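/- arXiv:2103.16208 — 2 statements merged into one kernel-verified Lean document; each statement's English description precedes it below -/
import Mathlib

section
/- Let k < n be positive integers, K a field, 0 ≤ ℓ ≤ n, and v ≤ w in I_{k,n}. Suppose the restricted ideal G_{k,n,ℓ}|_w^v = ker(φ_ℓ)|_{T_w^v} is monomial-free and the initial ideal in_{w_ℓ}(I(X_w^v)) is generated by homogeneous polynomials of degree two. Then the three ideals in_{w_ℓ}(I(X_w^v)), G_{k,n,ℓ}|_w^v, and ker(φ_ℓ|_w^v) of K[P_I : I ∈ T_w^v] are all equal; in particular, in_{w_ℓ}(I(X_w^v)) is the kernel of a monomial map, hence a toric ideal. -/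
open MvPolynomial

/-- `IsIdx n k J` : `J` is a strictly increasing `k`-tuple with entries in `{1, …, n}`,
representing an element `{J 0 < J 1 < … < J (k-1)}` of `I_{k,n}`. -/
def IsIdx (n k : ℕ) (J : Fin k → ℕ) : Prop :=
  StrictMono J ∧ ∀ s, 1 ≤ J s ∧ J s ≤ n

/-- Componentwise (Bruhat) order on sorted tuples. -/
def TupLe {k : ℕ} (I J : Fin k → ℕ) : Prop := ∀ s, I s ≤ J s

/-- Index type of the Plücker variables `P_I`, `I ∈ I_{k,n}`. -/
def PlVar (n k : ℕ) : Type := {J : Fin k → ℕ // IsIdx n k J}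

/-- The number of entries of `J` lying in `{1, …, ℓ}`. -/
def nSmall {k : ℕ} (ℓ : ℕ) (J : Fin k → ℕ) : ℕ :=
  (Finset.univ.filter fun s => J s ≤ ℓ).card

/-- Row assignment of the block diagonal matching field `B_ℓ` : the entry of `J` in sorted
position `i` (0-indexed) is placed in this (1-indexed) row. -/
def mfRow {k : ℕ} (ℓ : ℕ) (J : Fin k → ℕ) (i : Fin k) : ℕ :=
  if 2 ≤ k ∧ nSmall ℓ J = 1 then
    (if (i : ℕ) = 0 then 2 else if (i : ℕ) = 1 then 1 else (i : ℕ) + 1)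
  else (i : ℕ) + 1

/-- The monomial map `φ_ℓ` of the block diagonal matching field `B_ℓ`. -/
noncomputable def phiMF (K : Type*) [Field K] (n k ℓ : ℕ) :
    MvPolynomial (PlVar n k) K →ₐ[K] MvPolynomial (ℕ × ℕ) K :=
  aeval fun J => ∏ i : Fin k, X (mfRow ℓ J.val i, J.val i)

/-- The Plücker map, sending `P_J` to the `k × k` minor on columns `J`
of the generic matrix `(x_{i,j})`. -/
noncomputable def pluMap (K : Type*) [Field K] (n k : ℕ) :
    MvPolynomial (PlVar n k) K →ₐ[K] MvPolynomial (ℕ × ℕ) K :=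
  aeval fun J =>
    (Matrix.of fun r c : Fin k => (X ((r : ℕ) + 1, J.val c) : MvPolynomial (ℕ × ℕ) K)).det

/-- Restriction `G|_T = (G + ⟨P_I : I ∉ T⟩) ∩ K[P_I : I ∈ T]` of an ideal to the
variables indexed by `T`. -/
noncomputable def restrictIdeal {K : Type*} [Field K] {n k : ℕ}
    (G : Ideal (MvPolynomial (PlVar n k) K)) (T : Set (PlVar n k)) :
    Ideal (MvPolynomial T K) :=
  Ideal.comap (rename fun x : T => (x : PlVar n k))
    (G ⊔ Ideal.span (X '' {J | J ∉ T}))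

/-- An ideal of a polynomial ring is monomial-free if it contains no monomial. -/
def MonomialFree {K : Type*} [Field K] {σ : Type*} (I : Ideal (MvPolynomial σ K)) : Prop :=
  ∀ m : σ →₀ ℕ, (monomial m (1 : K)) ∉ I

/-- `T_w^v = {I ∈ I_{k,n} : v ≤ I ≤ w}`. -/
def TWV {n k : ℕ} (v w : PlVar n k) : Set (PlVar n k) :=
  {J | TupLe v.val J.val ∧ TupLe J.val w.val}

/-- `{I ∈ I_{k,n} : I ≤ w}`. -/
def TleW {n k : ℕ} (w : PlVar n k) : Set (PlVar n k) := {J | TupLe J.val w.val}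

/-- `{I ∈ I_{k,n} : v ≤ I}`. -/
def TgeV {n k : ℕ} (v : PlVar n k) : Set (PlVar n k) := {J | TupLe v.val J.val}

/-- The weight matrix `M_ℓ` (rows and columns 1-indexed). -/
def Mmat (n ℓ : ℕ) (i j : ℕ) : ℤ :=
  if i = 2 then (if j ≤ ℓ then (ℓ : ℤ) - j + 1 else (n : ℤ) - j + ℓ + 1)
  else ((i : ℤ) - 1) * ((n : ℤ) - j + 1)

/-- The weight `w_ℓ(P_J)` induced by `M_ℓ` on the Plücker variable `P_J`. -/
def wVec (n ℓ : ℕ) {k : ℕ} (J : Fin k → ℕ) : ℤ :=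
  ∑ i : Fin k, Mmat n ℓ (mfRow ℓ J i) (J i)

/-- Weight of an exponent vector with respect to a weight vector `u`. -/
def expWt {σ : Type*} (u : σ → ℤ) (m : σ →₀ ℕ) : ℤ := m.sum fun i e => u i * (e : ℤ)

/-- Initial form of a polynomial: the sum of its terms of minimal `u`-weight. -/
noncomputable def initialForm {K σ : Type*} [Field K] (u : σ → ℤ) (f : MvPolynomial σ K) :
    MvPolynomial σ K :=
  ∑ m ∈ f.support.filter (fun m => ∀ m' ∈ f.support, expWt u m ≤ expWt u m'),
    monomial m (coeff m f)

/-- Initial ideal with respect to the weight vector `u`. -/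
noncomputable def initialIdeal {K σ : Type*} [Field K] (u : σ → ℤ)
    (I : Ideal (MvPolynomial σ K)) : Ideal (MvPolynomial σ K) :=
  Ideal.span {g | ∃ f ∈ I, g = initialForm u f}

/-- `w_0 I = {n + 1 - i : i ∈ I}`, as a sorted tuple. -/
def w0t (n : ℕ) {k : ℕ} (I : Fin k → ℕ) : Fin k → ℕ :=
  fun s => n + 1 - I ⟨k - 1 - (s : ℕ), by have := s.isLt; omega⟩

/-- Membership in `Z_{k,n}` : either `J = {1, …, k-1, i}` with `k ≤ i ≤ n`,
or `J = {1, …, k+1} \\ {i}` with `1 ≤ i ≤ k-1`. -/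
def ZPred (n k : ℕ) (J : Fin k → ℕ) : Prop :=
  (∃ i, k ≤ i ∧ i ≤ n ∧
    ∀ s : Fin k, J s = if (s : ℕ) + 1 < k then (s : ℕ) + 1 else i) ∨
  (∃ i, 1 ≤ i ∧ i ≤ k - 1 ∧
    ∀ s : Fin k, J s = if (s : ℕ) + 1 < i then (s : ℕ) + 1 else (s : ℕ) + 2)

/-- A two-column semi-standard Young tableau with columns `I`, `J`. -/
def SSYT (n k : ℕ) (I J : Fin k → ℕ) : Prop :=
  IsIdx n k I ∧ IsIdx n k J ∧ ∀ s, I s ≤ J s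

/-- The map `Γ_ℓ` on two-column semi-standard Young tableaux (columns as sorted tuples). -/
def Gamma (ℓ : ℕ) {k : ℕ} (I J : Fin k → ℕ) : (Fin k → ℕ) × (Fin k → ℕ) :=
  if h : 2 ≤ k then
    let i0 := I ⟨0, by omega⟩
    let i1 := I ⟨1, by omega⟩
    let j0 := J ⟨0, by omega⟩
    let j1 := J ⟨1, by omega⟩
    if (i0 ≤ ℓ ∧ i1 ≤ ℓ ∧ j0 ≤ ℓ ∧ ℓ < j1 ∧ i0 < j0 ∧ j0 < i1) ∨
       (i0 ≤ ℓ ∧ ℓ < i1 ∧ ℓ < j0 ∧ ℓ < j1 ∧ j0 < i1 ∧ i1 < j1) then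
      ((fun s => if (s : ℕ) = 0 then j0 else I s), (fun s => if (s : ℕ) = 0 then i0 else J s))
    else (I, J)
  else (I, J)

/-- A column (a `k`-subset given as a sorted tuple) displayed in `B_ℓ`-order:
when `k ≥ 2` and exactly one entry is `≤ ℓ`, the two smallest entries are swapped. -/
def rowArrange (ℓ : ℕ) {k : ℕ} (C : Fin k → ℕ) : Fin k → ℕ :=
  if h : 2 ≤ k then
    (if nSmall ℓ C = 1 then
      fun s => if (s : ℕ) = 0 then C ⟨1, by omega⟩
        else if (s : ℕ) = 1 then C ⟨0, by omega⟩ else C s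
    else C)
  else C

/-- Two two-column tableaux (with columns `A,B` resp. `C,D`) are row-wise equal. -/
def rowEq {k : ℕ} (A B C D : Fin k → ℕ) : Prop :=
  ∀ s, ({A s, B s} : Multiset ℕ) = {C s, D s}

/-- The kernel of the restricted monomial map `φ_ℓ|_T`. -/
noncomputable def kerPhiRes (K : Type*) [Field K] (n k ℓ : ℕ) (T : Set (PlVar n k)) :
    Ideal (MvPolynomial T K) :=
  RingHom.ker ((phiMF K n k ℓ).comp (rename fun x : T => (x : PlVar n k)))

/-- The ideal `I(X_w^v)` of the Richardson variety: the restriction of the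
Plücker ideal `G_{k,n}` to the variables in `T_w^v`. -/
noncomputable def richIdeal (K : Type*) [Field K] (n k : ℕ) (v w : PlVar n k) :
    Ideal (MvPolynomial (TWV v w) K) :=
  restrictIdeal (RingHom.ker (pluMap K n k)) (TWV v w)

/-! ### Weights and leading monomials -/

lemma expWt_zero' {σ : Type*} (u : σ → ℤ) : expWt u 0 = 0 := by
  simp [expWt]

lemma expWt_add' {σ : Type*} (u : σ → ℤ) (a b : σ →₀ ℕ) :
    expWt u (a + b) = expWt u a + expWt u b := by
  classical
  unfold expWt
  rw [Finsupp.sum_add_index'] <;> intros <;> simp [mul_add]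

lemma expWt_single' {σ : Type*} (u : σ → ℤ) (a : σ) (e : ℕ) :
    expWt u (Finsupp.single a e) = u a * e := by
  simp [expWt]

lemma expWt_nsmul' {σ : Type*} (u : σ → ℤ) (e : ℕ) (a : σ →₀ ℕ) :
    expWt u (e • a) = e * expWt u a := by
  induction e with
  | zero => simp [expWt_zero']
  | succ e ih => rw [add_smul, expWt_add', ih, one_smul]; push_cast; ring

lemma expWt_sum' {σ ι : Type*} (u : σ → ℤ) (s : Finset ι) (a : ι → σ →₀ ℕ) :
    expWt u (∑ i ∈ s, a i) = ∑ i ∈ s, expWt u (a i) := by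
  classical
  induction s using Finset.induction_on with
  | empty => simp [expWt_zero']
  | insert i s hi ih => rw [Finset.sum_insert hi, Finset.sum_insert hi, expWt_add', ih]

/-- `p` has the unique term of minimal `u`-weight `ε X^α`. -/
def IsInit {K σ : Type*} [Field K] (u : σ → ℤ) (p : MvPolynomial σ K) (α : σ →₀ ℕ) (ε : K) :
    Prop :=
  coeff α p = ε ∧ ∀ β, coeff β p ≠ 0 → β ≠ α → expWt u α < expWt u β

lemma IsInit.le {K σ : Type*} [Field K] {u : σ → ℤ} {p : MvPolynomial σ K} {α : σ →₀ ℕ} {ε : K}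
    (h : IsInit u p α ε) (β : σ →₀ ℕ) (hβ : coeff β p ≠ 0) : expWt u α ≤ expWt u β := by
  by_cases e : β = α
  · rw [e]
  · exact (h.2 β hβ e).le

lemma IsInit.eq_of_le {K σ : Type*} [Field K] {u : σ → ℤ} {p : MvPolynomial σ K} {α : σ →₀ ℕ}
    {ε : K} (h : IsInit u p α ε) (β : σ →₀ ℕ) (hβ : coeff β p ≠ 0)
    (hle : expWt u β ≤ expWt u α) : β = α := by
  by_contra e
  exact absurd (h.2 β hβ e) (not_lt.mpr hle)

lemma IsInit.one {K σ : Type*} [Field K] (u : σ → ℤ) :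
    IsInit u (1 : MvPolynomial σ K) 0 1 := by
  classical
  refine ⟨by simp, fun β hβ h => ?_⟩
  rw [coeff_one] at hβ
  simp [Ne.symm h] at hβ

lemma IsInit.mul {K σ : Type*} [Field K] {u : σ → ℤ} {p q : MvPolynomial σ K} {α β : σ →₀ ℕ}
    {ε δ : K} (hp : IsInit u p α ε) (hq : IsInit u q β δ) :
    IsInit u (p * q) (α + β) (ε * δ) := by
  classical
  constructor
  · rw [coeff_mul, Finset.sum_eq_single (α, β)]
    · rw [hp.1, hq.1]
    · rintro ⟨x, y⟩ hxy hne
      by_contra h0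
      have hx : coeff x p ≠ 0 := left_ne_zero_of_mul h0
      have hy : coeff y q ≠ 0 := right_ne_zero_of_mul h0
      have hs : x + y = α + β := by simpa using hxy
      have hw := congrArg (expWt u) hs
      rw [expWt_add', expWt_add'] at hw
      have h1 := hp.le x hx
      have h2 := hq.le y hy
      have e1 := hp.eq_of_le x hx (by omega)
      have e2 := hq.eq_of_le y hy (by omega)
      exact hne (by rw [e1, e2])
    · intro h; simp at h
  · intro γ hγ hne
    rw [coeff_mul] at hγ
    obtain ⟨⟨x, y⟩, hxy, h0⟩ := Finset.exists_ne_zero_of_sum_ne_zero hγ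
    have hx : coeff x p ≠ 0 := left_ne_zero_of_mul h0
    have hy : coeff y q ≠ 0 := right_ne_zero_of_mul h0
    have hs : x + y = γ := by simpa using hxy
    have h1 := hp.le x hx
    have h2 := hq.le y hy
    rw [← hs, expWt_add', expWt_add']
    by_contra hlt
    have e1 := hp.eq_of_le x hx (by omega)
    have e2 := hq.eq_of_le y hy (by omega)
    exact hne (by rw [← hs, e1, e2])

lemma IsInit.pow {K σ : Type*} [Field K] {u : σ → ℤ} {p : MvPolynomial σ K} {α : σ →₀ ℕ}
    {ε : K} (hp : IsInit u p α ε) (e : ℕ) : IsInit u (p ^ e) (e • α) (ε ^ e) := by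
  induction e with
  | zero => simpa using IsInit.one u
  | succ e ih => rw [pow_succ, pow_succ, add_smul, one_smul]; exact ih.mul hp

lemma isInit_monomial {K σ τ : Type*} [Field K] (u : σ → ℤ)
    (Ψ : MvPolynomial τ K →ₐ[K] MvPolynomial σ K) (a : τ → σ →₀ ℕ) (ε : τ → K)
    (h : ∀ J, IsInit u (Ψ (X J)) (a J) (ε J)) (m : τ →₀ ℕ) :
    IsInit u (Ψ (monomial m 1)) (m.sum fun J e => e • a J) (m.prod fun J e => ε J ^ e) := by
  classical
  induction m using Finsupp.induction_linear with
  | zero =>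
    have : (monomial (0 : τ →₀ ℕ) (1 : K)) = 1 := rfl
    simpa [this] using IsInit.one u
  | add f g hf hg =>
    have : (monomial (f + g) (1 : K)) = monomial f 1 * monomial g 1 := by simp
    rw [this, map_mul, Finsupp.sum_add_index', Finsupp.prod_add_index']
    · exact hf.mul hg
    · simp
    · intros; rw [pow_add]
    · simp
    · intros; rw [add_smul]
  | single J e =>
    have : (monomial (Finsupp.single J e) (1 : K)) = X J ^ e := by
      rw [X_pow_eq_monomial]
    rw [this, map_pow]
    simpa using (h J).pow e

lemma coeff_comb {K σ ι : Type*} [Field K] {u : σ → ℤ} {p : ι → MvPolynomial σ K}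
    {α : ι → σ →₀ ℕ} {ε : ι → K} (hI : ∀ s, IsInit u (p s) (α s) (ε s))
    (hinj : Function.Injective α) (c : ι →₀ K) (s : ι)
    (hs : ∀ s' ∈ c.support, expWt u (α s) ≤ expWt u (α s')) :
    coeff (α s) (c.sum fun s' r => r • p s') = c s * ε s := by
  classical
  rw [Finsupp.sum, coeff_sum, Finset.sum_eq_single s]
  · rw [coeff_smul, (hI s).1, smul_eq_mul]
  · intro t ht hts
    by_contra h0
    rw [coeff_smul, smul_eq_mul] at h0
    have h1 : coeff (α s) (p t) ≠ 0 := right_ne_zero_of_mul h0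
    exact hts (hinj ((hI t).eq_of_le _ h1 (hs t ht))).symm
  · intro hns
    rw [Finsupp.notMem_support_iff.mp hns]; simp

/-- Combinations of polynomials with distinct leading monomials vanish only trivially. -/
lemma comb_eq_zero {K σ ι : Type*} [Field K] {u : σ → ℤ} {p : ι → MvPolynomial σ K}
    {α : ι → σ →₀ ℕ} {ε : ι → K} (hI : ∀ s, IsInit u (p s) (α s) (ε s)) (hε : ∀ s, ε s ≠ 0)
    (hinj : Function.Injective α) (c : ι →₀ K) (h0 : (c.sum fun s' r => r • p s') = 0) :
    c = 0 := by
  by_contra hc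
  obtain ⟨s, hs, hmin⟩ := Finset.exists_min_image c.support (fun s => expWt u (α s))
    (Finsupp.support_nonempty_iff.mpr hc)
  have := coeff_comb hI hinj c s hmin
  rw [h0, coeff_zero] at this
  exact mul_ne_zero (Finsupp.mem_support_iff.mp hs) (hε s) this.symm

lemma comb_init {K σ ι : Type*} [Field K] {u : σ → ℤ} {p : ι → MvPolynomial σ K}
    {α : ι → σ →₀ ℕ} {ε : ι → K} (hI : ∀ s, IsInit u (p s) (α s) (ε s)) (hε : ∀ s, ε s ≠ 0)
    (hinj : Function.Injective α) (c : ι →₀ K) (F : MvPolynomial σ K)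
    (hF : F = c.sum fun s' r => r • p s') (α0 : σ →₀ ℕ) (ε0 : K) (hε0 : ε0 ≠ 0)
    (hF0 : IsInit u F α0 ε0) :
    (∀ s ∈ c.support, expWt u α0 ≤ expWt u (α s)) ∧
    (∀ s ∈ c.support, expWt u (α s) = expWt u α0 → α s = α0) ∧
    (∃ s ∈ c.support, α s = α0) ∧
    (∀ s, α s = α0 → c s * ε s = ε0) := by
  have hmem : ∀ s ∈ c.support, (∀ s' ∈ c.support, expWt u (α s) ≤ expWt u (α s')) →
      coeff (α s) F ≠ 0 := by
    intro s hs hmin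
    rw [hF, coeff_comb hI hinj c s hmin]
    exact mul_ne_zero (Finsupp.mem_support_iff.mp hs) (hε s)
  have hle : ∀ s ∈ c.support, expWt u α0 ≤ expWt u (α s) := by
    intro t ht
    obtain ⟨s, hs, hmin⟩ := Finset.exists_min_image c.support (fun s => expWt u (α s)) ⟨t, ht⟩
    exact (hF0.le _ (hmem s hs hmin)).trans (hmin t ht)
  have heq : ∀ s ∈ c.support, expWt u (α s) ≤ expWt u α0 → α s = α0 := by
    intro s hs h
    exact hF0.eq_of_le _ (hmem s hs fun s' hs' => h.trans (hle s' hs')) h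
  refine ⟨hle, fun s hs h => heq s hs h.le, ?_, ?_⟩
  · by_contra hno
    push Not at hno
    have : coeff α0 F = 0 := by
      rw [hF, Finsupp.sum, coeff_sum]
      refine Finset.sum_eq_zero fun s hs => ?_
      rw [coeff_smul]
      by_contra h0
      have h1 : coeff α0 (p s) ≠ 0 := right_ne_zero_of_mul h0
      exact hno s hs (heq s hs ((hI s).le _ h1))
    exact hε0 (hF0.1.symm.trans this)
  · intro s hs
    have := coeff_comb hI hinj c s (fun s' hs' => by rw [hs]; exact hle s' hs')
    rw [← this, ← hF, hs, hF0.1]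

lemma mem_initialIdeal {K σ : Type*} [Field K] (u : σ → ℤ) (I : Ideal (MvPolynomial σ K))
    (f g : MvPolynomial σ K) (hf : f ∈ I) (ω : ℤ) (h1 : ∀ m, coeff m f ≠ 0 → ω ≤ expWt u m)
    (h2 : ∀ m, expWt u m = ω → coeff m g = coeff m f)
    (h3 : ∀ m, expWt u m ≠ ω → coeff m g = 0) :
    g ∈ initialIdeal u I := by
  classical
  by_cases hg : g = 0
  · rw [hg]; exact zero_mem _
  obtain ⟨m0, hm0⟩ := MvPolynomial.ne_zero_iff.mp hg
  have hw0 : expWt u m0 = ω := by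
    by_contra h; exact hm0 (h3 m0 h)
  have hf0 : coeff m0 f ≠ 0 := by rwa [← h2 m0 hw0]
  refine Ideal.subset_span ⟨f, hf, ?_⟩
  ext m
  rw [initialForm, coeff_sum]
  simp only [coeff_monomial]
  rw [Finset.sum_ite_eq']
  by_cases hw : expWt u m = ω
  · rw [h2 m hw]
    split_ifs with h
    · rfl
    · by_contra hne
      apply h
      simp only [Finset.mem_filter, mem_support_iff]
      exact ⟨hne, fun m' hm' => hw ▸ h1 m' hm'⟩
  · rw [h3 m hw, if_neg]
    simp only [Finset.mem_filter, mem_support_iff, not_and]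
    intro hm h
    have := h m0 hf0
    have := h1 m hm
    omega

/-! ### The leading term of a minor -/

/-- `J` has exactly one entry in `{1, …, ℓ}`. -/
def Typ1 {k : ℕ} (ℓ : ℕ) (J : Fin k → ℕ) : Prop :=
  ∃ h : 2 ≤ k, J ⟨0, by omega⟩ ≤ ℓ ∧ ℓ < J ⟨1, by omega⟩

lemma typ1_iff {k : ℕ} (ℓ : ℕ) (J : Fin k → ℕ) (hJ : StrictMono J) :
    (2 ≤ k ∧ nSmall ℓ J = 1) ↔ Typ1 ℓ J := by
  constructor
  · rintro ⟨hk, h⟩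
    refine ⟨hk, ?_⟩
    rw [nSmall, Finset.card_eq_one] at h
    obtain ⟨x, hx⟩ := h
    have hmem : ∀ s, J s ≤ ℓ ↔ s = x := by
      intro s
      have : s ∈ (Finset.univ.filter fun s => J s ≤ ℓ) ↔ s ∈ ({x} : Finset (Fin k)) := by rw [hx]
      simpa using this
    have h0 : J ⟨0, by omega⟩ ≤ ℓ :=
      (hJ.monotone (Fin.mk_le_of_le_val (Nat.zero_le _))).trans ((hmem x).2 rfl)
    refine ⟨h0, ?_⟩
    by_contra h1
    have e0 := (hmem _).1 h0
    have e1 := (hmem _).1 (not_lt.mp h1)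
    have := e0.trans e1.symm
    simp at this
  · rintro ⟨hk, h0, h1⟩
    refine ⟨hk, ?_⟩
    rw [nSmall, Finset.card_eq_one]
    refine ⟨⟨0, by omega⟩, ?_⟩
    ext s
    simp only [Finset.mem_filter, Finset.mem_univ, true_and, Finset.mem_singleton]
    constructor
    · intro hs
      by_contra hne
      have : (⟨1, by omega⟩ : Fin k) ≤ s := by
        rw [Fin.le_def]
        have : (s : ℕ) ≠ 0 := fun h => hne (Fin.ext h)
        show 1 ≤ (s : ℕ)
        omega
      have := hJ.monotone this
      omega
    · rintro rfl; exact h0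

open Classical in
/-- The permutation attached by `B_ℓ` to `J`. -/
noncomputable def rhoP {k : ℕ} (ℓ : ℕ) (J : Fin k → ℕ) : Equiv.Perm (Fin k) :=
  if h : Typ1 ℓ J then
    Equiv.swap ⟨0, by have := h.1; omega⟩ ⟨1, by have := h.1; omega⟩
  else 1

open Classical in
/-- The sign attached by `B_ℓ` to `J`. -/
noncomputable def sgnJ (K : Type*) [Field K] {k : ℕ} (ℓ : ℕ) (J : Fin k → ℕ) : K :=
  if Typ1 ℓ J then -1 else 1

lemma sgnJ_ne (K : Type*) [Field K] {k : ℕ} (ℓ : ℕ) (J : Fin k → ℕ) : sgnJ K ℓ J ≠ 0 := by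
  unfold sgnJ; split_ifs <;> simp

lemma sign_rhoP (K : Type*) [Field K] {k : ℕ} (ℓ : ℕ) (J : Fin k → ℕ) :
    (((Equiv.Perm.sign (rhoP ℓ J) : ℤˣ) : ℤ) : K) = sgnJ K ℓ J := by
  unfold rhoP sgnJ
  split_ifs with h
  · rw [Equiv.Perm.sign_swap (by simp)]; simp
  · simp

lemma rhoP_row {k : ℕ} (ℓ : ℕ) (J : Fin k → ℕ) (hJ : StrictMono J) (i : Fin k) :
    mfRow ℓ J i = (rhoP ℓ J i : ℕ) + 1 := by
  unfold mfRow rhoP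
  by_cases h : Typ1 ℓ J
  · rw [if_pos ((typ1_iff ℓ J hJ).2 h), dif_pos h]
    have hk := h.1
    by_cases h0 : (i : ℕ) = 0
    · have : i = ⟨0, by omega⟩ := Fin.ext h0
      rw [if_pos h0, this, Equiv.swap_apply_left]
    · by_cases h1 : (i : ℕ) = 1
      · have : i = ⟨1, by omega⟩ := Fin.ext h1
        rw [if_neg h0, if_pos h1, this, Equiv.swap_apply_right]
      · rw [Equiv.swap_apply_of_ne_of_ne]
        · simp [h0, h1]
        · exact fun h => h0 (congrArg Fin.val h)
        · exact fun h => h1 (congrArg Fin.val h)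
  · rw [if_neg (fun h' => h ((typ1_iff ℓ J hJ).1 h')), dif_neg h]; simp

/-- Weight of the term of the minor `J` attached to `σ`. -/
def permWt (n ℓ : ℕ) {k : ℕ} (J : Fin k → ℕ) (σ : Equiv.Perm (Fin k)) : ℤ :=
  ∑ c, Mmat n ℓ ((σ c : ℕ) + 1) (J c)

lemma permWt_swap (n ℓ : ℕ) {k : ℕ} (J : Fin k → ℕ) (σ : Equiv.Perm (Fin k)) (c c' : Fin k)
    (h : c ≠ c') :
    permWt n ℓ J (σ * Equiv.swap c c') - permWt n ℓ J σ =
      (Mmat n ℓ ((σ c' : ℕ) + 1) (J c) - Mmat n ℓ ((σ c : ℕ) + 1) (J c)) +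
      (Mmat n ℓ ((σ c : ℕ) + 1) (J c') - Mmat n ℓ ((σ c' : ℕ) + 1) (J c')) := by
  unfold permWt
  rw [← Finset.sum_sub_distrib, Fintype.sum_eq_add c c' h]
  · simp
  · rintro x ⟨h1, h2⟩
    simp [Equiv.swap_apply_of_ne_of_ne h1 h2]

lemma local_opt (n ℓ : ℕ) {k : ℕ} (J : Fin k → ℕ) (hJ : StrictMono J) (hJn : ∀ s, 1 ≤ J s ∧ J s ≤ n)
    (hℓ : ℓ ≤ n) (σ : Equiv.Perm (Fin k))
    (hσ : ∀ τ, permWt n ℓ J σ ≤ permWt n ℓ J τ) : σ = rhoP ℓ J := by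
  have key : ∀ c c' : Fin k, c < c' →
      Mmat n ℓ ((σ c : ℕ) + 1) (J c) + Mmat n ℓ ((σ c' : ℕ) + 1) (J c') ≤
      Mmat n ℓ ((σ c' : ℕ) + 1) (J c) + Mmat n ℓ ((σ c : ℕ) + 1) (J c') := by
    intro c c' h
    have h1 := permWt_swap n ℓ J σ c c' h.ne
    have h2 := hσ (σ * Equiv.swap c c')
    omega
  have hne : ∀ c c' : Fin k, c < c' → (σ c : ℕ) ≠ σ c' := fun c c' h e =>
    h.ne (σ.injective (Fin.ext e))
  -- rows `≥ 3` are filled increasingly by the largest entries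
  have factA : ∀ c c' : Fin k, c < c' → 2 ≤ (σ c : ℕ) → (σ c : ℕ) < σ c' := by
    intro c c' h h2
    have hk := key c c' h
    have hab := hJ h
    have hn := hne c c' h
    have hb := (hJn c').2
    have hb1 := (hJn c).1
    generalize hr : (σ c : ℕ) = r at *
    generalize hr' : (σ c' : ℕ) = r' at *
    generalize J c = a at *
    generalize J c' = b at *
    by_contra hlt
    have hlt' : r' < r := by omega
    unfold Mmat at hk
    rw [if_neg (by omega : ¬ r + 1 = 2), if_neg (by omega : ¬ r + 1 = 2)] at hk
    push_cast at hk
    have h3 : (a : ℤ) < b := by exact_mod_cast hab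
    have h4 : (b : ℤ) ≤ n := by exact_mod_cast hb
    have h5 : (r' : ℤ) < r := by exact_mod_cast hlt'
    have h6 : (2 : ℤ) ≤ r := by exact_mod_cast h2
    by_cases e1 : r' = 1
    · subst e1
      simp only [if_true] at hk
      split_ifs at hk <;> nlinarith
    · rw [if_neg (by omega), if_neg (by omega)] at hk
      nlinarith
  have hsm : StrictMono (fun c => rhoP ℓ J (σ c)) := by
    intro c c' h
    have hn := hne c c' h
    have hge : ∀ x : Fin k, 2 ≤ (x : ℕ) → rhoP ℓ J x = x := by
      intro x hx
      unfold rhoP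
      split_ifs with hT
      · apply Equiv.swap_apply_of_ne_of_ne
        · intro e; rw [e] at hx; simp at hx
        · intro e; rw [e] at hx; simp at hx
      · rfl
    have hlt : ∀ x : Fin k, (x : ℕ) < 2 → (rhoP ℓ J x : ℕ) < 2 := by
      intro x hx
      by_contra hc
      have := hge (rhoP ℓ J x) (by omega)
      have := (rhoP ℓ J).injective this
      rw [this] at hc; omega
    show rhoP ℓ J (σ c) < rhoP ℓ J (σ c')
    by_cases h1 : 2 ≤ (σ c : ℕ)
    · have := factA c c' h h1
      rw [hge _ h1, hge _ (by omega)]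
      exact this
    by_cases h2 : 2 ≤ (σ c' : ℕ)
    · rw [hge _ h2, Fin.lt_def]
      have := hlt (σ c) (by omega)
      omega
    -- now both are among the first two rows
    have hother : ∀ x : Fin k, x ≠ c → x ≠ c' → 2 ≤ (σ x : ℕ) := by
      intro x hx hx'
      have a1 : (σ x : ℕ) ≠ σ c := fun e => hx (σ.injective (Fin.ext e))
      have a2 : (σ x : ℕ) ≠ σ c' := fun e => hx' (σ.injective (Fin.ext e))
      omega
    have hcc : (c : ℕ) < c' := h
    have hk2 : 2 ≤ k := by have := c'.isLt; omega
    have hc0 : c = ⟨0, by omega⟩ := by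
      by_contra hc
      have hc1 : (0 : ℕ) < c := by
        have : (c : ℕ) ≠ 0 := fun e => hc (Fin.ext e)
        omega
      have := hother ⟨0, by omega⟩ (Ne.symm hc) (by intro e; rw [← e] at hcc; simp at hcc)
      have := factA ⟨0, by omega⟩ c hc1 this
      omega
    have hc1 : c' = ⟨1, by omega⟩ := by
      by_contra hc
      have hc2 : 1 < (c' : ℕ) := by
        have : (c' : ℕ) ≠ 1 := fun e => hc (Fin.ext e)
        omega
      have := hother ⟨1, by omega⟩ (by rw [hc0]; simp) (Ne.symm hc)
      have := factA ⟨1, by omega⟩ c' hc2 this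
      omega
    have hk := key c c' h
    have hab := hJ h
    have hb := (hJn c').2
    have hb1 := (hJn c).1
    by_cases h3 : (σ c : ℕ) = 0
    · have h4 : (σ c' : ℕ) = 1 := by omega
      have hnt : ¬ Typ1 ℓ J := by
        rintro ⟨_, t0, t1⟩
        rw [← hc0] at t0
        rw [← hc1] at t1
        rw [h3, h4] at hk
        simp only [Mmat] at hk
        norm_num at hk
        rw [if_neg (by omega), if_pos (by omega)] at hk
        omega
      have : rhoP ℓ J = 1 := dif_neg hnt
      rw [this]
      simp only [Equiv.Perm.coe_one, id_eq, Fin.lt_def]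
      omega
    · have h3 : (σ c : ℕ) = 1 := by omega
      have h4 : (σ c' : ℕ) = 0 := by omega
      have ht : Typ1 ℓ J := by
        refine ⟨hk2, ?_⟩
        rw [← hc0, ← hc1]
        rw [h3, h4] at hk
        simp only [Mmat] at hk
        norm_num at hk
        split_ifs at hk <;> omega
      have e1 : σ c = ⟨1, by omega⟩ := Fin.ext h3
      have e2 : σ c' = ⟨0, by omega⟩ := Fin.ext h4
      rw [rhoP, dif_pos ht, e1, e2, Equiv.swap_apply_left, Equiv.swap_apply_right]
      simp [Fin.lt_def]
  have hid : (fun c => rhoP ℓ J (σ c)) = id := by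
    refine StrictMono.range_inj hsm strictMono_id |>.1 ?_
    have : Function.Surjective (fun c => rhoP ℓ J (σ c)) :=
      (rhoP ℓ J).surjective.comp σ.surjective
    rw [this.range_eq, Function.surjective_id.range_eq]
  have hinv : rhoP ℓ J * rhoP ℓ J = 1 := by
    unfold rhoP
    split_ifs
    · exact Equiv.swap_mul_self _ _
    · rfl
  have h1 : rhoP ℓ J * σ = 1 := Equiv.ext fun c => congrFun hid c
  calc σ = (rhoP ℓ J * rhoP ℓ J) * σ := by rw [hinv, one_mul]
    _ = rhoP ℓ J := by rw [mul_assoc, h1, mul_one]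

lemma permWt_lt (n ℓ : ℕ) {k : ℕ} (J : Fin k → ℕ) (hJ : StrictMono J) (hJn : ∀ s, 1 ≤ J s ∧ J s ≤ n)
    (hℓ : ℓ ≤ n) (σ : Equiv.Perm (Fin k)) (hne : σ ≠ rhoP ℓ J) :
    permWt n ℓ J (rhoP ℓ J) < permWt n ℓ J σ := by
  obtain ⟨τ, hτ⟩ := Finite.exists_min (permWt n ℓ J)
  have e := local_opt n ℓ J hJ hJn hℓ τ hτ
  by_contra h
  exact hne (local_opt n ℓ J hJ hJn hℓ σ fun τ' =>
    (not_lt.mp h).trans (by rw [← e]; exact hτ τ'))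

/-- Exponent of the term of the minor `J` attached to `σ`. -/
noncomputable def permExp {k : ℕ} (J : Fin k → ℕ) (σ : Equiv.Perm (Fin k)) : ℕ × ℕ →₀ ℕ :=
  ∑ c, Finsupp.single ((σ c : ℕ) + 1, J c) 1

lemma permExp_inj {k : ℕ} (J : Fin k → ℕ) (hJ : StrictMono J) :
    Function.Injective (permExp J) := by
  intro σ τ h
  ext c
  have h1 := DFunLike.congr_fun h ((σ c : ℕ) + 1, J c)
  by_contra hne
  have h2 : permExp J τ ((σ c : ℕ) + 1, J c) = 0 := by
    unfold permExp
    rw [Finsupp.finsetSum_apply]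
    refine Finset.sum_eq_zero fun d _ => ?_
    rw [Finsupp.single_apply, if_neg]
    intro e
    have e2 := hJ.injective (Prod.mk.inj e).2
    have e1 := (Prod.mk.inj e).1
    rw [e2] at e1
    exact hne (by omega)
  have h3 : permExp J σ ((σ c : ℕ) + 1, J c) ≠ 0 := by
    unfold permExp
    rw [Finsupp.finsetSum_apply]
    intro h0
    have := (Finset.sum_eq_zero_iff.mp h0) c (Finset.mem_univ c)
    simp at this
  exact h3 (h1.trans h2)

/-- The minor on columns `c`. -/
noncomputable def minorP (K : Type*) [Field K] {k : ℕ} (J : Fin k → ℕ) :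
    MvPolynomial (ℕ × ℕ) K :=
  (Matrix.of fun r c : Fin k => (X ((r : ℕ) + 1, J c) : MvPolynomial (ℕ × ℕ) K)).det

lemma minorP_eq (K : Type*) [Field K] {k : ℕ} (J : Fin k → ℕ) :
    minorP K J = ∑ σ : Equiv.Perm (Fin k),
      monomial (permExp J σ) (((Equiv.Perm.sign σ : ℤˣ) : ℤ) : K) := by
  unfold minorP
  rw [Matrix.det_apply]
  refine Finset.sum_congr rfl fun σ _ => ?_
  have : (∏ c, (Matrix.of fun r c : Fin k =>
      (X ((r : ℕ) + 1, J c) : MvPolynomial (ℕ × ℕ) K)) (σ c) c) =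
      monomial (permExp J σ) (1 : K) := by
    unfold permExp
    rw [monomial_sum_one]
    rfl
  rw [this]
  rcases Int.units_eq_one_or (Equiv.Perm.sign σ) with h | h <;> simp [h]

lemma coeff_minorP (K : Type*) [Field K] {k : ℕ} (J : Fin k → ℕ) (β : ℕ × ℕ →₀ ℕ)
    (h : coeff β (minorP K J) ≠ 0) : ∃ σ, β = permExp J σ := by
  classical
  by_contra hno
  push Not at hno
  apply h
  rw [minorP_eq, coeff_sum]
  refine Finset.sum_eq_zero fun σ _ => ?_
  rw [coeff_monomial, if_neg (Ne.symm (hno σ))]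

/-- Exponent of `φ_ℓ (P_J)`. -/
noncomputable def eJ {n k : ℕ} (ℓ : ℕ) (J : PlVar n k) : ℕ × ℕ →₀ ℕ :=
  ∑ i, Finsupp.single (mfRow ℓ J.val i, J.val i) 1

lemma eJ_eq {n k : ℕ} (ℓ : ℕ) (J : PlVar n k) : eJ ℓ J = permExp J.val (rhoP ℓ J.val) := by
  unfold eJ permExp
  exact Finset.sum_congr rfl fun i _ => by rw [rhoP_row ℓ J.val J.2.1]

lemma expWt_permExp (n ℓ : ℕ) {k : ℕ} (J : Fin k → ℕ) (σ : Equiv.Perm (Fin k)) :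
    expWt (fun p : ℕ × ℕ => Mmat n ℓ p.1 p.2) (permExp J σ) = permWt n ℓ J σ := by
  unfold permExp permWt
  rw [expWt_sum']
  exact Finset.sum_congr rfl fun c _ => by rw [expWt_single']; simp

lemma pluMap_X (K : Type*) [Field K] {n k : ℕ} (J : PlVar n k) :
    pluMap K n k (X J) = minorP K J.val := by
  simp [pluMap, minorP]

lemma minor_isInit (K : Type*) [Field K] {n k : ℕ} (ℓ : ℕ) (hℓ : ℓ ≤ n) (J : PlVar n k) :
    IsInit (fun p : ℕ × ℕ => Mmat n ℓ p.1 p.2) (pluMap K n k (X J)) (eJ ℓ J)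
      (sgnJ K ℓ J.val) := by
  classical
  rw [pluMap_X, eJ_eq]
  constructor
  · rw [minorP_eq, coeff_sum, Finset.sum_eq_single (rhoP ℓ J.val)]
    · rw [coeff_monomial, if_pos rfl, sign_rhoP]
    · intro σ _ hσ
      rw [coeff_monomial, if_neg (fun e => hσ (permExp_inj J.val J.2.1 e))]
    · simp
  · intro β hβ hne
    obtain ⟨σ, rfl⟩ := coeff_minorP K J.val β hβ
    rw [expWt_permExp, expWt_permExp]
    exact permWt_lt n ℓ J.val J.2.1 J.2.2 hℓ σ (fun e => hne (by rw [e]))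

/-! ### Counting in non-crossing configurations -/

open Classical in
/-- Number (with multiplicity `m`) of elements satisfying `P`. -/
noncomputable def cnt {τ : Type*} [Fintype τ] (m : τ → ℕ) (P : τ → Prop) : ℕ :=
  ∑ J, if P J then m J else 0

lemma cnt_congr {τ : Type*} [Fintype τ] (m : τ → ℕ) {P Q : τ → Prop} (h : ∀ J, P J ↔ Q J) :
    cnt m P = cnt m Q := by
  have : P = Q := funext fun J => propext (h J)
  rw [this]

lemma cnt_add {τ : Type*} [Fintype τ] (m : τ → ℕ) {P Q R : τ → Prop}
    (h : ∀ J, P J ↔ (Q J ∨ R J)) (h' : ∀ J, ¬ (Q J ∧ R J)) :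
    cnt m P = cnt m Q + cnt m R := by
  classical
  unfold cnt
  rw [← Finset.sum_add_distrib]
  refine Finset.sum_congr rfl fun J _ => ?_
  have h1 := h J
  have h2 := h' J
  by_cases hq : Q J <;> by_cases hr : R J <;> simp_all

lemma cnt_eq_zero {τ : Type*} [Fintype τ] (m : τ → ℕ) {P : τ → Prop}
    (h : ∀ J, m J ≠ 0 → ¬ P J) : cnt m P = 0 := by
  classical
  unfold cnt
  refine Finset.sum_eq_zero fun J _ => ?_
  by_cases hm : m J = 0
  · simp [hm]
  · simp [h J hm]

lemma exists_of_cnt {τ : Type*} [Fintype τ] (m : τ → ℕ) {P : τ → Prop}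
    (h : cnt m P ≠ 0) : ∃ J, m J ≠ 0 ∧ P J := by
  by_contra hno
  push Not at hno
  exact h (cnt_eq_zero m hno)

lemma sum_cnt {τ : Type*} [Fintype τ] (m : τ → ℕ) (P : τ → Prop) (g : τ → ℕ)
    (s : Finset ℕ) :
    ∑ j ∈ s, cnt m (fun J => P J ∧ g J = j) = cnt m (fun J => P J ∧ g J ∈ s) := by
  classical
  unfold cnt
  rw [Finset.sum_comm]
  refine Finset.sum_congr rfl fun J _ => ?_
  by_cases hP : P J
  · simp [hP]
  · simp [hP]

section core

variable {τ : Type*} [Fintype τ] (x y : τ → ℕ) (ℓ : ℕ)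

/-- Content of the first row of the matching field tableau. -/
noncomputable def row1 (m : τ → ℕ) (t : ℕ) : ℕ :=
  cnt m (fun J => (x J ≤ ℓ ∧ ℓ < y J ∧ y J = t) ∨ (¬ (x J ≤ ℓ ∧ ℓ < y J) ∧ x J = t))

/-- Content of the second row of the matching field tableau. -/
noncomputable def row2 (m : τ → ℕ) (t : ℕ) : ℕ :=
  cnt m (fun J => (x J ≤ ℓ ∧ ℓ < y J ∧ x J = t) ∨ (¬ (x J ≤ ℓ ∧ ℓ < y J) ∧ y J = t))

/-- No two columns in the support of `m` cross in their first two rows. -/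
def NCross (m : τ → ℕ) : Prop :=
  ∀ I J, m I ≠ 0 → m J ≠ 0 → ¬ (x I < x J ∧ x J < y I ∧ y I < y J)

lemma row1_low (hxy : ∀ J, x J < y J) (m : τ → ℕ) {t : ℕ} (ht : t ≤ ℓ) :
    row1 x y ℓ m t = cnt m (fun J => y J ≤ ℓ ∧ x J = t) :=
  cnt_congr m fun J => by have := hxy J; omega

lemma row2_low (hxy : ∀ J, x J < y J) (m : τ → ℕ) {t : ℕ} (ht : t ≤ ℓ) :
    row2 x y ℓ m t = cnt m (fun J => True ∧ y J = t) + cnt m (fun J => ℓ < y J ∧ x J = t) :=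
  cnt_add m (fun J => by have := hxy J; simp only [true_and]; omega)
    (fun J => by have := hxy J; simp only [true_and]; omega)

lemma row1_high (hxy : ∀ J, x J < y J) (m : τ → ℕ) {t : ℕ} (ht : ℓ < t) :
    row1 x y ℓ m t = cnt m (fun J => True ∧ x J = t) + cnt m (fun J => x J ≤ ℓ ∧ y J = t) :=
  cnt_add m (fun J => by have := hxy J; simp only [true_and]; omega)
    (fun J => by have := hxy J; simp only [true_and]; omega)

lemma row2_high (hxy : ∀ J, x J < y J) (m : τ → ℕ) {t : ℕ} (ht : ℓ < t) :
    row2 x y ℓ m t = cnt m (fun J => ℓ < x J ∧ y J = t) :=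
  cnt_congr m fun J => by have := hxy J; omega

lemma typ_count (hxy : ∀ J, x J < y J) (m m' : τ → ℕ) (h1 : ∀ t, row1 x y ℓ m t = row1 x y ℓ m' t)
    (h2 : ∀ t, row2 x y ℓ m t = row2 x y ℓ m' t) :
    cnt m (fun J => x J ≤ ℓ ∧ ℓ < y J) = cnt m' (fun J => x J ≤ ℓ ∧ ℓ < y J) := by
  have key : ∀ m : τ → ℕ, ∑ t ∈ Finset.range (ℓ + 1), row2 x y ℓ m t =
      ∑ t ∈ Finset.range (ℓ + 1), row1 x y ℓ m t + cnt m (fun J => x J ≤ ℓ ∧ ℓ < y J) := by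
    intro m
    have e2 : ∑ t ∈ Finset.range (ℓ + 1), row2 x y ℓ m t = ∑ t ∈ Finset.range (ℓ + 1),
        (cnt m (fun J => True ∧ y J = t) + cnt m (fun J => ℓ < y J ∧ x J = t)) :=
      Finset.sum_congr rfl fun t ht =>
        row2_low x y ℓ hxy m (by have := Finset.mem_range.1 ht; omega)
    have e1 : ∑ t ∈ Finset.range (ℓ + 1), row1 x y ℓ m t = ∑ t ∈ Finset.range (ℓ + 1),
        cnt m (fun J => y J ≤ ℓ ∧ x J = t) :=
      Finset.sum_congr rfl fun t ht =>
        row1_low x y ℓ hxy m (by have := Finset.mem_range.1 ht; omega)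
    rw [e1, e2, Finset.sum_add_distrib, sum_cnt, sum_cnt, sum_cnt]
    congr 1
    · exact cnt_congr m fun J => by have := hxy J; simp only [Finset.mem_range, true_and]; omega
    · exact cnt_congr m fun J => by have := hxy J; simp only [Finset.mem_range, true_and]; omega
  have a := key m
  have b := key m'
  simp only [h1, h2] at a
  omega

lemma low_le (hxy : ∀ J, x J < y J) (m m' : τ → ℕ) (hm : NCross x y m)
    (h1 : ∀ t, row1 x y ℓ m t = row1 x y ℓ m' t)
    (h2 : ∀ t, row2 x y ℓ m t = row2 x y ℓ m' t) (t : ℕ) (ht : t ≤ ℓ)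
    (ih : ∀ j < t, cnt m (fun J => ℓ < y J ∧ x J = j) = cnt m' (fun J => ℓ < y J ∧ x J = j)) :
    cnt m (fun J => ℓ < y J ∧ x J = t) ≤ cnt m' (fun J => ℓ < y J ∧ x J = t) := by
  by_contra hlt
  push Not at hlt
  obtain ⟨I, hI, hyI, hxI⟩ := exists_of_cnt m (by omega : cnt m (fun J => ℓ < y J ∧ x J = t) ≠ 0)
  have split : ∀ m : τ → ℕ, cnt m (fun J => y J ≤ ℓ ∧ x J ∈ Finset.range t) =
      cnt m (fun J => x J < t ∧ t < y J ∧ y J ≤ ℓ) +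
      cnt m (fun J => True ∧ y J ∈ Finset.range (t + 1)) := fun m =>
    cnt_add m (fun J => by have := hxy J; simp only [Finset.mem_range, true_and]; omega)
      (fun J => by have := hxy J; simp only [Finset.mem_range, true_and]; omega)
  have z : cnt m (fun J => x J < t ∧ t < y J ∧ y J ≤ ℓ) = 0 := by
    refine cnt_eq_zero m fun J hJ hh => ?_
    exact hm J I hJ hI (by omega)
  have c1 : cnt m (fun J => y J ≤ ℓ ∧ x J ∈ Finset.range t) =
      cnt m' (fun J => y J ≤ ℓ ∧ x J ∈ Finset.range t) := by
    rw [← sum_cnt, ← sum_cnt]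
    refine Finset.sum_congr rfl fun j hj => ?_
    have hj' : j ≤ ℓ := by have := Finset.mem_range.1 hj; omega
    rw [← row1_low x y ℓ hxy m hj', ← row1_low x y ℓ hxy m' hj', h1]
  have c2 : ∑ j ∈ Finset.range (t + 1), (cnt m (fun J => True ∧ y J = j) +
        cnt m (fun J => ℓ < y J ∧ x J = j)) =
      ∑ j ∈ Finset.range (t + 1), (cnt m' (fun J => True ∧ y J = j) +
        cnt m' (fun J => ℓ < y J ∧ x J = j)) := by
    refine Finset.sum_congr rfl fun j hj => ?_
    have hj' : j ≤ ℓ := by have := Finset.mem_range.1 hj; omega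
    rw [← row2_low x y ℓ hxy m hj', ← row2_low x y ℓ hxy m' hj', h2]
  rw [Finset.sum_add_distrib, Finset.sum_add_distrib, sum_cnt m (fun _ => True),
    sum_cnt m' (fun _ => True),
    Finset.sum_range_succ _ t, Finset.sum_range_succ _ t,
    Finset.sum_congr rfl (fun j hj => ih j (Finset.mem_range.1 hj))] at c2
  have s1 := split m
  have s2 := split m'
  omega

lemma high_le (hxy : ∀ J, x J < y J) (m m' : τ → ℕ) (hm : NCross x y m) (N : ℕ) (hN : ∀ J, y J ≤ N)
    (h1 : ∀ t, row1 x y ℓ m t = row1 x y ℓ m' t)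
    (h2 : ∀ t, row2 x y ℓ m t = row2 x y ℓ m' t) (t : ℕ) (ht : ℓ < t) (htN : t ≤ N)
    (ih : ∀ j, t < j → cnt m (fun J => x J ≤ ℓ ∧ y J = j) =
      cnt m' (fun J => x J ≤ ℓ ∧ y J = j)) :
    cnt m (fun J => x J ≤ ℓ ∧ y J = t) ≤ cnt m' (fun J => x J ≤ ℓ ∧ y J = t) := by
  by_contra hlt
  push Not at hlt
  obtain ⟨I, hI, hxI, hyI⟩ := exists_of_cnt m (by omega : cnt m (fun J => x J ≤ ℓ ∧ y J = t) ≠ 0)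
  have split : ∀ m : τ → ℕ, cnt m (fun J => ℓ < x J ∧ y J ∈ Finset.Ioc t N) =
      cnt m (fun J => ℓ < x J ∧ x J < t ∧ t < y J) +
      cnt m (fun J => True ∧ x J ∈ Finset.Icc t N) := fun m =>
    cnt_add m (fun J => by
        have := hxy J; have := hN J; simp only [Finset.mem_Ioc, Finset.mem_Icc, true_and]; omega)
      (fun J => by have := hxy J; simp only [Finset.mem_Icc, true_and]; omega)
  have z : cnt m (fun J => ℓ < x J ∧ x J < t ∧ t < y J) = 0 := by
    refine cnt_eq_zero m fun J hJ hh => ?_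
    exact hm I J hI hJ (by omega)
  have c1 : cnt m (fun J => ℓ < x J ∧ y J ∈ Finset.Ioc t N) =
      cnt m' (fun J => ℓ < x J ∧ y J ∈ Finset.Ioc t N) := by
    rw [← sum_cnt, ← sum_cnt]
    refine Finset.sum_congr rfl fun j hj => ?_
    have hj' : ℓ < j := by have := Finset.mem_Ioc.1 hj; omega
    rw [← row2_high x y ℓ hxy m hj', ← row2_high x y ℓ hxy m' hj', h2]
  have c2 : ∑ j ∈ Finset.Icc t N, (cnt m (fun J => True ∧ x J = j) +
        cnt m (fun J => x J ≤ ℓ ∧ y J = j)) =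
      ∑ j ∈ Finset.Icc t N, (cnt m' (fun J => True ∧ x J = j) +
        cnt m' (fun J => x J ≤ ℓ ∧ y J = j)) := by
    refine Finset.sum_congr rfl fun j hj => ?_
    have hj' : ℓ < j := by have := Finset.mem_Icc.1 hj; omega
    rw [← row1_high x y ℓ hxy m hj', ← row1_high x y ℓ hxy m' hj', h1]
  have c3 : ∑ j ∈ Finset.Icc t N, cnt m' (fun J => x J ≤ ℓ ∧ y J = j) <
      ∑ j ∈ Finset.Icc t N, cnt m (fun J => x J ≤ ℓ ∧ y J = j) := by
    refine Finset.sum_lt_sum (fun j hj => ?_) ⟨t, Finset.mem_Icc.2 ⟨le_rfl, htN⟩, hlt⟩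
    rcases (Finset.mem_Icc.1 hj).1.eq_or_lt with e | e
    · rw [← e]; exact hlt.le
    · exact (ih j e).ge
  rw [Finset.sum_add_distrib, Finset.sum_add_distrib, sum_cnt m (fun _ => True),
    sum_cnt m' (fun _ => True)] at c2
  have s1 := split m
  have s2 := split m'
  omega

theorem content_eq (hxy : ∀ J, x J < y J) (m m' : τ → ℕ) (hm : NCross x y m) (hm' : NCross x y m')
    (N : ℕ) (hN : ∀ J, y J ≤ N)
    (h1 : ∀ t, row1 x y ℓ m t = row1 x y ℓ m' t)
    (h2 : ∀ t, row2 x y ℓ m t = row2 x y ℓ m' t) (t : ℕ) :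
    cnt m (fun J => x J = t) = cnt m' (fun J => x J = t) ∧
    cnt m (fun J => y J = t) = cnt m' (fun J => y J = t) := by
  have tr : ∀ (m : τ → ℕ) (g : τ → ℕ), cnt m (fun J => True ∧ g J = t) =
      cnt m (fun J => g J = t) := fun m g => cnt_congr m fun J => by simp
  rcases le_or_gt t ℓ with ht | ht
  · have hU : ∀ t, t ≤ ℓ → cnt m (fun J => ℓ < y J ∧ x J = t) =
        cnt m' (fun J => ℓ < y J ∧ x J = t) := by
      intro t
      induction t using Nat.strong_induction_on with
      | _ t ih =>
        intro ht
        exact le_antisymm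
          (low_le x y ℓ hxy m m' hm h1 h2 t ht fun j hj => ih j hj (by omega))
          (low_le x y ℓ hxy m' m hm' (fun t => (h1 t).symm) (fun t => (h2 t).symm) t ht
            fun j hj => (ih j hj (by omega)).symm)
    have hu := hU t ht
    have a := row1_low x y ℓ hxy m ht
    have a' := row1_low x y ℓ hxy m' ht
    have b := row2_low x y ℓ hxy m ht
    have b' := row2_low x y ℓ hxy m' ht
    have sp : ∀ m : τ → ℕ, cnt m (fun J => x J = t) =
        cnt m (fun J => y J ≤ ℓ ∧ x J = t) + cnt m (fun J => ℓ < y J ∧ x J = t) := fun m =>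
      cnt_add m (fun J => by omega) (fun J => by omega)
    have s1 := sp m
    have s2 := sp m'
    have := h1 t
    have := h2 t
    rw [tr] at b b'
    constructor <;> omega
  · have hV : ∀ d t, ℓ < t → t + d = N + 1 → cnt m (fun J => x J ≤ ℓ ∧ y J = t) =
        cnt m' (fun J => x J ≤ ℓ ∧ y J = t) := by
      intro d
      induction d using Nat.strong_induction_on with
      | _ d ih =>
        intro t ht hd
        have big : ∀ j, N < j → ∀ m : τ → ℕ, cnt m (fun J => x J ≤ ℓ ∧ y J = j) = 0 :=
          fun j hj m => cnt_eq_zero m fun J _ => by have := hN J; omega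
        rcases Nat.eq_zero_or_pos d with h0 | h0
        · rw [big t (by omega), big t (by omega)]
        have ih' : ∀ j, t < j → cnt m (fun J => x J ≤ ℓ ∧ y J = j) =
            cnt m' (fun J => x J ≤ ℓ ∧ y J = j) := by
          intro j hj
          rcases le_or_gt j N with hjN | hjN
          · exact ih (N + 1 - j) (by omega) j (by omega) (by omega)
          · rw [big j hjN, big j hjN]
        exact le_antisymm
          (high_le x y ℓ hxy m m' hm N hN h1 h2 t ht (by omega) ih')
          (high_le x y ℓ hxy m' m hm' N hN (fun t => (h1 t).symm) (fun t => (h2 t).symm) t ht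
            (by omega) fun j hj => (ih' j hj).symm)
    have hv : cnt m (fun J => x J ≤ ℓ ∧ y J = t) = cnt m' (fun J => x J ≤ ℓ ∧ y J = t) := by
      rcases le_or_gt t N with htN | htN
      · exact hV (N + 1 - t) t ht (by omega)
      · rw [cnt_eq_zero m fun J _ => by have := hN J; omega,
          cnt_eq_zero m' fun J _ => by have := hN J; omega]
    have a := row1_high x y ℓ hxy m ht
    have a' := row1_high x y ℓ hxy m' ht
    have b := row2_high x y ℓ hxy m ht
    have b' := row2_high x y ℓ hxy m' ht
    have sp : ∀ m : τ → ℕ, cnt m (fun J => y J = t) =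
        cnt m (fun J => ℓ < x J ∧ y J = t) + cnt m (fun J => x J ≤ ℓ ∧ y J = t) := fun m =>
      cnt_add m (fun J => by omega) (fun J => by omega)
    have s1 := sp m
    have s2 := sp m'
    have := h1 t
    have := h2 t
    rw [tr] at a a'
    constructor <;> omega

end core

/-! ### Exponents of matching field monomials -/

instance plVarFinite (n k : ℕ) : Finite (PlVar n k) := by
  have : Function.Injective (fun J : PlVar n k => fun s : Fin k =>
      (⟨J.val s, Nat.lt_succ_of_le (J.2.2 s).2⟩ : Fin (n + 1))) := by
    intro I J h
    apply Subtype.ext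
    funext s
    exact congrArg Fin.val (congrFun h s)
  exact Finite.of_injective _ this

noncomputable instance plVarFintype (n k : ℕ) : Fintype (PlVar n k) := Fintype.ofFinite _

lemma permExp_apply {k : ℕ} (J : Fin k → ℕ) (σ : Equiv.Perm (Fin k)) (r : Fin k) (t : ℕ) :
    permExp J σ ((r : ℕ) + 1, t) = if J (σ.symm r) = t then 1 else 0 := by
  classical
  unfold permExp
  rw [Finsupp.finsetSum_apply, Finset.sum_eq_single (σ.symm r)]
  · rw [Finsupp.single_apply]
    simp
  · intro c _ hc
    rw [Finsupp.single_apply, if_neg]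
    intro e
    apply hc
    have h1 : σ c = r := Fin.ext (by have := (Prod.mk.inj e).1; omega)
    rw [← h1]; simp
  · simp

lemma permExp_apply_zero {k : ℕ} (J : Fin k → ℕ) (σ : Equiv.Perm (Fin k)) (q t : ℕ)
    (hq : q = 0 ∨ k < q) : permExp J σ (q, t) = 0 := by
  classical
  unfold permExp
  rw [Finsupp.finsetSum_apply]
  refine Finset.sum_eq_zero fun c _ => ?_
  rw [Finsupp.single_apply, if_neg]
  intro e
  have := (Prod.mk.inj e).1
  have := (σ c).isLt
  omega

/-- Exponent of `φ_ℓ (P^m)`. -/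
noncomputable def eM {n k : ℕ} (ℓ : ℕ) (m : PlVar n k →₀ ℕ) : ℕ × ℕ →₀ ℕ :=
  m.sum fun J e => e • eJ ℓ J

lemma eM_add {n k : ℕ} (ℓ : ℕ) (a b : PlVar n k →₀ ℕ) : eM ℓ (a + b) = eM ℓ a + eM ℓ b := by
  classical
  unfold eM
  rw [Finsupp.sum_add_index'] <;> intros <;> simp [add_smul]

lemma eM_single {n k : ℕ} (ℓ : ℕ) (J : PlVar n k) (e : ℕ) :
    eM ℓ (Finsupp.single J e) = e • eJ ℓ J := by
  simp [eM]

lemma eM_zero {n k : ℕ} (ℓ : ℕ) : eM ℓ (0 : PlVar n k →₀ ℕ) = 0 := by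
  simp [eM]

lemma eM_apply {n k : ℕ} (ℓ : ℕ) (m : PlVar n k →₀ ℕ) (p : ℕ × ℕ) :
    eM ℓ m p = ∑ J, m J * eJ ℓ J p := by
  unfold eM
  rw [Finsupp.sum_fintype]
  · rw [Finsupp.finsetSum_apply]
    simp
  · simp

lemma phi_monomial (K : Type*) [Field K] {n k : ℕ} (ℓ : ℕ) (m : PlVar n k →₀ ℕ) (c : K) :
    phiMF K n k ℓ (monomial m c) = monomial (eM ℓ m) c := by
  have h1 : ∀ J : PlVar n k, phiMF K n k ℓ (X J) = monomial (eJ ℓ J) 1 := by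
    intro J
    unfold eJ
    rw [monomial_sum_one]
    rw [phiMF, aeval_X]
    rfl
  have h2 : phiMF K n k ℓ (monomial m 1) = monomial (eM ℓ m) 1 := by
    induction m using Finsupp.induction_linear with
    | zero =>
      rw [eM_zero]
      exact map_one (phiMF K n k ℓ)
    | add f g hf hg =>
      have : (monomial (f + g) (1 : K)) = monomial f 1 * monomial g 1 := by simp
      rw [this, map_mul, hf, hg, eM_add]; simp
    | single J e =>
      rw [← X_pow_eq_monomial, map_pow, h1, eM_single, monomial_pow]; simp
  have : monomial m c = c • monomial m (1 : K) := by rw [smul_monomial]; simp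
  rw [this, map_smul, h2, smul_monomial]; simp

lemma expWt_eM {n k : ℕ} (ℓ : ℕ) (m : PlVar n k →₀ ℕ) :
    expWt (fun J : PlVar n k => wVec n ℓ J.val) m =
      expWt (fun p : ℕ × ℕ => Mmat n ℓ p.1 p.2) (eM ℓ m) := by
  induction m using Finsupp.induction_linear with
  | zero => rw [eM_zero, expWt_zero', expWt_zero']
  | add f g hf hg => rw [eM_add, expWt_add', expWt_add', hf, hg]
  | single J e =>
    rw [eM_single, expWt_single', expWt_nsmul', mul_comm]
    congr 1
    unfold wVec eJ
    rw [expWt_sum']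
    exact Finset.sum_congr rfl fun c _ => by rw [expWt_single']; simp

lemma eJ_degree {n k : ℕ} (ℓ : ℕ) (J : PlVar n k) : Finsupp.degree (eJ ℓ J) = k := by
  unfold eJ
  rw [map_sum]
  simp

lemma eM_degree {n k : ℕ} (ℓ : ℕ) (m : PlVar n k →₀ ℕ) :
    Finsupp.degree (eM ℓ m) = k * Finsupp.degree m := by
  induction m using Finsupp.induction_linear with
  | zero => simp [eM_zero]
  | add f g hf hg => rw [eM_add, map_add, map_add, hf, hg, mul_add]
  | single J e =>
    rw [eM_single, map_nsmul, eJ_degree]; simp [mul_comm]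

lemma not_typ1_zero {n k : ℕ} (J : PlVar n k) : ¬ Typ1 0 J.val := by
  rintro ⟨h, h0, _⟩
  have := (J.2.2 ⟨0, by omega⟩).1
  omega

lemma rhoP_zero {n k : ℕ} (J : PlVar n k) : rhoP 0 J.val = 1 := dif_neg (not_typ1_zero J)

lemma eJ_zero_eq {n k : ℕ} (J : PlVar n k) :
    eJ 0 J = ∑ i : Fin k, Finsupp.single ((i : ℕ) + 1, J.val i) 1 := by
  rw [eJ_eq, rhoP_zero]; rfl

lemma eJ_zero_apply {n k : ℕ} (J : PlVar n k) (r : Fin k) (t : ℕ) :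
    eJ 0 J ((r : ℕ) + 1, t) = if J.val r = t then 1 else 0 := by
  rw [eJ_eq, rhoP_zero, permExp_apply]; rfl

/-! ### Chains are determined by their row contents -/

/-- Sum of the entries. -/
def entSum {n k : ℕ} (J : PlVar n k) : ℕ := ∑ i, J.val i

/-- The support of `m` is a chain. -/
def IsChainM {n k : ℕ} (m : PlVar n k →₀ ℕ) : Prop :=
  ∀ I J, m I ≠ 0 → m J ≠ 0 → TupLe I.val J.val ∨ TupLe J.val I.val

lemma eM_zero_ne {n k : ℕ} (m : PlVar n k →₀ ℕ) (r : Fin k) (t : ℕ) :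
    eM 0 m ((r : ℕ) + 1, t) ≠ 0 ↔ ∃ J, m J ≠ 0 ∧ J.val r = t := by
  rw [eM_apply]
  constructor
  · intro h
    obtain ⟨J, _, hJ⟩ := Finset.exists_ne_zero_of_sum_ne_zero h
    refine ⟨J, left_ne_zero_of_mul hJ, ?_⟩
    have := right_ne_zero_of_mul hJ
    rw [eJ_zero_apply] at this
    by_contra hne
    rw [if_neg hne] at this
    exact this rfl
  · rintro ⟨J, hJ, hr⟩ h0
    have := (Finset.sum_eq_zero_iff.mp h0) J (Finset.mem_univ J)
    rw [eJ_zero_apply, if_pos hr] at this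
    omega

lemma chain_min {n k : ℕ} (m : PlVar n k →₀ ℕ) (hm : IsChainM m) (h0 : m ≠ 0) :
    ∃ I, m I ≠ 0 ∧ ∀ J, m J ≠ 0 → TupLe I.val J.val := by
  obtain ⟨I, hI, hmin⟩ := Finset.exists_min_image m.support entSum
    (Finsupp.support_nonempty_iff.mpr h0)
  have hI' := Finsupp.mem_support_iff.mp hI
  refine ⟨I, hI', fun J hJ => ?_⟩
  rcases hm I J hI' hJ with h | h
  · exact h
  · have h1 := hmin J (Finsupp.mem_support_iff.mpr hJ)
    intro s
    by_contra hlt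
    have : entSum J < entSum I :=
      Finset.sum_lt_sum (fun i _ => h i) ⟨s, Finset.mem_univ s, not_le.mp hlt⟩
    omega

lemma chain_inj {n k : ℕ} (hk : 0 < k) (m m' : PlVar n k →₀ ℕ) (hm : IsChainM m)
    (hm' : IsChainM m') (h : eM 0 m = eM 0 m') : m = m' := by
  classical
  induction hd : Finsupp.degree m generalizing m m' with
  | zero =>
    have h1 := eM_degree 0 m
    have h2 := eM_degree 0 m'
    rw [h, h2, hd] at h1
    have h3 : Finsupp.degree m' = 0 := by
      rcases Nat.mul_eq_zero.1 h1 with h | h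
      · omega
      · exact h
    rw [(Finsupp.degree_eq_zero_iff m).1 hd, (Finsupp.degree_eq_zero_iff m').1 h3]
  | succ d ih =>
    have h0 : m ≠ 0 := by
      rintro rfl; simp at hd
    have h0' : m' ≠ 0 := by
      rintro rfl
      have h1 := eM_degree 0 m
      rw [h, eM_zero, hd] at h1
      simp at h1; omega
    obtain ⟨I, hI, hImin⟩ := chain_min m hm h0
    obtain ⟨I', hI', hImin'⟩ := chain_min m' hm' h0'
    have e : I = I' := by
      apply Subtype.ext
      funext r
      apply le_antisymm
      · have := (eM_zero_ne m' r (I'.val r)).2 ⟨I', hI', rfl⟩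
        rw [← h] at this
        obtain ⟨J, hJ, hr⟩ := (eM_zero_ne m r _).1 this
        rw [← hr]; exact hImin J hJ r
      · have := (eM_zero_ne m r (I.val r)).2 ⟨I, hI, rfl⟩
        rw [h] at this
        obtain ⟨J, hJ, hr⟩ := (eM_zero_ne m' r _).1 this
        rw [← hr]; exact hImin' J hJ r
    subst e
    have s1 : m = (m - Finsupp.single I 1) + Finsupp.single I 1 := by
      rw [tsub_add_cancel_of_le]
      rw [Finsupp.single_le_iff]; omega
    have s2 : m' = (m' - Finsupp.single I 1) + Finsupp.single I 1 := by
      rw [tsub_add_cancel_of_le]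
      rw [Finsupp.single_le_iff]; omega
    have sub : ∀ (q : PlVar n k →₀ ℕ) (J : PlVar n k),
        (q - Finsupp.single I 1 : PlVar n k →₀ ℕ) J ≠ 0 → q J ≠ 0 := by
      intro q J hJ
      rw [Finsupp.tsub_apply] at hJ
      omega
    have h' := h
    rw [s1, s2, eM_add, eM_add] at h'
    have hd' : Finsupp.degree (m - Finsupp.single I 1) = d := by
      rw [s1, map_add] at hd
      simp at hd; exact hd
    have := ih (m - Finsupp.single I 1) (m' - Finsupp.single I 1)
      (fun A B hA hB => hm A B (sub m A hA) (sub m B hB))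
      (fun A B hA hB => hm' A B (sub m' A hA) (sub m' B hB)) (add_right_cancel h') hd'
    rw [s1, s2, this]

/-! ### Non-crossing representatives -/

section two

variable {n k : ℕ} (hk : 2 ≤ k)

/-- First entry. -/
def fstE (J : PlVar n k) : ℕ := J.val ⟨0, by omega⟩

/-- Second entry. -/
def sndE (J : PlVar n k) : ℕ := J.val ⟨1, by omega⟩

lemma fst_lt_snd (J : PlVar n k) : fstE hk J < sndE hk J := J.2.1 (by simp [Fin.lt_def])

lemma typ1_fs (ℓ : ℕ) (J : PlVar n k) : Typ1 ℓ J.val ↔ (fstE hk J ≤ ℓ ∧ ℓ < sndE hk J) :=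
  ⟨fun h => h.2, fun h => ⟨hk, h⟩⟩

lemma eJ_row1 (ℓ : ℕ) (J : PlVar n k) (t : ℕ) [Decidable ((fstE hk J ≤ ℓ ∧ ℓ < sndE hk J ∧
      sndE hk J = t) ∨ (¬ (fstE hk J ≤ ℓ ∧ ℓ < sndE hk J) ∧ fstE hk J = t))] :
    eJ ℓ J (1, t) = if (fstE hk J ≤ ℓ ∧ ℓ < sndE hk J ∧ sndE hk J = t) ∨
      (¬ (fstE hk J ≤ ℓ ∧ ℓ < sndE hk J) ∧ fstE hk J = t) then 1 else 0 := by
  have := permExp_apply J.val (rhoP ℓ J.val) ⟨0, by omega⟩ t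
  rw [eJ_eq]
  refine this.trans ?_
  have ht := typ1_fs hk ℓ J
  by_cases h : Typ1 ℓ J.val
  · have e : J.val ((rhoP ℓ J.val).symm ⟨0, by omega⟩) = sndE hk J := by
      rw [rhoP, dif_pos h, Equiv.symm_swap, Equiv.swap_apply_left]; rfl
    rw [e]
    congr 1
    have := ht.1 h
    apply propext
    omega
  · have e : J.val ((rhoP ℓ J.val).symm ⟨0, by omega⟩) = fstE hk J := by
      rw [rhoP, dif_neg h]; rfl
    rw [e]
    congr 1
    have hn : ¬ (fstE hk J ≤ ℓ ∧ ℓ < sndE hk J) := fun h' => h (ht.2 h')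
    have hxy := fst_lt_snd hk J
    apply propext
    omega

lemma eJ_row2 (ℓ : ℕ) (J : PlVar n k) (t : ℕ) [Decidable ((fstE hk J ≤ ℓ ∧ ℓ < sndE hk J ∧
      fstE hk J = t) ∨ (¬ (fstE hk J ≤ ℓ ∧ ℓ < sndE hk J) ∧ sndE hk J = t))] :
    eJ ℓ J (2, t) = if (fstE hk J ≤ ℓ ∧ ℓ < sndE hk J ∧ fstE hk J = t) ∨
      (¬ (fstE hk J ≤ ℓ ∧ ℓ < sndE hk J) ∧ sndE hk J = t) then 1 else 0 := by
  have := permExp_apply J.val (rhoP ℓ J.val) ⟨1, by omega⟩ t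
  rw [eJ_eq]
  refine this.trans ?_
  have ht := typ1_fs hk ℓ J
  by_cases h : Typ1 ℓ J.val
  · have e : J.val ((rhoP ℓ J.val).symm ⟨1, by omega⟩) = fstE hk J := by
      rw [rhoP, dif_pos h, Equiv.symm_swap, Equiv.swap_apply_right]; rfl
    rw [e]
    congr 1
    have := ht.1 h
    apply propext
    omega
  · have e : J.val ((rhoP ℓ J.val).symm ⟨1, by omega⟩) = sndE hk J := by
      rw [rhoP, dif_neg h]; rfl
    rw [e]
    congr 1
    have hn : ¬ (fstE hk J ≤ ℓ ∧ ℓ < sndE hk J) := fun h' => h (ht.2 h')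
    have hxy := fst_lt_snd hk J
    apply propext
    omega

lemma eM_row1 (ℓ : ℕ) (m : PlVar n k →₀ ℕ) (t : ℕ) :
    eM ℓ m (1, t) = row1 (fstE hk) (sndE hk) ℓ m t := by
  classical
  rw [eM_apply, row1, cnt]
  refine Finset.sum_congr rfl fun J _ => ?_
  rw [eJ_row1 hk]
  rw [mul_ite, mul_one, mul_zero]
  split_ifs <;> rfl

lemma eM_row2 (ℓ : ℕ) (m : PlVar n k →₀ ℕ) (t : ℕ) :
    eM ℓ m (2, t) = row2 (fstE hk) (sndE hk) ℓ m t := by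
  classical
  rw [eM_apply, row2, cnt]
  refine Finset.sum_congr rfl fun J _ => ?_
  rw [eJ_row2 hk]
  rw [mul_ite, mul_one, mul_zero]
  split_ifs <;> rfl

lemma eM_row1_zero (m : PlVar n k →₀ ℕ) (t : ℕ) :
    eM 0 m (1, t) = cnt m (fun J => fstE hk J = t) := by
  rw [eM_row1 hk, row1]
  refine cnt_congr _ fun J => ?_
  have : 1 ≤ fstE hk J := (J.2.2 _).1
  omega

lemma eM_row2_zero (m : PlVar n k →₀ ℕ) (t : ℕ) :
    eM 0 m (2, t) = cnt m (fun J => sndE hk J = t) := by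
  rw [eM_row2 hk, row2]
  refine cnt_congr _ fun J => ?_
  have : 1 ≤ fstE hk J := (J.2.2 _).1
  omega

lemma eM_other (ℓ : ℕ) (m : PlVar n k →₀ ℕ) (q t : ℕ) (h1 : q ≠ 1) (h2 : q ≠ 2) :
    eM ℓ m (q, t) = eM 0 m (q, t) := by
  rw [eM_apply, eM_apply]
  refine Finset.sum_congr rfl fun J _ => ?_
  congr 1
  rw [eJ_eq, eJ_eq]
  by_cases hq : q = 0 ∨ k < q
  · rw [permExp_apply_zero _ _ _ _ hq, permExp_apply_zero _ _ _ _ hq]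
  · push Not at hq
    obtain ⟨r, rfl⟩ : ∃ r : Fin k, q = (r : ℕ) + 1 := ⟨⟨q - 1, by omega⟩, by simp; omega⟩
    rw [permExp_apply, permExp_apply, rhoP_zero]
    have : (rhoP ℓ J.val).symm r = r := by
      unfold rhoP
      split_ifs with h
      · rw [Equiv.symm_swap]
        apply Equiv.swap_apply_of_ne_of_ne
        · intro e; rw [e] at h1; simp at h1
        · intro e; rw [e] at h2; simp at h2
      · rfl
    rw [this]; rfl

lemma nc_content (ℓ : ℕ) (m m' : PlVar n k →₀ ℕ) (hm : NCross (fstE hk) (sndE hk) m)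
    (hm' : NCross (fstE hk) (sndE hk) m') (h : eM ℓ m = eM ℓ m') : eM 0 m = eM 0 m' := by
  have key := content_eq (fstE hk) (sndE hk) ℓ (fst_lt_snd hk) m m' hm hm' n
    (fun J => (J.2.2 _).2)
    (fun t => by rw [← eM_row1, ← eM_row1, h]) (fun t => by rw [← eM_row2, ← eM_row2, h])
  ext ⟨q, t⟩
  by_cases h1 : q = 1
  · subst h1
    rw [eM_row1_zero hk, eM_row1_zero hk]; exact (key t).1
  by_cases h2 : q = 2
  · subst h2
    rw [eM_row2_zero hk, eM_row2_zero hk]; exact (key t).2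
  rw [← eM_other ℓ m q t h1 h2, ← eM_other ℓ m' q t h1 h2, h]

/-- Replace the first entry. -/
def updF (J : PlVar n k) (a : ℕ) (h1 : 1 ≤ a) (h2 : a < sndE hk J) : PlVar n k :=
  ⟨fun s => if (s : ℕ) = 0 then a else J.val s, by
    have hs : ∀ s : Fin k, (s : ℕ) ≠ 0 → sndE hk J ≤ J.val s := fun s hs =>
      J.2.1.monotone (by rw [Fin.le_def]; simp; omega)
    constructor
    · intro s t hst
      have hst' : (s : ℕ) < t := hst
      simp only
      rw [if_neg (by omega : ¬ (t : ℕ) = 0)]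
      split_ifs with h
      · exact lt_of_lt_of_le h2 (hs t (by omega))
      · exact J.2.1 hst
    · intro s
      simp only
      split_ifs with h
      · have := (J.2.2 ⟨1, by omega⟩).2
        change sndE hk J ≤ n at this
        omega
      · exact J.2.2 s⟩

lemma exists_nc (m : PlVar n k →₀ ℕ) :
    ∃ m' : PlVar n k →₀ ℕ, eM 0 m' = eM 0 m ∧ NCross (fstE hk) (sndE hk) m' := by
  classical
  have hfin : {m' : PlVar n k →₀ ℕ | eM 0 m' = eM 0 m}.Finite := by
    refine (Finsupp.finite_of_degree_le (Finsupp.degree m)).subset fun m' hm' => ?_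
    have h1 := eM_degree 0 m'
    rw [hm', eM_degree] at h1
    have := Nat.eq_of_mul_eq_mul_left (by omega : 0 < k) h1
    exact this.ge
  let u : PlVar n k → ℤ := fun J => ((sndE hk J : ℤ) - fstE hk J) ^ 2
  obtain ⟨q, hq, hmax⟩ := Set.exists_max_image _ (expWt u) hfin ⟨m, rfl⟩
  refine ⟨q, hq, ?_⟩
  rintro I J hI hJ ⟨a1, a2, a3⟩
  have hIJ : I ≠ J := by rintro rfl; omega
  have hI1 : 1 ≤ fstE hk I := (I.2.2 _).1
  let I' := updF hk I (fstE hk J) (by omega) a2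
  let J' := updF hk J (fstE hk I) hI1 (by omega)
  obtain ⟨r, hr⟩ : ∃ r, q = r + (Finsupp.single I 1 + Finsupp.single J 1) := by
    refine ⟨q - (Finsupp.single I 1 + Finsupp.single J 1), ?_⟩
    rw [tsub_add_cancel_of_le]
    intro A
    rw [Finsupp.add_apply, Finsupp.single_apply, Finsupp.single_apply]
    by_cases e1 : I = A
    · subst e1
      rw [if_neg (Ne.symm hIJ)]; simp; omega
    · rw [if_neg e1]
      by_cases e2 : J = A
      · subst e2; simp; omega
      · simp [e2]
  have hE : eJ 0 I' + eJ 0 J' = eJ 0 I + eJ 0 J := by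
    simp only [eJ_zero_eq]
    rw [← Finset.sum_add_distrib, ← Finset.sum_add_distrib]
    refine Finset.sum_congr rfl fun i _ => ?_
    by_cases h0 : (i : ℕ) = 0
    · have e0 : i = ⟨0, by omega⟩ := Fin.ext h0
      have b1 : I'.val i = J.val i := by
        show (if (i : ℕ) = 0 then fstE hk J else I.val i) = J.val i
        rw [if_pos h0, e0]; rfl
      have b2 : J'.val i = I.val i := by
        show (if (i : ℕ) = 0 then fstE hk I else J.val i) = I.val i
        rw [if_pos h0, e0]; rfl
      rw [b1, b2, add_comm]
    · have b1 : I'.val i = I.val i := if_neg h0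
      have b2 : J'.val i = J.val i := if_neg h0
      rw [b1, b2]
  have hmem : eM 0 (r + (Finsupp.single I' 1 + Finsupp.single J' 1)) = eM 0 m := by
    rw [← hq, hr, eM_add, eM_add, eM_add, eM_add]
    simp only [eM_single, one_smul]
    rw [hE]
  have := hmax _ hmem
  rw [hr] at this
  simp only [expWt_add', expWt_single'] at this
  have f1 : fstE hk I' = fstE hk J := rfl
  have f2 : fstE hk J' = fstE hk I := rfl
  have f3 : sndE hk I' = sndE hk I := rfl
  have f4 : sndE hk J' = sndE hk J := rfl
  simp only [u, f1, f2, f3, f4] at this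
  push_cast at this
  have b1 : (fstE hk I : ℤ) < fstE hk J := by exact_mod_cast a1
  have b3 : (sndE hk I : ℤ) < sndE hk J := by exact_mod_cast a3
  nlinarith [mul_pos (sub_pos.2 b1) (sub_pos.2 b3)]

end two

/-- A choice of representatives on which both `e_0` and `e_ℓ` are injective. -/
lemma exists_reps (n k ℓ : ℕ) : ∃ S : Set (PlVar n k →₀ ℕ),
    (∀ m : PlVar n k →₀ ℕ, ∃ s ∈ S, eM 0 s = eM 0 m) ∧
    (∀ s ∈ S, ∀ s' ∈ S, eM 0 s = eM 0 s' → s = s') ∧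
    (∀ s ∈ S, ∀ s' ∈ S, eM ℓ s = eM ℓ s' → s = s') := by
  classical
  obtain ⟨P, hP1, hP2⟩ : ∃ P : (PlVar n k →₀ ℕ) → Prop,
      (∀ m, ∃ s, P s ∧ eM 0 s = eM 0 m) ∧
      (∀ s s', P s → P s' → eM ℓ s = eM ℓ s' → eM 0 s = eM 0 s') := by
    by_cases hk : 2 ≤ k
    · refine ⟨fun m => NCross (fstE hk) (sndE hk) m, fun m => ?_, fun s s' h h' => ?_⟩
      · obtain ⟨q, h1, h2⟩ := exists_nc hk m
        exact ⟨q, h2, h1⟩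
      · exact nc_content hk ℓ s s' h h'
    · refine ⟨fun _ => True, fun m => ⟨m, trivial, rfl⟩, fun s s' _ _ h => ?_⟩
      have : ∀ m : PlVar n k →₀ ℕ, eM ℓ m = eM 0 m := by
        intro m
        unfold eM
        congr 1
        funext J e
        rw [eJ_eq, eJ_eq, rhoP_zero]
        have : rhoP ℓ J.val = 1 := dif_neg fun h => hk h.1
        rw [this]
      rw [← this, ← this, h]
  choose f hf1 hf2 using hP1
  let g : (ℕ × ℕ →₀ ℕ) → (PlVar n k →₀ ℕ) := fun R =>
    if h : ∃ m : PlVar n k →₀ ℕ, eM 0 m = R then f h.choose else 0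
  have hg : ∀ m : PlVar n k →₀ ℕ, P (g (eM 0 m)) ∧ eM 0 (g (eM 0 m)) = eM 0 m := by
    intro m
    have h : ∃ m' : PlVar n k →₀ ℕ, eM 0 m' = eM 0 m := ⟨m, rfl⟩
    have : g (eM 0 m) = f h.choose := dif_pos h
    rw [this]
    exact ⟨hf1 _, (hf2 _).trans h.choose_spec⟩
  refine ⟨Set.range fun m : PlVar n k →₀ ℕ => g (eM 0 m), fun m => ⟨_, ⟨m, rfl⟩, (hg m).2⟩, ?_, ?_⟩
  · rintro _ ⟨m, rfl⟩ _ ⟨m', rfl⟩ h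
    simp only [(hg _).2] at h
    simp only [h]
  · rintro _ ⟨m, rfl⟩ _ ⟨m', rfl⟩ h
    have := hP2 _ _ (hg m).1 (hg m').1 h
    simp only [(hg _).2] at this
    simp only [this]

/-- The sign of `m` only depends on `e_ℓ (m)`. -/
lemma sgn_eq (K : Type*) [Field K] {n k : ℕ} (ℓ : ℕ) (m m' : PlVar n k →₀ ℕ)
    (h : eM ℓ m = eM ℓ m') :
    (m.prod fun J e => sgnJ K ℓ J.val ^ e) = m'.prod fun J e => sgnJ K ℓ J.val ^ e := by
  classical
  by_cases hk : 2 ≤ k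
  · have key : ∀ m : PlVar n k →₀ ℕ, (m.prod fun J e => sgnJ K ℓ J.val ^ e) =
        (-1) ^ cnt m (fun J => fstE hk J ≤ ℓ ∧ ℓ < sndE hk J) := by
      intro m
      rw [Finsupp.prod_fintype _ _ (by simp), cnt, ← Finset.prod_pow_eq_pow_sum]
      refine Finset.prod_congr rfl fun J _ => ?_
      unfold sgnJ
      simp only [typ1_fs hk]
      split_ifs <;> simp
    rw [key, key, typ_count (fstE hk) (sndE hk) ℓ (fst_lt_snd hk) m m'
      (fun t => by rw [← eM_row1, ← eM_row1, h]) (fun t => by rw [← eM_row2, ← eM_row2, h])]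
  · have : ∀ J : PlVar n k, sgnJ K ℓ J.val = 1 := fun J => if_neg fun h => hk h.1
    simp [this]

/-! ### The quadratic straightening relation -/

section R0

variable (K : Type*) [Field K] {k : ℕ}

/-- A column of the generic matrix. -/
noncomputable def colV (k : ℕ) (c : ℕ) : Fin k → MvPolynomial (ℕ × ℕ) K :=
  fun r => X ((r : ℕ) + 1, c)

lemma minorP_det (c : Fin k → ℕ) :
    minorP K c = Matrix.detRowAlternating (fun i => colV K k (c i)) := by
  unfold minorP
  rw [← Matrix.det_transpose]
  rfl

/-- The determinant with some of the columns fixed. -/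
noncomputable def partDet (P : Fin k → Prop) [DecidablePred P] (J : Fin k → ℕ) :
    (Fin k → MvPolynomial (ℕ × ℕ) K) [⋀^{r // P r}]→ₗ[MvPolynomial (ℕ × ℕ) K]
      MvPolynomial (ℕ × ℕ) K :=
  { (Matrix.detRowAlternating (R := MvPolynomial (ℕ × ℕ) K)
      (n := Fin k)).toMultilinearMap.domDomRestrict P (fun r => colV K k (J r)) with
    map_eq_zero_of_eq' := by
      intro x i j hx hij
      change Matrix.detRowAlternating (fun r => if h : P r then x ⟨r, h⟩ else colV K k (J r)) = 0
      refine AlternatingMap.map_eq_zero_of_eq _ _ (i := i.1) (j := j.1) ?_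
        (fun h => hij (Subtype.ext h))
      simp only [dif_pos i.2, dif_pos j.2]
      exact hx }

lemma partDet_apply (P : Fin k → Prop) [DecidablePred P] (J : Fin k → ℕ)
    (x : {r // P r} → ℕ) :
    partDet K P J (fun r => colV K k (x r)) =
      minorP K (fun r => if h : P r then x ⟨r, h⟩ else J r) := by
  rw [minorP_det]
  change Matrix.detRowAlternating
    (fun r => if h : P r then colV K k (x ⟨r, h⟩) else colV K k (J r)) = _
  congr 1
  funext r
  split_ifs <;> rfl

lemma sum_split (P : Fin k → Prop) [DecidablePred P] (J : Fin k → ℕ)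
    (x : {r // P r} → ℕ) : ∑ r, (if h : P r then x ⟨r, h⟩ else J r) =
      ∑ r, x r + ∑ r : {r // ¬ P r}, J r := by
  classical
  rw [← Fintype.sum_subtype_add_sum_subtype P]
  congr 1
  · exact Finset.sum_congr rfl fun r _ => by rw [dif_pos r.2]
  · exact Finset.sum_congr rfl fun r _ => by rw [dif_neg r.2]

lemma sum_split' (P : Fin k → Prop) [DecidablePred P] (J : Fin k → ℕ) : ∑ r, J r =
      ∑ r : {r // P r}, J r + ∑ r : {r // ¬ P r}, J r := by
  classical
  rw [← Fintype.sum_subtype_add_sum_subtype P]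

lemma perm_lt {A B : Type*} [Fintype A] [Fintype B] [DecidableEq A] [DecidableEq B]
    (τ : A ⊕ B → ℕ) (θ : ℕ)
    (ha : ∀ a, τ (Sum.inl a) < θ) (hb : ∀ b, θ ≤ τ (Sum.inr b)) (σ : Equiv.Perm (A ⊕ B))
    (hσ : σ ∉ (Equiv.Perm.sumCongrHom A B).range) :
    ∑ b, τ (σ (Sum.inr b)) < ∑ b, τ (Sum.inr b) := by
  obtain ⟨b0, a0, hb0⟩ : ∃ b a, σ (Sum.inr b) = Sum.inl a := by
    by_contra hno
    push Not at hno
    apply hσ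
    apply Equiv.Perm.mem_sumCongrHom_range_of_perm_mapsTo_inl
    rw [Equiv.Perm.perm_mapsTo_inl_iff_mapsTo_inr]
    rintro _ ⟨b, rfl⟩
    rcases h : σ (Sum.inr b) with a | b'
    · exact absurd h (hno b a)
    · exact ⟨b', rfl⟩
  let f : A ⊕ B → ℤ := fun x => (τ x : ℤ) - θ
  let g : A ⊕ B → ℤ := fun x => max (f x) 0
  have e1 : ∑ b, f (σ (Sum.inr b)) < ∑ b, g (σ (Sum.inr b)) := by
    apply Finset.sum_lt_sum
    · intro i _; exact le_max_left _ _
    · refine ⟨b0, Finset.mem_univ _, ?_⟩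
      rw [hb0]
      have := ha a0
      simp only [f, g, lt_max_iff]
      right; omega
  have e2 : ∑ b, g (σ (Sum.inr b)) ≤ ∑ x, g (σ x) := by
    rw [Fintype.sum_sum_type]
    have : 0 ≤ ∑ a, g (σ (Sum.inl a)) := Finset.sum_nonneg fun i _ => le_max_right _ _
    omega
  have e3 : ∑ x, g (σ x) = ∑ b, f (Sum.inr b) := by
    rw [Equiv.sum_comp σ g, Fintype.sum_sum_type]
    have h1 : ∑ a, g (Sum.inl a) = 0 := Finset.sum_eq_zero fun a _ => by
      have := ha a
      simp only [f, g]; omega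
    rw [h1, zero_add]
    refine Finset.sum_congr rfl fun b _ => ?_
    have := hb b
    simp only [f, g]; omega
  have e4 : ∑ b, f (σ (Sum.inr b)) < ∑ b, f (Sum.inr b) := by omega
  simp only [f, Finset.sum_sub_distrib] at e4
  have : ((∑ b, τ (σ (Sum.inr b)) : ℕ) : ℤ) < ((∑ b, τ (Sum.inr b) : ℕ) : ℤ) := by
    push_cast; linarith
  exact_mod_cast this

/-- The set of products of minors allowed in the straightening of `I, J`. -/
def R0set (n : ℕ) (I J : Fin k → ℕ) : Set (MvPolynomial (ℕ × ℕ) K) :=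
  {p | ∃ a b : Fin k → ℕ, p = minorP K a * minorP K b ∧ ∑ r, a r < ∑ r, I r ∧
    ∑ r, a r + ∑ r, b r = ∑ r, I r + ∑ r, J r ∧ (∀ r, 1 ≤ a r ∧ a r ≤ n) ∧
    (∀ r, 1 ≤ b r ∧ b r ≤ n)}

lemma coprod_rel {R M A B : Type*} [CommRing R] [IsDomain R] [AddCommGroup M] [Module R M]
    [Fintype A] [Fintype B] [DecidableEq A] [DecidableEq B]
    (a : M [⋀^A]→ₗ[R] R) (b : M [⋀^B]→ₗ[R] R) (v : A ⊕ B → M)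
    (h : a.domCoprod b v = 0) :
    a (fun i => v (Sum.inl i)) * b (fun i => v (Sum.inr i)) ∈ AddSubgroup.closure
      {p : R | ∃ σ : Equiv.Perm (A ⊕ B), σ ∉ (Equiv.Perm.sumCongrHom A B).range ∧
        p = a (fun i => v (σ (Sum.inl i))) * b (fun i => v (σ (Sum.inr i)))} := by
  classical
  let t : Equiv.Perm.ModSumCongr A B → R := fun q =>
    LinearMap.mul' R R (AlternatingMap.domCoprod.summand a b q v)
  have hsum : ∑ q, t q = 0 := by
    have := congrArg (LinearMap.mul' R R) h
    rw [map_zero] at this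
    rw [← this]
    simp only [AlternatingMap.domCoprod_apply, sum_apply, t]
    rw [map_sum]
  have ht : ∀ σ : Equiv.Perm (A ⊕ B), t (Quotient.mk'' σ) = ((Equiv.Perm.sign σ : ℤˣ) : ℤ) •
      (a (fun i => v (σ (Sum.inl i))) * b (fun i => v (σ (Sum.inr i)))) := by
    intro σ
    simp only [t]
    rw [AlternatingMap.domCoprod.summand_mk'', smul_apply, MultilinearMap.domDomCongr_apply,
      MultilinearMap.domCoprod_apply, Units.smul_def, map_zsmul]
    simp
  have hsum := (Finset.add_sum_erase Finset.univ t (Finset.mem_univ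
    (Quotient.mk'' (1 : Equiv.Perm (A ⊕ B)) : Equiv.Perm.ModSumCongr A B))).trans hsum
  have h1 : t (Quotient.mk'' 1) = a (fun i => v (Sum.inl i)) * b (fun i => v (Sum.inr i)) := by
    rw [ht]; simp
  rw [← h1, eq_neg_of_add_eq_zero_left hsum]
  refine AddSubgroup.neg_mem _ (AddSubgroup.sum_mem _ fun q hq => ?_)
  induction q using Quotient.inductionOn' with | _ σ
  rw [ht]
  refine AddSubgroup.zsmul_mem _ ?_ _
  apply AddSubgroup.subset_closure
  refine ⟨σ, ?_, rfl⟩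
  intro hσ
  apply (Finset.mem_erase.1 hq).1
  apply Quotient.sound'
  rw [QuotientGroup.leftRel_apply]
  simpa using hσ

lemma card_split (s : Fin k) :
    Fintype.card (Fin k) < Fintype.card ({r : Fin k // r ≤ s} ⊕ {r : Fin k // s ≤ r}) := by
  rw [Fintype.card_sum]
  have := s.isLt
  have h1 : Fintype.card {r : Fin k // r ≤ s} = (s : ℕ) + 1 := by
    rw [Fintype.card_of_subtype (Finset.Iic s) (by simp), Fin.card_Iic]
  have h2 : Fintype.card {r : Fin k // s ≤ r} = k - (s : ℕ) := by
    rw [Fintype.card_of_subtype (Finset.Ici s) (by simp), Fin.card_Ici]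
  rw [h1, h2, Fintype.card_fin]
  omega

lemma R0_minor (n : ℕ) (I J : Fin k → ℕ) (hI : IsIdx n k I) (hJ : IsIdx n k J) (s : Fin k)
    (hs : J s < I s) :
    minorP K I * minorP K J ∈ Submodule.span K (R0set K n I J) := by
  classical
  obtain ⟨τ, hτl, hτr⟩ : ∃ τ : {r : Fin k // r ≤ s} ⊕ {r : Fin k // s ≤ r} → ℕ,
      (∀ r, τ (Sum.inl r) = J r.1) ∧ (∀ r, τ (Sum.inr r) = I r.1) :=
    ⟨Sum.elim (fun r => J r.1) (fun r => I r.1), fun _ => rfl, fun _ => rfl⟩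
  have hD : (partDet K (fun r => r ≤ s) J).domCoprod (partDet K (fun r => s ≤ r) I)
      (fun x => colV K k (τ x)) = 0 := by
    apply AlternatingMap.map_linearDependent
    intro hli
    have h1 := hli.fintype_card_le_finrank
    rw [Module.finrank_fintype_fun_eq_card] at h1
    have h2 := card_split s
    omega
  have key := coprod_rel _ _ _ hD
  have e1 : minorP K J = partDet K (fun r => r ≤ s) J (fun r => colV K k (τ (Sum.inl r))) := by
    rw [partDet_apply K (fun r => r ≤ s) J (fun r => τ (Sum.inl r))]
    simp [hτl]
  have e2 : minorP K I = partDet K (fun r => s ≤ r) I (fun r => colV K k (τ (Sum.inr r))) := by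
    rw [partDet_apply K (fun r => s ≤ r) I (fun r => τ (Sum.inr r))]
    simp [hτr]
  rw [mul_comm, e1, e2]
  have hτ : ∀ x, 1 ≤ τ x ∧ τ x ≤ n := by
    rintro (x | x)
    · rw [hτl]; exact hJ.2 _
    · rw [hτr]; exact hI.2 _
  refine (AddSubgroup.closure_le (Submodule.span K (R0set K n I J)).toAddSubgroup).2 ?_ key
  rintro _ ⟨σ, hσ, rfl⟩
  rw [partDet_apply K (fun r => r ≤ s) J (fun r => τ (σ (Sum.inl r))),
    partDet_apply K (fun r => s ≤ r) I (fun r => τ (σ (Sum.inr r))), mul_comm]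
  refine Submodule.subset_span ⟨_, _, rfl, ?_, ?_, ?_, ?_⟩
  · rw [sum_split (fun r => s ≤ r) I (fun r => τ (σ (Sum.inr r))), sum_split' (fun r => s ≤ r) I]
    refine Nat.add_lt_add_right ?_ _
    have := perm_lt τ (I s) ?_ ?_ σ hσ
    · simpa only [hτr] using this
    · intro x
      rw [hτl]
      exact lt_of_le_of_lt (hJ.1.monotone x.2) hs
    · intro x
      rw [hτr]
      exact hI.1.monotone x.2
  · rw [sum_split (fun r => s ≤ r) I (fun r => τ (σ (Sum.inr r))),
      sum_split (fun r => r ≤ s) J (fun r => τ (σ (Sum.inl r))),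
      sum_split' (fun r => s ≤ r) I, sum_split' (fun r => r ≤ s) J]
    have := Equiv.sum_comp σ τ
    rw [Fintype.sum_sum_type, Fintype.sum_sum_type] at this
    simp only [hτl, hτr] at this
    omega
  · intro r; split_ifs
    · exact hτ _
    · exact hI.2 _
  · intro r; split_ifs
    · exact hτ _
    · exact hJ.2 _

end R0

/-! ### Straightening and spanning -/

section straight

variable (K : Type*) [Field K] {n k : ℕ}

lemma minorP_sort (c : Fin k → ℕ) (hc : ∀ r, 1 ≤ c r ∧ c r ≤ n) :
    minorP K c = 0 ∨ ∃ (J : PlVar n k) (ε : K), minorP K c = ε • pluMap K n k (X J) ∧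
      entSum J = ∑ r, c r := by
  classical
  by_cases hinj : Function.Injective c
  · right
    have hs : StrictMono (c ∘ Tuple.sort c) :=
      (Tuple.monotone_sort c).strictMono_of_injective (hinj.comp (Tuple.sort c).injective)
    have hidx : IsIdx n k (c ∘ Tuple.sort c) := ⟨hs, fun r => hc _⟩
    refine ⟨⟨c ∘ Tuple.sort c, hidx⟩,
      (((Equiv.Perm.sign (Tuple.sort c) : ℤˣ) : ℤ) : K), ?_, ?_⟩
    · have e0 := pluMap_X K (⟨c ∘ Tuple.sort c, hidx⟩ : PlVar n k)
      rw [e0, minorP_det, minorP_det]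
      have := AlternatingMap.map_perm (Matrix.detRowAlternating (R := MvPolynomial (ℕ × ℕ) K)
        (n := Fin k)) (fun i => colV K k (c i)) (Tuple.sort c)
      have e : (fun i => colV K k ((c ∘ Tuple.sort c) i)) =
        (fun i => colV K k (c i)) ∘ Tuple.sort c := rfl
      rw [e, this]
      rcases Int.units_eq_one_or (Equiv.Perm.sign (Tuple.sort c)) with h | h <;> rw [h] <;> simp
    · exact Equiv.sum_comp (Tuple.sort c) c
  · left
    rw [Function.not_injective_iff] at hinj
    obtain ⟨i, j, h, hij⟩ := hinj
    rw [minorP_det]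
    exact AlternatingMap.map_eq_zero_of_eq _ _ (by simp only [h]) hij

/-- Products of minors. -/
noncomputable def pm (m : PlVar n k →₀ ℕ) : MvPolynomial (ℕ × ℕ) K :=
  pluMap K n k (monomial m 1)

lemma pm_add (a b : PlVar n k →₀ ℕ) : pm K (a + b) = pm K a * pm K b := by
  unfold pm
  rw [← map_mul]; simp

lemma pm_single (J : PlVar n k) : pm K (Finsupp.single J 1) = pluMap K n k (X J) := rfl

/-- The sign of a monomial. -/
noncomputable def sgnM (ℓ : ℕ) (m : PlVar n k →₀ ℕ) : K :=
  m.prod fun J e => sgnJ K ℓ J.val ^ e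

lemma sgnM_ne (ℓ : ℕ) (m : PlVar n k →₀ ℕ) : sgnM K ℓ m ≠ 0 :=
  Finset.prod_ne_zero_iff.2 fun _ _ => pow_ne_zero _ (sgnJ_ne K ℓ _)

lemma pm_isInit (ℓ : ℕ) (hℓ : ℓ ≤ n) (m : PlVar n k →₀ ℕ) :
    IsInit (fun p : ℕ × ℕ => Mmat n ℓ p.1 p.2) (pm K m) (eM ℓ m) (sgnM K ℓ m) :=
  isInit_monomial _ (pluMap K n k) (eJ ℓ) (fun J => sgnJ K ℓ J.val)
    (fun J => minor_isInit K ℓ hℓ J) m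

lemma split_two (q : PlVar n k →₀ ℕ) (I J : PlVar n k) (hI : q I ≠ 0) (hJ : q J ≠ 0)
    (hIJ : I ≠ J) : ∃ r, q = r + (Finsupp.single I 1 + Finsupp.single J 1) := by
  classical
  refine ⟨q - (Finsupp.single I 1 + Finsupp.single J 1), ?_⟩
  rw [tsub_add_cancel_of_le]
  intro A
  rw [Finsupp.add_apply, Finsupp.single_apply, Finsupp.single_apply]
  by_cases e1 : I = A
  · subst e1
    rw [if_neg (Ne.symm hIJ)]; simp; omega
  · rw [if_neg e1]
    by_cases e2 : J = A
    · subst e2; simp; omega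
    · simp [e2]

lemma straighten (m : PlVar n k →₀ ℕ) : pm K m ∈ Submodule.span K
    (pm K '' {U : PlVar n k →₀ ℕ | IsChainM U ∧ Finsupp.degree U = Finsupp.degree m}) := by
  classical
  by_contra hbad
  set L := Submodule.span K
    (pm K '' {U : PlVar n k →₀ ℕ | IsChainM U ∧ Finsupp.degree U = Finsupp.degree m}) with hL
  have hfin : {q : PlVar n k →₀ ℕ | Finsupp.degree q = Finsupp.degree m ∧ pm K q ∉ L}.Finite :=
    (Finsupp.finite_of_degree_le (Finsupp.degree m)).subset fun q hq => hq.1.le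
  let u : PlVar n k → ℤ := fun J => (entSum J : ℤ) ^ 2
  obtain ⟨q, ⟨hqd, hqL⟩, hmax⟩ := Set.exists_max_image _ (expWt u) hfin ⟨m, rfl, hbad⟩
  obtain ⟨I, J, hI, hJ, hIJ, hle⟩ : ∃ I J, q I ≠ 0 ∧ q J ≠ 0 ∧ ¬ TupLe I.val J.val ∧
      entSum I ≤ entSum J := by
    by_contra hno
    apply hqL
    refine Submodule.subset_span ⟨q, ⟨fun I J hI hJ => ?_, hqd⟩, rfl⟩
    by_contra h
    push Not at h
    rcases le_total (entSum I) (entSum J) with h1 | h1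
    · exact hno ⟨I, J, hI, hJ, h.1, h1⟩
    · exact hno ⟨J, I, hJ, hI, h.2, h1⟩
  have hne : I ≠ J := by rintro rfl; exact hIJ fun _ => le_rfl
  obtain ⟨r, hr⟩ := split_two q I J hI hJ hne
  obtain ⟨s, hs⟩ : ∃ s, J.val s < I.val s := by
    by_contra h; push Not at h; exact hIJ h
  have key := R0_minor K n I.val J.val I.2 J.2 s hs
  apply hqL
  have e : pm K q = LinearMap.mulLeft K (pm K r) (minorP K I.val * minorP K J.val) := by
    rw [hr, pm_add, pm_add, pm_single, pm_single, pluMap_X, pluMap_X]; rfl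
  rw [e]
  have hspan : Submodule.span K (R0set K n I.val J.val) ≤
      L.comap (LinearMap.mulLeft K (pm K r)) := by
    rw [Submodule.span_le]
    rintro _ ⟨a, b, rfl, h1, h2, ha, hb⟩
    change pm K r * (minorP K a * minorP K b) ∈ L
    rcases minorP_sort K a ha with h0 | ⟨A, ε, hA, hA'⟩
    · rw [h0]; simp
    rcases minorP_sort K b hb with h0 | ⟨B, δ, hB, hB'⟩
    · rw [h0]; simp
    have e2 : pm K r * (minorP K a * minorP K b) =
        (ε * δ) • pm K (r + (Finsupp.single A 1 + Finsupp.single B 1)) := by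
      rw [pm_add, pm_add, pm_single, pm_single, hA, hB]
      simp only [smul_mul_assoc, mul_smul_comm, smul_smul]
      rw [mul_comm δ ε]
    rw [e2]
    refine Submodule.smul_mem _ _ ?_
    by_contra hb'
    have hd : Finsupp.degree (r + (Finsupp.single A 1 + Finsupp.single B 1)) =
        Finsupp.degree m := by
      rw [← hqd, hr]
      simp only [map_add, Finsupp.degree_single]
    have hw := hmax _ ⟨hd, hb'⟩
    rw [hr] at hw
    simp only [expWt_add', expWt_single', u] at hw
    have g1 : (entSum A : ℤ) < entSum I := by
      rw [hA']; exact_mod_cast h1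
    have g2 : (entSum A : ℤ) + entSum B = entSum I + entSum J := by
      rw [hA', hB']; exact_mod_cast h2
    have g3 : (entSum I : ℤ) ≤ entSum J := by exact_mod_cast hle
    have g4 : (entSum B : ℤ) = entSum I + entSum J - entSum A := by linarith
    rw [g4] at hw
    push_cast at hw
    nlinarith [mul_pos (sub_pos.2 g1) (sub_pos.2 (lt_of_lt_of_le g1 g3))]
  exact hspan key

lemma spanning (hk : 0 < k) (S : Set (PlVar n k →₀ ℕ))
    (hS : ∀ m : PlVar n k →₀ ℕ, ∃ s ∈ S, eM 0 s = eM 0 m) (m : PlVar n k →₀ ℕ) :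
    pm K m ∈ Submodule.span K (pm K '' S) := by
  classical
  set L := Submodule.span K (pm K '' S) with hL
  suffices h : ∀ U : PlVar n k →₀ ℕ, IsChainM U → pm K U ∈ L by
    refine (Submodule.span_le.2 ?_) (straighten K m)
    rintro _ ⟨U, ⟨hU, _⟩, rfl⟩
    exact h U hU
  intro U0 hU0
  by_contra hbad
  set d := Finsupp.degree U0 with hd
  have hfin : {q : PlVar n k →₀ ℕ | Finsupp.degree q = d ∧ IsChainM q ∧ pm K q ∉ L}.Finite :=
    (Finsupp.finite_of_degree_le d).subset fun q hq => hq.1.le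
  let u : ℕ × ℕ → ℤ := fun p => Mmat n 0 p.1 p.2
  obtain ⟨U, ⟨hUd, hUc, hUL⟩, hmax⟩ :=
    Set.exists_max_image _ (fun q => expWt u (eM 0 q)) hfin ⟨U0, rfl, hU0, hbad⟩
  obtain ⟨s, hsS, hs⟩ := hS U
  have hsd : Finsupp.degree s = d := by
    have h1 := eM_degree 0 s
    rw [hs, eM_degree, hUd] at h1
    exact (Nat.eq_of_mul_eq_mul_left hk h1).symm
  let ι := {W : PlVar n k →₀ ℕ // IsChainM W ∧ Finsupp.degree W = d}
  have hst := straighten K s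
  rw [hsd] at hst
  have himg : pm K '' {U : PlVar n k →₀ ℕ | IsChainM U ∧ Finsupp.degree U = d} =
      Set.range (fun W : ι => pm K W.1) := by
    ext p
    constructor
    · rintro ⟨W, hW, rfl⟩; exact ⟨⟨W, hW⟩, rfl⟩
    · rintro ⟨W, rfl⟩; exact ⟨W.1, W.2, rfl⟩
  rw [himg, Finsupp.mem_span_range_iff_exists_finsupp] at hst
  obtain ⟨c, hc⟩ := hst
  obtain ⟨h1, h2, _, h4⟩ := comb_init (u := u) (p := fun W : ι => pm K W.1)
    (α := fun W => eM 0 W.1) (ε := fun W => sgnM K 0 W.1)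
    (fun W => pm_isInit K 0 (Nat.zero_le n) W.1) (fun W => sgnM_ne K 0 W.1)
    (fun W W' h => Subtype.ext (chain_inj hk W.1 W'.1 W.2.1 W'.2.1 h)) c (pm K s) hc.symm
    (eM 0 s) (sgnM K 0 s) (sgnM_ne K 0 s) (pm_isInit K 0 (Nat.zero_le n) s)
  let U' : ι := ⟨U, hUc, hUd⟩
  have hcU : c U' ≠ 0 := by
    intro h0
    have := h4 U' hs.symm
    rw [h0, zero_mul] at this
    exact sgnM_ne K 0 s this.symm
  have hU'mem : U' ∈ c.support := Finsupp.mem_support_iff.2 hcU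
  rw [Finsupp.sum, ← Finset.add_sum_erase _ _ hU'mem] at hc
  have hrest : ∑ W ∈ c.support.erase U', c W • pm K W.1 ∈ L := by
    refine Submodule.sum_mem _ fun W hW => Submodule.smul_mem _ _ ?_
    rw [Finset.mem_erase] at hW
    by_contra hWL
    have hw := hmax W.1 ⟨W.2.2, W.2.1, hWL⟩
    have hge := h1 W hW.2
    rw [hs] at hge
    have := h2 W hW.2 (by rw [hs]; exact le_antisymm hw hge)
    rw [hs] at this
    exact hW.1 (Subtype.ext (chain_inj hk _ _ W.2.1 hUc this))
  have hsL : pm K s ∈ L := Submodule.subset_span ⟨s, hsS, rfl⟩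
  have : c U' • pm K U ∈ L := by
    have e : c U' • pm K U = pm K s - ∑ W ∈ c.support.erase U', c W • pm K W.1 := by
      rw [← hc]; simp [U']
    rw [e]
    exact Submodule.sub_mem _ hsL hrest
  exact hUL ((Submodule.smul_mem_iff _ hcU).1 this)

end straight

/-! ### Restriction to a set of variables -/

section restr

variable {K : Type*} [Field K] {n k : ℕ} (T : Set (PlVar n k))

open Classical in
/-- The projection killing the variables outside `T`. -/
noncomputable def piT : MvPolynomial (PlVar n k) K →ₐ[K] MvPolynomial T K :=
  aeval fun J => if h : J ∈ T then X ⟨J, h⟩ else 0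

lemma piT_rename (f : MvPolynomial T K) : piT T (rename (fun x : T => (x : PlVar n k)) f) = f := by
  have : (piT T).comp (rename (fun x : T => (x : PlVar n k))) = AlgHom.id K (MvPolynomial T K) := by
    apply MvPolynomial.algHom_ext
    intro J
    simp [piT, rename_X]
  exact DFunLike.congr_fun this f

lemma rename_piT (g : MvPolynomial (PlVar n k) K) :
    rename (fun x : T => (x : PlVar n k)) (piT T g) - g ∈
      Ideal.span ((X : PlVar n k → MvPolynomial (PlVar n k) K) '' {J | J ∉ T}) := by
  rw [← Ideal.Quotient.eq]
  have : ((Ideal.Quotient.mkₐ K (Ideal.span ((X : PlVar n k → MvPolynomial (PlVar n k) K) ''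
      {J | J ∉ T}))).comp (rename (fun x : T => (x : PlVar n k)))).comp (piT T) =
      Ideal.Quotient.mkₐ K _ := by
    apply MvPolynomial.algHom_ext
    intro J
    simp only [AlgHom.comp_apply, piT, aeval_X]
    split_ifs with h
    · rw [rename_X]
    · rw [map_zero, map_zero, eq_comm]
      exact Ideal.Quotient.eq_zero_iff_mem.2 (Ideal.subset_span ⟨J, h, rfl⟩)
  exact DFunLike.congr_fun this g

lemma mem_restrict (G : Ideal (MvPolynomial (PlVar n k) K)) (f : MvPolynomial T K) :
    f ∈ restrictIdeal G T ↔ ∃ g ∈ G, f = piT T g := by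
  unfold restrictIdeal
  rw [Ideal.mem_comap]
  constructor
  · intro h
    obtain ⟨g, hg, y, hy, e⟩ := Submodule.mem_sup.1 h
    refine ⟨g, hg, ?_⟩
    have h0 : piT T y = 0 := by
      have : Ideal.span ((X : PlVar n k → MvPolynomial (PlVar n k) K) '' {J | J ∉ T}) ≤
          RingHom.ker (piT T) := by
        rw [Ideal.span_le]
        rintro _ ⟨J, hJ, rfl⟩
        change piT T (X J) = 0
        rw [piT, aeval_X, dif_neg hJ]
      exact this hy
    rw [← piT_rename T f, ← e, map_add, h0, add_zero]
  · rintro ⟨g, hg, rfl⟩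
    have := rename_piT T g
    have e : rename (fun x : T => (x : PlVar n k)) (piT T g) =
      g + (rename (fun x : T => (x : PlVar n k)) (piT T g) - g) := by ring
    rw [e]
    exact Submodule.add_mem_sup hg this

/-- Extension by zero of exponents. -/
noncomputable def EX (m : T →₀ ℕ) : PlVar n k →₀ ℕ := m.mapDomain (fun x : T => (x : PlVar n k))

lemma EX_inj : Function.Injective (EX T) :=
  Finsupp.mapDomain_injective Subtype.val_injective

/-- The support is contained in `T`. -/
def InT (m : PlVar n k →₀ ℕ) : Prop := ∀ J, m J ≠ 0 → J ∈ T

lemma inT_EX (m : T →₀ ℕ) : InT T (EX T m) := by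
  intro J hJ
  by_contra h
  apply hJ
  exact Finsupp.mapDomain_of_notMem_range _ _ (by simpa using h)

lemma exists_EX (m : PlVar n k →₀ ℕ) (h : InT T m) : ∃ m' : T →₀ ℕ, EX T m' = m := by
  refine ⟨m.comapDomain _ (Subtype.val_injective.injOn), ?_⟩
  apply Finsupp.mapDomain_comapDomain _ Subtype.val_injective
  intro J hJ
  exact ⟨⟨J, h J (Finsupp.mem_support_iff.1 hJ)⟩, rfl⟩

lemma rename_mon (m : T →₀ ℕ) (c : K) :
    rename (fun x : T => (x : PlVar n k)) (monomial m c) = monomial (EX T m) c :=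
  rename_monomial _ _ _

lemma piT_mon (m : T →₀ ℕ) (c : K) : piT T (monomial (EX T m) c) = monomial m c := by
  rw [← rename_mon, piT_rename]

lemma piT_mon_out (m : PlVar n k →₀ ℕ) (c : K) (h : ¬ InT T m) : piT T (monomial m c) = 0 := by
  unfold InT at h
  push Not at h
  obtain ⟨J, hJ, hJT⟩ := h
  rw [piT, aeval_monomial, Finsupp.prod, Finset.prod_eq_zero (Finsupp.mem_support_iff.2 hJ),
    mul_zero]
  rw [dif_neg hJT, zero_pow hJ]

lemma coeff_piT (g : MvPolynomial (PlVar n k) K) (m : T →₀ ℕ) :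
    coeff m (piT T g) = coeff (EX T m) g := by
  classical
  induction g using MvPolynomial.induction_on' with
  | monomial u a =>
    by_cases h : InT T u
    · obtain ⟨u', rfl⟩ := exists_EX T u h
      rw [piT_mon, coeff_monomial, coeff_monomial]
      simp only [(EX_inj T).eq_iff]
    · rw [piT_mon_out T u a h, coeff_zero, coeff_monomial, if_neg]
      rintro rfl
      exact h (inT_EX T m)
  | add p q hp hq => rw [map_add, coeff_add, coeff_add, hp, hq]

lemma EX_sum {N : Type*} [AddCommMonoid N] (m : T →₀ ℕ) (F : PlVar n k → ℕ → N)
    (h0 : ∀ J, F J 0 = 0) (h1 : ∀ J a b, F J (a + b) = F J a + F J b) :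
    (EX T m).sum F = m.sum fun J e => F J e :=
  Finsupp.sum_mapDomain_index h0 h1

lemma expWt_EX (u : PlVar n k → ℤ) (m : T →₀ ℕ) :
    expWt (fun x : T => u x) m = expWt u (EX T m) := by
  unfold expWt
  rw [EX_sum] <;> intros <;> simp [mul_add]

end restr

/-! ### Remainders -/

open Classical in
lemma coeff_csum {K τ : Type*} [Field K] (S : Set (τ →₀ ℕ)) (c : S →₀ K) (q : τ →₀ ℕ) :
    coeff q (c.sum fun s r => monomial s.1 r) = if h : q ∈ S then c ⟨q, h⟩ else 0 := by
  rw [Finsupp.sum, coeff_sum]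
  simp only [coeff_monomial]
  split_ifs with h
  · rw [Finset.sum_eq_single ⟨q, h⟩]
    · simp
    · intro b _ hb
      rw [if_neg]
      rintro rfl
      exact hb rfl
    · intro hn
      rw [Finsupp.notMem_support_iff.1 hn]; simp
  · refine Finset.sum_eq_zero fun b _ => ?_
    rw [if_neg]
    rintro rfl
    exact h b.2

lemma exists_rem (K : Type*) [Field K] {n k : ℕ} (hk : 0 < k) (ℓ : ℕ) (hℓ : ℓ ≤ n)
    (S : Set (PlVar n k →₀ ℕ))
    (hS : ∀ m : PlVar n k →₀ ℕ, ∃ s ∈ S, eM 0 s = eM 0 m)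
    (hSi : ∀ s ∈ S, ∀ s' ∈ S, eM ℓ s = eM ℓ s' → s = s') (m : PlVar n k →₀ ℕ) :
    ∃ R : MvPolynomial (PlVar n k) K, pluMap K n k R = pluMap K n k (monomial m 1) ∧
      (∀ q, coeff q R ≠ 0 → q ∈ S ∧
        expWt (fun J : PlVar n k => wVec n ℓ J.val) m ≤
          expWt (fun J : PlVar n k => wVec n ℓ J.val) q ∧
        (expWt (fun J : PlVar n k => wVec n ℓ J.val) q =
          expWt (fun J : PlVar n k => wVec n ℓ J.val) m → eM ℓ q = eM ℓ m)) ∧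
      (∀ s ∈ S, eM ℓ s = eM ℓ m → coeff s R = 1) ∧ ∃ s ∈ S, eM ℓ s = eM ℓ m := by
  classical
  have h := spanning K hk S hS m
  rw [Set.image_eq_range, Finsupp.mem_span_range_iff_exists_finsupp] at h
  obtain ⟨c, hc⟩ := h
  obtain ⟨h1, h2, ⟨s0, _, hs0⟩, h4⟩ := comb_init (u := fun p : ℕ × ℕ => Mmat n ℓ p.1 p.2)
    (p := fun s : S => pm K s.1)
    (α := fun s => eM ℓ s.1) (ε := fun s => sgnM K ℓ s.1)
    (fun s => pm_isInit K ℓ hℓ s.1) (fun s => sgnM_ne K ℓ s.1)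
    (fun s s' h => Subtype.ext (hSi _ s.2 _ s'.2 h)) c (pm K m) hc.symm
    (eM ℓ m) (sgnM K ℓ m) (sgnM_ne K ℓ m) (pm_isInit K ℓ hℓ m)
  have hcoe := coeff_csum S c
  have h1' : ∀ s : S, c s ≠ 0 → expWt (fun p : ℕ × ℕ => Mmat n ℓ p.1 p.2) (eM ℓ m) ≤
      expWt (fun p : ℕ × ℕ => Mmat n ℓ p.1 p.2) (eM ℓ s.1) :=
    fun s hs => h1 s (Finsupp.mem_support_iff.2 hs)
  have h2' : ∀ s : S, c s ≠ 0 → expWt (fun p : ℕ × ℕ => Mmat n ℓ p.1 p.2) (eM ℓ s.1) =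
      expWt (fun p : ℕ × ℕ => Mmat n ℓ p.1 p.2) (eM ℓ m) → eM ℓ s.1 = eM ℓ m :=
    fun s hs => h2 s (Finsupp.mem_support_iff.2 hs)
  have h4' : ∀ s : S, eM ℓ s.1 = eM ℓ m → c s * sgnM K ℓ s.1 = sgnM K ℓ m := h4
  clear h1 h2 h4
  refine ⟨c.sum fun s r => monomial s.1 r, ?_, ?_, ?_, ⟨s0.1, s0.2, hs0⟩⟩
  · change _ = pm K m
    rw [← hc, Finsupp.sum, Finsupp.sum, map_sum]
    refine Finset.sum_congr rfl fun s _ => ?_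
    rw [pm, ← map_smul, smul_monomial, smul_eq_mul, mul_one]
  · intro q hq
    rw [hcoe] at hq
    by_cases h : q ∈ S
    · rw [dif_pos h] at hq
      rw [expWt_eM, expWt_eM]
      exact ⟨h, h1' ⟨q, h⟩ hq, h2' ⟨q, h⟩ hq⟩
    · rw [dif_neg h] at hq
      exact absurd rfl hq
  · intro s hs he
    rw [hcoe, dif_pos hs]
    have h5 := h4' ⟨s, hs⟩ he
    have e : sgnM K ℓ s = sgnM K ℓ m := sgn_eq K ℓ s m he
    rw [e] at h5
    exact mul_right_cancel₀ (sgnM_ne K ℓ m) (by rw [h5, one_mul])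

/-! ### The Richardson specialization -/

section psi

variable (K : Type*) [Field K] {n k : ℕ}

/-- Entries allowed for the Richardson variety. -/
def Allowed (v w : PlVar n k) (p : ℕ × ℕ) : Prop :=
  ∃ i : Fin k, p.1 = (i : ℕ) + 1 ∧ v.val i ≤ p.2 ∧ p.2 ≤ w.val i

open Classical in
/-- Killing the variables which are not allowed. -/
noncomputable def psiV (v w : PlVar n k) :
    MvPolynomial (ℕ × ℕ) K →ₐ[K] MvPolynomial (ℕ × ℕ) K :=
  aeval fun p => if Allowed v w p then X p else 0

open Classical in
lemma coeff_psiV (v w : PlVar n k) (p : MvPolynomial (ℕ × ℕ) K) (β : ℕ × ℕ →₀ ℕ) :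
    coeff β (psiV K v w p) = if ∀ x, β x ≠ 0 → Allowed v w x then coeff β p else 0 := by
  induction p using MvPolynomial.induction_on' with
  | monomial u a =>
    by_cases h : ∀ x, u x ≠ 0 → Allowed v w x
    · have : psiV K v w (monomial u a) = monomial u a := by
        rw [psiV, aeval_monomial, monomial_eq]
        congr 1
        refine Finset.prod_congr rfl fun x hx => ?_
        simp only
        rw [if_pos (h x (Finsupp.mem_support_iff.1 hx))]
      rw [this, coeff_monomial]
      by_cases e : u = β
      · subst e
        simp only [if_true]
        rw [if_pos h]
      · simp [e]
    · have : psiV K v w (monomial u a) = 0 := by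
        push Not at h
        obtain ⟨x, hx, hA⟩ := h
        rw [psiV, aeval_monomial, Finsupp.prod,
          Finset.prod_eq_zero (Finsupp.mem_support_iff.2 hx), mul_zero]
        rw [if_neg hA, zero_pow hx]
      rw [this, coeff_zero, coeff_monomial]
      by_cases e : u = β
      · subst e
        rw [if_neg h]
      · simp [e]
  | add p q hp hq =>
    rw [map_add, coeff_add, coeff_add, hp, hq]
    split_ifs <;> simp

lemma perm_exists_ge (σ : Equiv.Perm (Fin k)) (c : Fin k) : ∃ c' ≤ c, c ≤ σ c' := by
  classical
  by_contra h
  push Not at h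
  have : (Finset.Iic c).card ≤ (Finset.Iio c).card :=
    Finset.card_le_card_of_injOn σ (fun x hx => by
      simp only [Finset.coe_Iic, Set.mem_Iic, Finset.coe_Iio, Set.mem_Iio] at hx ⊢
      exact h x hx) (σ.injective.injOn)
  rw [Fin.card_Iic, Fin.card_Iio] at this
  omega

lemma perm_exists_le (σ : Equiv.Perm (Fin k)) (c : Fin k) : ∃ c', c ≤ c' ∧ σ c' ≤ c := by
  classical
  by_contra h
  push Not at h
  have : (Finset.Ici c).card ≤ (Finset.Ioi c).card :=
    Finset.card_le_card_of_injOn σ (fun x hx => by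
      simp only [Finset.coe_Ici, Set.mem_Ici, Finset.coe_Ioi, Set.mem_Ioi] at hx ⊢
      exact h x hx) (σ.injective.injOn)
  rw [Fin.card_Ici, Fin.card_Ioi] at this
  have := c.isLt
  omega

lemma permExp_ne (J : Fin k → ℕ) (σ : Equiv.Perm (Fin k)) (c : Fin k) :
    permExp J σ ((σ c : ℕ) + 1, J c) ≠ 0 := by
  rw [permExp_apply]; simp

lemma psiV_out (v w I : PlVar n k) (hI : I ∉ TWV v w) :
    psiV K v w (pluMap K n k (X I)) = 0 := by
  classical
  ext β
  rw [coeff_psiV, coeff_zero]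
  split_ifs with h
  · by_contra hne
    rw [pluMap_X] at hne
    obtain ⟨σ, rfl⟩ := coeff_minorP K I.val β hne
    have hA : ∀ c, v.val (σ c) ≤ I.val c ∧ I.val c ≤ w.val (σ c) := by
      intro c
      obtain ⟨i, h1, h2⟩ := h _ (permExp_ne I.val σ c)
      have : σ c = i := Fin.ext (by simpa using h1)
      rw [this]; exact h2
    apply hI
    constructor
    · intro c
      obtain ⟨c', h1, h2⟩ := perm_exists_ge σ c
      exact (v.2.1.monotone h2).trans ((hA c').1.trans (I.2.1.monotone h1))
    · intro c
      obtain ⟨c', h1, h2⟩ := perm_exists_le σ c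
      exact (I.2.1.monotone h1).trans ((hA c').2.trans (w.2.1.monotone h2))
  · rfl

lemma psiV_in (v w I : PlVar n k) (hI : I ∈ TWV v w) :
    IsInit (fun p : ℕ × ℕ => Mmat n 0 p.1 p.2) (psiV K v w (pluMap K n k (X I))) (eJ 0 I)
      (sgnJ K 0 I.val) := by
  classical
  have h := minor_isInit K 0 (Nat.zero_le n) I
  constructor
  · rw [coeff_psiV, if_pos, h.1]
    rintro ⟨q, t⟩ hx
    rw [eJ_eq] at hx
    by_cases hq : q = 0 ∨ k < q
    · exact absurd (permExp_apply_zero _ _ _ _ hq) hx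
    · push Not at hq
      obtain ⟨r, rfl⟩ : ∃ r : Fin k, q = (r : ℕ) + 1 := ⟨⟨q - 1, by omega⟩, by simp; omega⟩
      rw [← eJ_eq, eJ_zero_apply] at hx
      have : I.val r = t := by
        by_contra hne
        rw [if_neg hne] at hx
        exact hx rfl
      subst this
      exact ⟨r, rfl, hI.1 r, hI.2 r⟩
  · intro β hβ hne
    rw [coeff_psiV] at hβ
    split_ifs at hβ with hA
    · exact h.2 β hβ hne
    · exact absurd rfl hβ

end psi

lemma ker_zero {K σ τ : Type*} [Field K] (u : σ → ℤ)
    (Θ : MvPolynomial τ K →ₐ[K] MvPolynomial σ K) (a : τ → σ →₀ ℕ) (ε : τ → K)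
    (h : ∀ J, IsInit u (Θ (X J)) (a J) (ε J)) (hε : ∀ J, ε J ≠ 0) (r : MvPolynomial τ K)
    (hinj : ∀ s s', coeff s r ≠ 0 → coeff s' r ≠ 0 →
      (s.sum fun J e => e • a J) = (s'.sum fun J e => e • a J) → s = s') (h0 : Θ r = 0) :
    r = 0 := by
  classical
  let c : {s // s ∈ r.support} →₀ K := Finsupp.equivFunOnFinite.symm fun s => coeff s.1 r
  have hc : c = 0 := by
    refine comb_eq_zero (u := u) (p := fun s : {s // s ∈ r.support} => Θ (monomial s.1 1))
      (fun s => isInit_monomial u Θ a ε h s.1)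
      (fun s => Finset.prod_ne_zero_iff.2 fun J _ => pow_ne_zero _ (hε J))
      (fun s s' he => Subtype.ext (hinj _ _ (mem_support_iff.1 s.2) (mem_support_iff.1 s'.2) he))
      c ?_
    rw [Finsupp.sum_fintype _ _ (by simp)]
    rw [← h0]
    conv_rhs => rw [r.as_sum, map_sum, ← Finset.sum_coe_sort]
    refine Finset.sum_congr rfl fun s _ => ?_
    rw [← map_smul, smul_monomial, smul_eq_mul, mul_one]
    rfl
  by_contra hr
  obtain ⟨s, hs⟩ := MvPolynomial.ne_zero_iff.1 hr
  exact hs (DFunLike.congr_fun hc ⟨s, mem_support_iff.2 hs⟩)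

/-! ### Comparison of the three ideals -/

section final

variable {K : Type*} [Field K] {n k : ℕ} (T : Set (PlVar n k)) (ℓ : ℕ)

/-- The restricted monomial map. -/
noncomputable def PhiR (K : Type*) [Field K] {n k : ℕ} (T : Set (PlVar n k)) (ℓ : ℕ) :
    MvPolynomial T K →ₐ[K] MvPolynomial (ℕ × ℕ) K :=
  (phiMF K n k ℓ).comp (rename fun x : T => (x : PlVar n k))

lemma PhiR_mon (m : T →₀ ℕ) (c : K) :
    PhiR K T ℓ (monomial m c) = monomial (eM ℓ (EX T m)) c := by
  rw [PhiR, AlgHom.comp_apply, rename_mon, phi_monomial]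

lemma mem_kerPhi (f : MvPolynomial T K) : f ∈ kerPhiRes K n k ℓ T ↔ PhiR K T ℓ f = 0 := Iff.rfl

lemma fibre (hmf : MonomialFree (restrictIdeal (RingHom.ker (phiMF K n k ℓ)) T))
    (m m' : PlVar n k →₀ ℕ) (hm : InT T m) (he : eM ℓ m = eM ℓ m') : InT T m' := by
  by_contra h
  obtain ⟨m0, rfl⟩ := exists_EX T m hm
  apply hmf m0
  rw [mem_restrict]
  refine ⟨monomial (EX T m0) 1 - monomial m' 1, ?_, ?_⟩
  · rw [RingHom.mem_ker, map_sub, phi_monomial, phi_monomial, he, sub_self]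
  · rw [map_sub, piT_mon, piT_mon_out T m' 1 h, sub_zero]

open Classical in
lemma coeff_PhiR_piT (hfib : ∀ m m' : PlVar n k →₀ ℕ, InT T m → eM ℓ m = eM ℓ m' → InT T m')
    (g : MvPolynomial (PlVar n k) K) (β : ℕ × ℕ →₀ ℕ) :
    coeff β (PhiR K T ℓ (piT T g)) =
      if ∃ m, InT T m ∧ eM ℓ m = β then coeff β (phiMF K n k ℓ g) else 0 := by
  induction g using MvPolynomial.induction_on' with
  | monomial u a =>
    rw [phi_monomial, coeff_monomial]
    by_cases h : InT T u
    · obtain ⟨u', rfl⟩ := exists_EX T u h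
      rw [piT_mon, PhiR_mon, coeff_monomial]
      by_cases e : eM ℓ (EX T u') = β
      · rw [if_pos e, if_pos ⟨_, h, e⟩]
      · rw [if_neg e, ite_self]
    · rw [piT_mon_out T u a h, map_zero, coeff_zero]
      by_cases e : eM ℓ u = β
      · rw [if_neg]
        rintro ⟨m, hm, hm'⟩
        exact h (hfib m u hm (hm'.trans e.symm))
      · rw [if_neg e, ite_self]
  | add p q hp hq =>
    rw [map_add, map_add, coeff_add, hp, hq, map_add, coeff_add]
    split_ifs <;> simp

lemma restrict_eq_kerPhi (hmf : MonomialFree (restrictIdeal (RingHom.ker (phiMF K n k ℓ)) T)) :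
    restrictIdeal (RingHom.ker (phiMF K n k ℓ)) T = kerPhiRes K n k ℓ T := by
  classical
  apply le_antisymm
  · intro f hf
    rw [mem_restrict] at hf
    obtain ⟨g, hg, rfl⟩ := hf
    rw [RingHom.mem_ker] at hg
    rw [mem_kerPhi]
    ext β
    rw [coeff_PhiR_piT T ℓ (fibre T ℓ hmf), hg, coeff_zero, ite_self]
  · intro f hf
    rw [mem_restrict]
    exact ⟨rename (fun x : T => (x : PlVar n k)) f, hf, (piT_rename T f).symm⟩

/-- The weight of exponents. -/
lemma expWt_T (m : T →₀ ℕ) :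
    expWt (fun x : T => wVec n ℓ (x : PlVar n k).val) m =
      expWt (fun J : PlVar n k => wVec n ℓ J.val) (EX T m) :=
  expWt_EX T (fun J : PlVar n k => wVec n ℓ J.val) m

lemma ker_le_init (hk : 0 < k) (hℓ : ℓ ≤ n)
    (hmf : MonomialFree (restrictIdeal (RingHom.ker (phiMF K n k ℓ)) T)) :
    kerPhiRes K n k ℓ T ≤ initialIdeal (fun x : T => wVec n ℓ (x : PlVar n k).val)
      (restrictIdeal (RingHom.ker (pluMap K n k)) T) := by
  classical
  obtain ⟨S, hS, -, hSi⟩ := exists_reps n k ℓ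
  choose R hR1 hR2 hR3 hR4 using exists_rem K hk ℓ hℓ S hS hSi
  choose t htS hte using hR4
  have htT : ∀ m : T →₀ ℕ, ∃ q : T →₀ ℕ, EX T q = t (EX T m) := fun m =>
    exists_EX T _ (fibre T ℓ hmf _ _ (inT_EX T m) (hte _).symm)
  choose t' ht' using htT
  have hbin : ∀ m : T →₀ ℕ, (monomial m 1 - monomial (t' m) 1 : MvPolynomial T K) ∈
      initialIdeal (fun x : T => wVec n ℓ (x : PlVar n k).val)
      (restrictIdeal (RingHom.ker (pluMap K n k)) T) := by
    intro m
    have hWt : expWt (fun J : PlVar n k => wVec n ℓ J.val) (t (EX T m)) =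
        expWt (fun J : PlVar n k => wVec n ℓ J.val) (EX T m) := by
      rw [expWt_eM, expWt_eM, hte]
    have hco : ∀ q : T →₀ ℕ, coeff q (piT T (monomial (EX T m) 1 - R (EX T m))) =
        (if m = q then 1 else 0) - coeff (EX T q) (R (EX T m)) := by
      intro q
      rw [coeff_piT, coeff_sub, coeff_monomial]
      simp only [(EX_inj T).eq_iff]
    refine mem_initialIdeal _ _ (piT T (monomial (EX T m) 1 - R (EX T m))) _ ?_
      (expWt (fun J : PlVar n k => wVec n ℓ J.val) (EX T m)) ?_ ?_ ?_
    · rw [mem_restrict]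
      refine ⟨_, ?_, rfl⟩
      rw [RingHom.mem_ker, map_sub, hR1, sub_self]
    · intro q hq
      rw [expWt_T]
      rw [hco] at hq
      by_cases e : m = q
      · rw [e]
      · rw [if_neg e, zero_sub, neg_ne_zero] at hq
        exact (hR2 _ _ hq).2.1
    · intro q hq
      rw [expWt_T] at hq
      rw [hco, coeff_sub, coeff_monomial, coeff_monomial]
      congr 1
      by_cases e : t' m = q
      · rw [if_pos e, ← e, ht', hR3 _ _ (htS _) (hte _)]
      · rw [if_neg e]
        by_contra hne
        have hne' := Ne.symm hne
        obtain ⟨h1, -, h3⟩ := hR2 _ _ hne'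
        apply e
        apply EX_inj T
        rw [ht']
        exact hSi _ (htS _) _ h1 ((hte _).trans (h3 hq).symm)
    · intro q hq
      rw [expWt_T] at hq
      rw [coeff_sub, coeff_monomial, coeff_monomial, if_neg, if_neg, sub_zero]
      · rintro rfl
        rw [ht'] at hq
        exact hq hWt
      · rintro rfl
        exact hq rfl
  have hfac : ∀ m m' : T →₀ ℕ, eM ℓ (EX T m) = eM ℓ (EX T m') → t' m = t' m' := by
    intro m m' h
    apply EX_inj T
    rw [ht', ht']
    exact hSi _ (htS _) _ (htS _) (by rw [hte, hte, h])
  let hh : (ℕ × ℕ →₀ ℕ) → (T →₀ ℕ) := fun β =>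
    if h : ∃ m : T →₀ ℕ, eM ℓ (EX T m) = β then t' h.choose else 0
  have hhh : ∀ m : T →₀ ℕ, hh (eM ℓ (EX T m)) = t' m := by
    intro m
    have h : ∃ m' : T →₀ ℕ, eM ℓ (EX T m') = eM ℓ (EX T m) := ⟨m, rfl⟩
    simp only [hh]
    rw [dif_pos h]
    exact hfac _ _ h.choose_spec
  let Λ : MvPolynomial (ℕ × ℕ) K →ₗ[K] MvPolynomial T K :=
    (basisMonomials (ℕ × ℕ) K).constr K (fun β => monomial (hh β) (1 : K))
  have hΛ : ∀ β (a : K), Λ (monomial β a) = a • monomial (hh β) (1 : K) := by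
    intro β a
    have : (monomial β a : MvPolynomial (ℕ × ℕ) K) = a • basisMonomials (ℕ × ℕ) K β := by
      rw [coe_basisMonomials, smul_monomial, smul_eq_mul, mul_one]
    rw [this, map_smul, Module.Basis.constr_basis]
  have hall : ∀ f : MvPolynomial T K, f - Λ (PhiR K T ℓ f) ∈
      initialIdeal (fun x : T => wVec n ℓ (x : PlVar n k).val)
      (restrictIdeal (RingHom.ker (pluMap K n k)) T) := by
    intro f
    induction f using MvPolynomial.induction_on' with
    | monomial m a =>
      rw [PhiR_mon, hΛ, hhh]
      have : (monomial m a : MvPolynomial T K) - a • monomial (t' m) 1 =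
          C a * (monomial m 1 - monomial (t' m) 1) := by
        rw [mul_sub, C_mul_monomial, mul_one, smul_eq_C_mul]
      rw [this]
      exact Ideal.mul_mem_left _ _ (hbin m)
    | add p q hp hq =>
      have := add_mem hp hq
      rw [map_add, map_add]
      convert this using 1
      ring
  intro f hf
  rw [mem_kerPhi] at hf
  have := hall f
  rwa [hf, map_zero, sub_zero] at this

lemma init_le_ker (hk : 0 < k) (hℓ : ℓ ≤ n) (v w : PlVar n k)
    (hmf : MonomialFree (restrictIdeal (RingHom.ker (phiMF K n k ℓ)) (TWV v w))) :
    initialIdeal (fun x : TWV v w => wVec n ℓ (x : PlVar n k).val)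
      (restrictIdeal (RingHom.ker (pluMap K n k)) (TWV v w)) ≤ kerPhiRes K n k ℓ (TWV v w) := by
  classical
  obtain ⟨S, hS, hS0, hSi⟩ := exists_reps n k ℓ
  choose R hR1 hR2 hR3 hR4 using exists_rem K hk ℓ hℓ S hS hSi
  unfold initialIdeal
  rw [Ideal.span_le]
  rintro _ ⟨f, hf, rfl⟩
  change initialForm _ f ∈ kerPhiRes K n k ℓ (TWV v w)
  rw [mem_kerPhi]
  have hsum0 : ∀ q : TWV v w →₀ ℕ,
      ∑ m ∈ f.support, coeff m f * coeff (EX _ q) (R (EX _ m)) = 0 := by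
    let G : MvPolynomial (PlVar n k) K := ∑ m ∈ f.support, coeff m f • R (EX _ m)
    have hcG : ∀ q, coeff q (piT (TWV v w) G) =
        ∑ m ∈ f.support, coeff m f * coeff (EX _ q) (R (EX _ m)) := by
      intro q
      rw [coeff_piT, coeff_sum]
      simp only [coeff_smul, smul_eq_mul]
    have hplu : pluMap K n k (rename (fun x : TWV v w => (x : PlVar n k)) f) =
        pluMap K n k G := by
      conv_lhs => rw [f.as_sum]
      rw [map_sum, map_sum, map_sum]
      refine Finset.sum_congr rfl fun m _ => ?_
      rw [rename_mon, map_smul, hR1, ← map_smul, smul_monomial, smul_eq_mul, mul_one]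
    have hmem : piT (TWV v w) G ∈ restrictIdeal (RingHom.ker (pluMap K n k)) (TWV v w) := by
      have h1 : f - piT (TWV v w) G ∈ restrictIdeal (RingHom.ker (pluMap K n k)) (TWV v w) := by
        rw [mem_restrict]
        refine ⟨rename (fun x : TWV v w => (x : PlVar n k)) f - G, ?_, ?_⟩
        · rw [RingHom.mem_ker, map_sub, hplu, sub_self]
        · rw [map_sub, piT_rename]
      have := sub_mem hf h1
      rwa [sub_sub_cancel] at this
    let Θ : MvPolynomial (TWV v w) K →ₐ[K] MvPolynomial (ℕ × ℕ) K :=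
      ((psiV K v w).comp (pluMap K n k)).comp (rename (fun x : TWV v w => (x : PlVar n k)))
    have hΘ : Θ (piT (TWV v w) G) = 0 := by
      rw [mem_restrict] at hmem
      obtain ⟨g, hg, e⟩ := hmem
      rw [e]
      have h1 := rename_piT (TWV v w) g
      have h2 : Ideal.span ((X : PlVar n k → MvPolynomial (PlVar n k) K) ''
          {J | J ∉ TWV v w}) ≤ RingHom.ker ((psiV K v w).comp (pluMap K n k)) := by
        rw [Ideal.span_le]
        rintro _ ⟨J, hJ, rfl⟩
        exact psiV_out K v w J hJ
      have h3 := h2 h1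
      rw [RingHom.mem_ker, map_sub, sub_eq_zero] at h3
      change ((psiV K v w).comp (pluMap K n k)) _ = 0
      refine h3.trans ?_
      rw [AlgHom.comp_apply, RingHom.mem_ker.1 hg, map_zero]
    have hr : piT (TWV v w) G = 0 := by
      refine ker_zero (fun p : ℕ × ℕ => Mmat n 0 p.1 p.2) Θ
        (fun J : TWV v w => eJ 0 (J : PlVar n k)) (fun J => sgnJ K 0 (J : PlVar n k).val)
        ?_ (fun J => sgnJ_ne K 0 _) _ ?_ hΘ
      · intro J
        have : Θ (X J) = psiV K v w (pluMap K n k (X (J : PlVar n k))) := by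
          simp only [Θ, AlgHom.comp_apply, rename_X]
        rw [this]
        exact psiV_in K v w J J.2
      · intro s s' hs hs' he
        have key : ∀ q, coeff q (piT (TWV v w) G) ≠ 0 → EX _ q ∈ S := by
          intro q hq
          rw [hcG] at hq
          obtain ⟨m, -, hm⟩ := Finset.exists_ne_zero_of_sum_ne_zero hq
          exact (hR2 _ _ (right_ne_zero_of_mul hm)).1
        have hE : ∀ q : TWV v w →₀ ℕ, (q.sum fun J e => e • eJ 0 (J : PlVar n k)) =
            eM 0 (EX _ q) := by
          intro q
          unfold eM
          rw [EX_sum]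
          · intro J; simp
          · intro J a b; rw [add_smul]
        rw [hE, hE] at he
        exact EX_inj _ (hS0 _ (key s hs) _ (key s' hs') he)
    intro q
    rw [← hcG, hr, coeff_zero]
  ext β
  rw [coeff_zero, initialForm, map_sum, coeff_sum]
  simp only [PhiR_mon, coeff_monomial]
  by_cases hex : ∃ m0 ∈ f.support.filter (fun m => ∀ m' ∈ f.support,
      expWt (fun x : TWV v w => wVec n ℓ (x : PlVar n k).val) m ≤
      expWt (fun x : TWV v w => wVec n ℓ (x : PlVar n k).val) m'),
      eM ℓ (EX _ m0) = β
  · obtain ⟨m0, hm0, he0⟩ := hex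
    rw [Finset.mem_filter] at hm0
    obtain ⟨hm0, hmin⟩ := hm0
    obtain ⟨s, hs, hse⟩ := hR4 (EX _ m0)
    obtain ⟨q, rfl⟩ := exists_EX (TWV v w) s
      (fibre _ ℓ hmf _ _ (inT_EX _ m0) hse.symm)
    rw [Finset.sum_filter]
    refine Eq.trans ?_ (hsum0 q)
    refine Finset.sum_congr rfl fun m hm => ?_
    by_cases e : eM ℓ (EX _ m) = β
    · rw [if_pos e, hR3 _ _ hs (by rw [hse, he0, e]), mul_one, if_pos]
      intro m' hm'
      refine le_trans (le_of_eq ?_) (hmin m' hm')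
      rw [expWt_T, expWt_T, expWt_eM, expWt_eM, e, he0]
    · rw [if_neg e, ite_self]
      by_contra hne
      have hne' := right_ne_zero_of_mul (Ne.symm hne)
      obtain ⟨-, h2, h3⟩ := hR2 _ _ hne'
      have h4 := hmin m hm
      rw [expWt_T, expWt_T] at h4
      have h5 : expWt (fun J : PlVar n k => wVec n ℓ J.val) (EX _ q) =
          expWt (fun J : PlVar n k => wVec n ℓ J.val) (EX _ m0) := by
        rw [expWt_eM, expWt_eM, hse]
      have h6 := h3 (le_antisymm (h5.le.trans h4) h2)
      exact e (by rw [← h6, hse, he0])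
  · refine Finset.sum_eq_zero fun m hm => ?_
    rw [if_neg]
    intro e
    exact hex ⟨m, hm, e⟩

end final

/-- If `G_{k,n,ℓ}|_w^v` is monomial-free and `in_{w_ℓ}(I(X_w^v))` is
generated by homogeneous polynomials of degree two, then the three ideals
`in_{w_ℓ}(I(X_w^v))`, `G_{k,n,ℓ}|_w^v` and `ker(φ_ℓ|_w^v)` are all equal; in particular
`in_{w_ℓ}(I(X_w^v))` is the kernel of a monomial map, hence toric. -/
theorem statement_18 (K : Type*) [Field K] (n k ℓ : ℕ) (hk : 0 < k) (hkn : k < n)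
    (hℓn : ℓ ≤ n) (v w : PlVar n k) (hvw : TupLe v.val w.val)
    (hmf : MonomialFree (restrictIdeal (RingHom.ker (phiMF K n k ℓ)) (TWV v w)))
    (hquad : ∃ S : Set (MvPolynomial (TWV v w) K),
      (∀ g ∈ S, g.IsHomogeneous 2) ∧
      Ideal.span S =
        initialIdeal (fun x : TWV v w => wVec n ℓ (x : PlVar n k).val)
          (richIdeal K n k v w)) :
    initialIdeal (fun x : TWV v w => wVec n ℓ (x : PlVar n k).val) (richIdeal K n k v w) =
        restrictIdeal (RingHom.ker (phiMF K n k ℓ)) (TWV v w) ∧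
      restrictIdeal (RingHom.ker (phiMF K n k ℓ)) (TWV v w) =
        kerPhiRes K n k ℓ (TWV v w) := by
  have h := restrict_eq_kerPhi (TWV v w) ℓ hmf
  refine ⟨?_, h⟩
  rw [h]
  exact le_antisymm (init_le_ker ℓ hk hℓn v w hmf) (ker_le_init (TWV v w) ℓ hk hℓn hmf)
end

section
/- Let k < n be positive integers, K a field, and v ≤ w in I_{k,n}. For ℓ = 0 (the diagonal matching field), the three ideals G_{k,n,0}|_w^v = ker(φ_0)|_{T_w^v}, in_{w_0}(I(X_w^v)), and ker(φ_0|_w^v) of K[P_I : I ∈ T_w^v] are all equal; in particular, they are quadratically generated toric ideals (generated by binomials of degree two and equal to the kernel of a monomial map). -/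
open MvPolynomial

section Sub19


/-- exponent of the diagonal monomial -/
noncomputable def dl {k : ℕ} (J : Fin k → ℕ) : ℕ × ℕ →₀ ℕ :=
  ∑ i : Fin k, Finsupp.single ((i : ℕ) + 1, J i) 1

lemma mfRow_zero {n k : ℕ} (J : PlVar n k) (i : Fin k) : mfRow 0 J.val i = (i : ℕ) + 1 := by
  have : nSmall 0 J.val = 0 := by
    unfold nSmall
    rw [Finset.card_eq_zero, Finset.filter_eq_empty_iff]
    intro s _ h
    have := (J.2.2 s).1
    omega
  simp [mfRow, this]

lemma dl_apply {k : ℕ} (J : Fin k → ℕ) (i : Fin k) (j : ℕ) :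
    dl J ((i : ℕ) + 1, j) = if J i = j then 1 else 0 := by
  unfold dl
  rw [Finsupp.finsetSum_apply, Finset.sum_eq_single i]
  · simp [Finsupp.single_apply]
  · intro b _ hb
    rw [Finsupp.single_apply, if_neg]
    intro h
    simp only [Prod.mk.injEq] at h
    exact hb (Fin.ext (by omega))
  · simp

lemma phi_X {K : Type*} [Field K] {n k : ℕ} (J : PlVar n k) :
    phiMF K n k 0 (X J) = monomial (dl J.val) 1 := by
  unfold phiMF dl
  rw [aeval_X, monomial_sum_one]
  simp only [mfRow_zero]
  rfl

variable {K : Type*} [Field K] {n k : ℕ} {v w : PlVar n k}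

/-- the entries of an element of the interval -/
def ent (x : TWV v w) : Fin k → ℕ := x.val.val

lemma ent_inj {x y : TWV v w} (h : ent x = ent y) : x = y :=
  Subtype.ext (Subtype.ext h)

/-- restricted monomial map -/
noncomputable def phiT (K : Type*) [Field K] {n k : ℕ} (v w : PlVar n k) :
    MvPolynomial (TWV v w) K →ₐ[K] MvPolynomial (ℕ × ℕ) K :=
  (phiMF K n k 0).comp (rename fun x : TWV v w => (x : PlVar n k))

/-- exponents of the image of a monomial -/
noncomputable def Ph (m : TWV v w →₀ ℕ) : ℕ × ℕ →₀ ℕ := m.sum fun x e => e • dl (ent x)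

lemma Ph_add (a b : TWV v w →₀ ℕ) : Ph (a + b) = Ph a + Ph b := by
  classical
  unfold Ph
  rw [Finsupp.sum_add_index]
  · simp
  · intros; rw [add_smul]

lemma Ph_single (x : TWV v w) : Ph (Finsupp.single x 1) = dl (ent x) := by
  unfold Ph
  simp

lemma phiT_X (x : TWV v w) : phiT K v w (X x) = monomial (dl (ent x)) 1 := by
  unfold phiT
  rw [AlgHom.comp_apply, rename_X, phi_X]; rfl

lemma phiT_monomial (m : TWV v w →₀ ℕ) (c : K) :
    phiT K v w (monomial m c) = monomial (Ph m) c := by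
  have h : phiT K v w = aeval fun x => monomial (dl (ent x)) 1 := by
    ext x : 1
    rw [phiT_X, aeval_X]
  rw [h, aeval_monomial, Ph, Finsupp.sum, Finsupp.prod]
  simp only [monomial_pow, one_pow]
  rw [← monomial_sum_one, algebraMap_eq, C_mul_monomial, mul_one]

lemma Ph_pos {m : TWV v w →₀ ℕ} {i : Fin k} {j : ℕ} :
    Ph m ((i : ℕ) + 1, j) ≠ 0 ↔ ∃ x ∈ m.support, ent x i = j := by
  unfold Ph
  rw [Finsupp.sum, Finsupp.finsetSum_apply, ne_eq, Finset.sum_eq_zero_iff]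
  push Not
  apply exists_congr
  intro x
  apply and_congr_right
  intro hx
  rw [Finsupp.smul_apply, dl_apply]
  rw [Finsupp.mem_support_iff] at hx
  split_ifs with h <;> simp [h, hx]

/-- standard exponents: the support is a chain -/
def Stdm (m : TWV v w →₀ ℕ) : Prop :=
  ∀ x ∈ m.support, ∀ y ∈ m.support, ent x ≤ ent y ∨ ent y ≤ ent x

lemma Stdm_max {m : TWV v w →₀ ℕ} (h : Stdm m) (h0 : m ≠ 0) :
    ∃ x ∈ m.support, ∀ y ∈ m.support, ent y ≤ ent x := by
  obtain ⟨x, hx, hm⟩ := Finset.exists_max_image m.support (fun x => ∑ i, ent x i)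
    (Finsupp.support_nonempty_iff.2 h0)
  refine ⟨x, hx, fun y hy => ?_⟩
  rcases h y hy x hx with h1 | h1
  · exact h1
  · intro i
    by_contra hlt
    have := Finset.sum_lt_sum (s := Finset.univ) (f := ent x) (g := ent y)
      (fun i _ => h1 i) ⟨i, Finset.mem_univ _, not_le.1 hlt⟩
    have := hm y hy
    omega

lemma Ph_zero_iff (hk : 0 < k) {m : TWV v w →₀ ℕ} (h : Ph m = 0) : m = 0 := by
  by_contra h0
  obtain ⟨x, hx⟩ := Finsupp.support_nonempty_iff.2 h0
  have := (Ph_pos (m := m) (i := ⟨0, hk⟩) (j := ent x ⟨0, hk⟩)).2 ⟨x, hx, rfl⟩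
  rw [h] at this
  simp at this

lemma Stdm_inj (hk : 0 < k) : ∀ (N : ℕ) (m m' : TWV v w →₀ ℕ), m.degree = N → Stdm m → Stdm m' →
    Ph m = Ph m' → m = m' := by
  classical
  intro N
  induction N with
  | zero =>
    intro m m' hN _ _ hP
    have hm : m = 0 := (Finsupp.degree_eq_zero_iff m).1 hN
    subst hm
    symm
    apply Ph_zero_iff hk
    rw [← hP]; simp [Ph]
  | succ N ih =>
    intro m m' hN hs hs' hP
    have h0 : m ≠ 0 := by rintro rfl; simp at hN
    have h0' : m' ≠ 0 := by
      rintro rfl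
      apply h0
      apply Ph_zero_iff hk
      rw [hP]; simp [Ph]
    obtain ⟨x, hx, hxm⟩ := Stdm_max hs h0
    obtain ⟨y, hy, hym⟩ := Stdm_max hs' h0'
    have hxy : x = y := by
      apply ent_inj
      funext i
      apply le_antisymm
      · obtain ⟨z, hz, hzi⟩ := Ph_pos.1 (hP ▸ Ph_pos.2 ⟨x, hx, rfl⟩ : Ph m' ((i : ℕ) + 1, ent x i) ≠ 0)
        rw [← hzi]; exact hym z hz i
      · obtain ⟨z, hz, hzi⟩ := Ph_pos.1 (hP ▸ Ph_pos.2 ⟨y, hy, rfl⟩ : Ph m ((i : ℕ) + 1, ent y i) ≠ 0)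
        rw [← hzi]; exact hxm z hz i
    subst hxy
    have e : m = (m - Finsupp.single x 1) + Finsupp.single x 1 := by
      rw [tsub_add_cancel_of_le]
      rw [Finsupp.single_le_iff]
      rw [Finsupp.mem_support_iff] at hx; omega
    have e' : m' = (m' - Finsupp.single x 1) + Finsupp.single x 1 := by
      rw [tsub_add_cancel_of_le]
      rw [Finsupp.single_le_iff]
      rw [Finsupp.mem_support_iff] at hy; omega
    have sub : ∀ {a : TWV v w →₀ ℕ}, Stdm a → Stdm (a - Finsupp.single x 1) := by
      intro a ha p hp q hq
      exact ha p (Finsupp.support_mono tsub_le_self hp) q (Finsupp.support_mono tsub_le_self hq)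
    rw [e, e']
    congr 1
    apply ih _ _ _ (sub hs) (sub hs')
    · rw [e, e', Ph_add, Ph_add] at hP
      exact add_right_cancel hP
    · rw [e, map_add, Finsupp.degree_single] at hN
      omega

/-- polynomials supported on standard exponents -/
noncomputable def StdPoly (K : Type*) [Field K] {n k : ℕ} (v w : PlVar n k) :
    Submodule K (MvPolynomial (TWV v w) K) where
  carrier := {p | ∀ m ∈ p.support, Stdm m}
  add_mem' := by
    classical
    intro a b ha hb m hm
    rcases Finset.mem_union.1 (support_add hm) with h | h
    · exact ha m h
    · exact hb m h
  zero_mem' := by simp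
  smul_mem' := by
    intro c p hp m hm
    exact hp m (support_smul hm)

lemma mem_StdPoly {p : MvPolynomial (TWV v w) K} :
    p ∈ StdPoly K v w ↔ ∀ m ∈ p.support, Stdm m := Iff.rfl

lemma monomial_mem_StdPoly {m : TWV v w →₀ ℕ} (h : Stdm m) (c : K) :
    monomial m c ∈ StdPoly K v w := by
  intro m' hm'
  rw [Finset.mem_singleton.1 (support_monomial_subset hm')]; exact h

lemma StdPoly_ker (hk : 0 < k) {p : MvPolynomial (TWV v w) K} (hp : p ∈ StdPoly K v w)
    (h : phiT K v w p = 0) : p = 0 := by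
  classical
  ext m
  rw [coeff_zero]
  by_contra hm
  have hm' := mem_support_iff.2 hm
  have h2 := congrArg (coeff (Ph m)) h
  rw [p.as_sum, map_sum, coeff_sum, coeff_zero, Finset.sum_eq_single m] at h2
  · rw [phiT_monomial, coeff_monomial, if_pos rfl] at h2
    exact hm h2
  · intro b hb hbm
    rw [phiT_monomial, coeff_monomial, if_neg]
    intro hP
    exact hbm (Stdm_inj hk _ b m rfl (hp b hb) (hp m hm') hP)
  · intro h; exact absurd hm' h

/-- meet -/
def infT (x y : TWV v w) : TWV v w :=
  ⟨⟨fun s => min (ent x s) (ent y s), by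
    refine ⟨fun a b hab => ?_, fun s => ?_⟩
    · have h1 : ent x a < ent x b := x.1.2.1 hab
      have h2 : ent y a < ent y b := y.1.2.1 hab
      simp only; omega
    · have h1 : 1 ≤ ent x s ∧ ent x s ≤ n := x.1.2.2 s
      have h2 : 1 ≤ ent y s ∧ ent y s ≤ n := y.1.2.2 s
      simp only; omega⟩, by
    refine ⟨fun s => ?_, fun s => ?_⟩
    · have h1 : v.1 s ≤ ent x s := x.2.1 s
      have h2 : v.1 s ≤ ent y s := y.2.1 s
      simp only; omega
    · have h1 : ent x s ≤ w.1 s := x.2.2 s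
      have h2 : ent y s ≤ w.1 s := y.2.2 s
      simp only; omega⟩

/-- join -/
def supT (x y : TWV v w) : TWV v w :=
  ⟨⟨fun s => max (ent x s) (ent y s), by
    refine ⟨fun a b hab => ?_, fun s => ?_⟩
    · have h1 : ent x a < ent x b := x.1.2.1 hab
      have h2 : ent y a < ent y b := y.1.2.1 hab
      simp only; omega
    · have h1 : 1 ≤ ent x s ∧ ent x s ≤ n := x.1.2.2 s
      have h2 : 1 ≤ ent y s ∧ ent y s ≤ n := y.1.2.2 s
      simp only; omega⟩, by
    refine ⟨fun s => ?_, fun s => ?_⟩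
    · have h1 : v.1 s ≤ ent x s := x.2.1 s
      have h2 : v.1 s ≤ ent y s := y.2.1 s
      simp only; omega
    · have h1 : ent x s ≤ w.1 s := x.2.2 s
      have h2 : ent y s ≤ w.1 s := y.2.2 s
      simp only; omega⟩

lemma ent_infT (x y : TWV v w) (s : Fin k) : ent (infT x y) s = min (ent x s) (ent y s) := rfl
lemma ent_supT (x y : TWV v w) (s : Fin k) : ent (supT x y) s = max (ent x s) (ent y s) := rfl

/-- pair exponent -/
noncomputable def pr {σ : Type*} (x y : σ) : σ →₀ ℕ := Finsupp.single x 1 + Finsupp.single y 1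

lemma Ph_pr (x y : TWV v w) : Ph (pr x y) = Ph (pr (infT x y) (supT x y)) := by
  unfold pr
  simp only [Ph_add, Ph_single]
  unfold dl
  rw [← Finset.sum_add_distrib, ← Finset.sum_add_distrib]
  apply Finset.sum_congr rfl
  intro i _
  rw [ent_infT, ent_supT]
  rcases le_total (ent x i) (ent y i) with h | h
  · rw [min_eq_left h, max_eq_right h]
  · rw [min_eq_right h, max_eq_left h, add_comm]

lemma Stdm_pr {x y : TWV v w} (h : ent x ≤ ent y) : Stdm (pr x y) := by
  classical
  intro a ha b hb
  have : ∀ c ∈ (pr x y).support, c = x ∨ c = y := by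
    intro c hc
    unfold pr at hc
    rcases Finset.mem_union.1 (Finsupp.support_add hc) with h | h
    · left; exact Finset.mem_singleton.1 (Finsupp.support_single_subset h)
    · right; exact Finset.mem_singleton.1 (Finsupp.support_single_subset h)
  rcases this a ha with rfl | rfl <;> rcases this b hb with rfl | rfl
  · left; exact le_rfl
  · left; exact h
  · right; exact h
  · left; exact le_rfl

/-- Hibi binomial -/
noncomputable def hibi (K : Type*) [Field K] {n k : ℕ} {v w : PlVar n k} (x y : TWV v w) :
    MvPolynomial (TWV v w) K :=
  monomial (pr x y) 1 - monomial (pr (infT x y) (supT x y)) 1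

lemma phiT_hibi (x y : TWV v w) : phiT K v w (hibi K x y) = 0 := by
  unfold hibi
  rw [map_sub, phiT_monomial, phiT_monomial, Ph_pr, sub_self]

lemma hibi_homog (x y : TWV v w) : (hibi K x y).IsHomogeneous 2 := by
  unfold hibi
  apply IsHomogeneous.sub <;> apply isHomogeneous_monomial <;>
    simp [pr, Finsupp.degree_single]

/-- the set of Hibi binomials -/
def hibiSet (K : Type*) [Field K] {n k : ℕ} (v w : PlVar n k) :
    Set (MvPolynomial (TWV v w) K) := {g | ∃ x y : TWV v w, g = hibi K x y}

/-- termination measure -/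
noncomputable def mu (m : TWV v w →₀ ℕ) : ℕ :=
  m.sum fun x e => e * ((k * n) ^ 2 - (∑ i, ent x i) ^ 2)

lemma mu_add (a b : TWV v w →₀ ℕ) : mu (a + b) = mu a + mu b := by
  classical
  unfold mu
  rw [Finsupp.sum_add_index]
  · simp
  · intros; rw [add_mul]

lemma mu_single (x : TWV v w) :
    mu (Finsupp.single x 1) = ((k * n) ^ 2 - (∑ i, ent x i) ^ 2) := by
  unfold mu
  simp

lemma ent_sum_le (x : TWV v w) : ∑ i, ent x i ≤ k * n := by
  calc ∑ i, ent x i ≤ ∑ i : Fin k, n := Finset.sum_le_sum fun i _ => (x.1.2.2 i).2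
    _ = k * n := by simp

lemma mu_lt {x y : TWV v w} (h1 : ¬ ent x ≤ ent y) (h2 : ¬ ent y ≤ ent x) :
    mu (pr (infT x y) (supT x y)) < mu (pr x y) := by
  unfold pr
  simp only [mu_add, mu_single]
  have a1 : ∑ i, ent (infT x y) i < ∑ i, ent x i := by
    simp only [Pi.le_def, not_forall, not_le] at h1
    obtain ⟨i, hi⟩ := h1
    apply Finset.sum_lt_sum
    · intro i _; rw [ent_infT]; omega
    · exact ⟨i, Finset.mem_univ _, by rw [ent_infT]; omega⟩
  have a2 : ∑ i, ent (infT x y) i < ∑ i, ent y i := by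
    simp only [Pi.le_def, not_forall, not_le] at h2
    obtain ⟨i, hi⟩ := h2
    apply Finset.sum_lt_sum
    · intro i _; rw [ent_infT]; omega
    · exact ⟨i, Finset.mem_univ _, by rw [ent_infT]; omega⟩
  have a3 : ∑ i, ent (infT x y) i + ∑ i, ent (supT x y) i = ∑ i, ent x i + ∑ i, ent y i := by
    rw [← Finset.sum_add_distrib, ← Finset.sum_add_distrib]
    apply Finset.sum_congr rfl
    intro i _; rw [ent_infT, ent_supT]; omega
  have b1 := ent_sum_le (infT x y)
  have b2 := ent_sum_le (supT x y)
  have b3 := ent_sum_le x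
  have b4 := ent_sum_le y
  have c1 := Nat.pow_le_pow_left b1 2
  have c2 := Nat.pow_le_pow_left b2 2
  have c3 := Nat.pow_le_pow_left b3 2
  have c4 := Nat.pow_le_pow_left b4 2
  generalize ∑ i, ent (infT x y) i = a at *
  generalize ∑ i, ent (supT x y) i = b at *
  generalize ∑ i, ent x i = c at *
  generalize ∑ i, ent y i = d at *
  have : c ^ 2 + d ^ 2 < a ^ 2 + b ^ 2 := by
    obtain ⟨p, rfl⟩ := Nat.exists_eq_add_of_lt a1
    obtain ⟨q, rfl⟩ := Nat.exists_eq_add_of_lt a2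
    have : b = a + p + 1 + q + 1 := by omega
    subst this
    nlinarith
  omega

lemma exists_std (N : ℕ) : ∀ m : TWV v w →₀ ℕ, mu m = N → ∃ m', Stdm m' ∧
    (monomial m (1 : K) - monomial m' 1) ∈ Ideal.span (hibiSet K v w) := by
  classical
  induction N using Nat.strong_induction_on with
  | _ N ih =>
    intro m hm
    by_cases hs : Stdm m
    · exact ⟨m, hs, by simp⟩
    · unfold Stdm at hs
      push Not at hs
      obtain ⟨x, hx, y, hy, h1, h2⟩ := hs
      have hxy : x ≠ y := by rintro rfl; exact h1 le_rfl
      have hle : pr x y ≤ m := by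
        intro z
        rw [Finsupp.mem_support_iff] at hx hy
        unfold pr
        rw [Finsupp.add_apply, Finsupp.single_apply, Finsupp.single_apply]
        split_ifs with e1 e2 e2
        · exact absurd (e1.trans e2.symm) hxy
        · subst e1; omega
        · subst e2; omega
        · omega
      obtain ⟨r, rfl⟩ := exists_add_of_le hle
      have hlt := mu_lt h1 h2
      rw [mu_add] at hm
      obtain ⟨m', hm', hmem⟩ := ih (mu (pr (infT x y) (supT x y) + r))
        (by rw [mu_add]; omega) _ rfl
      refine ⟨m', hm', ?_⟩
      have : (monomial (pr x y + r) (1 : K) - monomial m' 1) =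
          monomial r 1 * hibi K x y + (monomial (pr (infT x y) (supT x y) + r) (1 : K) - monomial m' 1) := by
        unfold hibi
        rw [mul_sub, monomial_mul, monomial_mul, add_comm r, add_comm r]
        simp
      rw [this]
      exact Ideal.add_mem _ (Ideal.mul_mem_left _ _ (Ideal.subset_span ⟨x, y, rfl⟩)) hmem

lemma exists_stdPoly (p : MvPolynomial (TWV v w) K) : ∃ q ∈ StdPoly K v w,
    p - q ∈ Ideal.span (hibiSet K v w) := by
  induction p using MvPolynomial.induction_on' with
  | monomial m c =>
    obtain ⟨m', h1, h2⟩ := exists_std (K := K) _ m rfl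
    refine ⟨monomial m' c, monomial_mem_StdPoly h1 c, ?_⟩
    have : monomial m c - monomial m' c = C c * (monomial m (1 : K) - monomial m' 1) := by
      rw [mul_sub, C_mul_monomial, C_mul_monomial, mul_one]
    rw [this]
    exact Ideal.mul_mem_left _ _ h2
  | add p q hp hq =>
    obtain ⟨a, ha, ha'⟩ := hp
    obtain ⟨b, hb, hb'⟩ := hq
    refine ⟨a + b, Submodule.add_mem _ ha hb, ?_⟩
    have : p + q - (a + b) = (p - a) + (q - b) := by ring
    rw [this]
    exact Ideal.add_mem _ ha' hb'

lemma ker_phiT (hk : 0 < k) :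
    RingHom.ker (phiT K v w) = Ideal.span (hibiSet K v w) := by
  have hle : Ideal.span (hibiSet K v w) ≤ RingHom.ker (phiT K v w) := by
    rw [Ideal.span_le]
    rintro _ ⟨x, y, rfl⟩
    exact phiT_hibi x y
  apply le_antisymm _ hle
  intro p hp
  obtain ⟨q, hq, h⟩ := exists_stdPoly p
  have h2 := hle h
  rw [RingHom.mem_ker] at hp h2
  rw [map_sub, hp, zero_sub, neg_eq_zero] at h2
  have := StdPoly_ker hk hq h2
  rw [this, sub_zero] at h
  exact h


/-- kill the matrix entries outside the band -/
noncomputable def rho (K : Type*) [Field K] {n k : ℕ} (v w : PlVar n k) :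
    MvPolynomial (ℕ × ℕ) K →ₐ[K] MvPolynomial (ℕ × ℕ) K :=
  letI := Classical.propDecidable
  aeval fun p => if ∀ s : Fin k, (s : ℕ) + 1 = p.1 → v.val s ≤ p.2 ∧ p.2 ≤ w.val s
    then X p else 0

lemma rho_X_mem {s : Fin k} {j : ℕ} (h : v.val s ≤ j ∧ j ≤ w.val s) :
    rho K v w (X ((s : ℕ) + 1, j)) = X ((s : ℕ) + 1, j) := by
  unfold rho
  rw [aeval_X, if_pos]
  intro t ht
  have : t = s := Fin.ext (by simpa using ht)
  subst this; exact h

lemma rho_X_not {s : Fin k} {j : ℕ} (h : ¬ (v.val s ≤ j ∧ j ≤ w.val s)) :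
    rho K v w (X ((s : ℕ) + 1, j)) = 0 := by
  unfold rho
  rw [aeval_X, if_neg]
  intro h2
  exact h (h2 s rfl)

lemma rho_X_or (p : ℕ × ℕ) : rho K v w (X p) = X p ∨ rho K v w (X p) = 0 := by
  unfold rho
  rw [aeval_X]
  split_ifs <;> simp

lemma dl_monomial (J : Fin k → ℕ) :
    (monomial (dl J) 1 : MvPolynomial (ℕ × ℕ) K) = ∏ i : Fin k, X ((i : ℕ) + 1, J i) := by
  unfold dl
  rw [monomial_sum_one]
  rfl

lemma rho_phi_not {J : PlVar n k} (h : J ∉ TWV v w) :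
    rho K v w (phiMF K n k 0 (X J)) = 0 := by
  rw [phi_X, dl_monomial, map_prod]
  by_contra hne
  rw [Finset.prod_eq_zero_iff] at hne
  apply h
  push Not at hne
  have : ∀ s, v.val s ≤ J.val s ∧ J.val s ≤ w.val s := by
    intro s
    by_contra hs
    exact hne s (Finset.mem_univ _) (rho_X_not hs)
  exact ⟨fun s => (this s).1, fun s => (this s).2⟩

lemma rho_phiT (p : MvPolynomial (TWV v w) K) : rho K v w (phiT K v w p) = phiT K v w p := by
  have : (rho K v w).comp (phiT K v w) = phiT K v w := by
    ext x : 1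
    rw [AlgHom.comp_apply, phiT_X, dl_monomial, map_prod]
    apply Finset.prod_congr rfl
    intro s _
    exact rho_X_mem ⟨x.2.1 s, x.2.2 s⟩
  exact DFunLike.congr_fun this p

lemma restrict_phi :
    restrictIdeal (RingHom.ker (phiMF K n k 0)) (TWV v w) = RingHom.ker (phiT K v w) := by
  apply le_antisymm
  · intro f hf
    unfold restrictIdeal at hf
    rw [Ideal.mem_comap] at hf
    have hle : RingHom.ker (phiMF K n k 0) ⊔ Ideal.span (X '' {J | J ∉ TWV v w}) ≤
        RingHom.ker ((rho K v w).comp (phiMF K n k 0)) := by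
      apply sup_le
      · intro g hg
        rw [RingHom.mem_ker] at hg ⊢
        rw [AlgHom.comp_apply, hg, map_zero]
      · rw [Ideal.span_le]
        rintro _ ⟨J, hJ, rfl⟩
        exact rho_phi_not hJ
    have h := hle hf
    rw [RingHom.mem_ker] at h ⊢
    rw [← rho_phiT]
    exact h
  · intro f hf
    unfold restrictIdeal
    rw [Ideal.mem_comap]
    apply Ideal.mem_sup_left
    exact hf

lemma perm_le (σ : Equiv.Perm (Fin k)) (s : Fin k) : ∃ c ≤ s, s ≤ σ c := by
  by_contra h
  push Not at h
  have := Finset.card_le_card_of_injOn (s := Finset.Iic s) (t := Finset.Iio s) σ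
    (fun c hc => by
      simp only [Finset.coe_Iio, Set.mem_Iio]
      exact h c (by simpa using hc)) σ.injective.injOn
  simp at this

lemma perm_ge (σ : Equiv.Perm (Fin k)) (s : Fin k) : ∃ c, s ≤ c ∧ σ c ≤ s := by
  obtain ⟨c, h1, h2⟩ := perm_le σ⁻¹ s
  exact ⟨σ⁻¹ c, h2, by simpa using h1⟩

lemma plu_X (J : PlVar n k) : pluMap K n k (X J) =
    ∑ σ : Equiv.Perm (Fin k), Equiv.Perm.sign σ • ∏ c : Fin k, X ((σ c : ℕ) + 1, J.val c) := by
  unfold pluMap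
  rw [aeval_X, Matrix.det_apply]
  rfl

lemma rho_plu_not {J : PlVar n k} (h : J ∉ TWV v w) :
    rho K v w (pluMap K n k (X J)) = 0 := by
  rw [plu_X, map_sum]
  apply Finset.sum_eq_zero
  intro σ _
  rw [Units.smul_def, map_zsmul, map_prod]
  by_contra hne
  have hne2 : ∏ c : Fin k, rho K v w (X ((σ c : ℕ) + 1, J.val c)) ≠ 0 := by
    intro h0; apply hne; rw [h0, smul_zero]
  rw [Finset.prod_ne_zero_iff] at hne2
  have hb : ∀ c, v.val (σ c) ≤ J.val c ∧ J.val c ≤ w.val (σ c) := by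
    intro s
    by_contra hs
    exact hne2 s (Finset.mem_univ _) (rho_X_not hs)
  apply h
  constructor
  · intro s
    obtain ⟨c, h1, h2⟩ := perm_le σ s
    exact (v.2.1.monotone h2).trans ((hb c).1.trans (J.2.1.monotone h1))
  · intro s
    obtain ⟨c, h1, h2⟩ := perm_ge σ s
    exact (J.2.1.monotone h1).trans ((hb c).2.trans (w.2.1.monotone h2))

lemma rich_ker {g : MvPolynomial (TWV v w) K} (hg : g ∈ richIdeal K n k v w) :
    rho K v w (pluMap K n k (rename (fun x : TWV v w => (x : PlVar n k)) g)) = 0 := by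
  unfold richIdeal restrictIdeal at hg
  rw [Ideal.mem_comap] at hg
  have hle : RingHom.ker (pluMap K n k) ⊔ Ideal.span (X '' {J | J ∉ TWV v w}) ≤
      RingHom.ker ((rho K v w).comp (pluMap K n k)) := by
    apply sup_le
    · intro g hg
      rw [RingHom.mem_ker] at hg ⊢
      rw [AlgHom.comp_apply, hg, map_zero]
    · rw [Ideal.span_le]
      rintro _ ⟨J, hJ, rfl⟩
      exact rho_plu_not hJ
  exact hle hg

/-- the weight grading, as a one-parameter deformation -/
noncomputable def theta (K : Type*) [Field K] (n : ℕ) :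
    MvPolynomial (ℕ × ℕ) K →ₐ[K] Polynomial (MvPolynomial (ℕ × ℕ) K) :=
  aeval fun p => Polynomial.X ^ ((p.1 - 1) * (n + 1 - p.2)) * Polynomial.C (X p)

lemma theta_rho (p : ℕ × ℕ) : theta K n (rho K v w (X p)) =
    Polynomial.X ^ ((p.1 - 1) * (n + 1 - p.2)) * Polynomial.C (rho K v w (X p)) := by
  rcases rho_X_or (K := K) (v := v) (w := w) p with h | h
  · rw [h]; unfold theta; rw [aeval_X]
  · rw [h, map_zero, map_zero, mul_zero]

/-- natural number weight -/
def uN (n : ℕ) {k : ℕ} (J : Fin k → ℕ) : ℕ := ∑ c : Fin k, (c : ℕ) * (n + 1 - J c)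

lemma wVec_eq (J : PlVar n k) : wVec n 0 J.val = (uN n J.val : ℤ) := by
  unfold wVec uN
  push_cast
  apply Finset.sum_congr rfl
  intro c _
  rw [mfRow_zero]
  have h1 := (J.2.2 c).1
  have h2 := (J.2.2 c).2
  have h3 : ((n + 1 - J.val c : ℕ) : ℤ) = (n : ℤ) - J.val c + 1 := by omega
  rw [h3]
  unfold Mmat
  rw [if_neg (by omega : ¬ J.val c ≤ 0)]
  split_ifs with h
  · have : (c : ℕ) = 1 := by omega
    rw [this]; push_cast; ring
  · push_cast; ring

lemma weight_lt (J : PlVar n k) {σ : Equiv.Perm (Fin k)} (hσ : σ ≠ 1) :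
    uN n J.val < ∑ c : Fin k, (σ c : ℕ) * (n + 1 - J.val c) := by
  unfold uN
  have hs : StrictAnti fun c : Fin k => n + 1 - J.val c := by
    intro a b hab
    have := J.2.1 hab
    have := (J.2.2 b).2
    simp only; omega
  have hav : Antivary (fun c : Fin k => (c : ℕ)) (fun c : Fin k => n + 1 - J.val c) := by
    intro a b hab
    exact (hs.lt_iff_gt.1 hab).le
  refine (hav.sum_mul_lt_sum_comp_perm_mul_iff (σ := σ)).2 ?_
  intro h
  apply hσ
  have hmono : Monotone σ := by
    intro a b hab
    rcases hab.eq_or_lt with rfl | hlt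
    · exact le_rfl
    · exact h (hs hlt)
  have hsm : StrictMono σ := hmono.strictMono_of_injective σ.injective
  ext c
  have : σ = (1 : Equiv.Perm (Fin k)) := by
    have := Subsingleton.elim (hsm.orderIsoOfSurjective _ σ.surjective) (OrderIso.refl _)
    ext c
    have := congrArg (fun f => (f c : ℕ)) (congrArg DFunLike.coe this)
    simpa using this
  rw [this]

lemma exists_D (x : TWV v w) : ∃ D : Polynomial (MvPolynomial (ℕ × ℕ) K),
    theta K n (rho K v w (pluMap K n k (X x.val))) = Polynomial.X ^ (uN n (ent x)) * D ∧
    D.eval 0 = monomial (dl (ent x)) 1 := by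
  classical
  refine ⟨∑ σ : Equiv.Perm (Fin k), Equiv.Perm.sign σ •
    (Polynomial.X ^ ((∑ c : Fin k, (σ c : ℕ) * (n + 1 - ent x c)) - uN n (ent x)) *
      Polynomial.C (∏ c : Fin k, rho K v w (X ((σ c : ℕ) + 1, ent x c)))), ?_, ?_⟩
  · rw [plu_X, map_sum, map_sum, Finset.mul_sum]
    apply Finset.sum_congr rfl
    intro σ _
    rw [Units.smul_def, Units.smul_def, map_zsmul, map_zsmul, map_prod, map_prod, mul_smul_comm]
    congr 1
    rw [← mul_assoc, ← pow_add, Nat.add_sub_cancel', map_prod, ← Finset.prod_pow_eq_pow_sum,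
      ← Finset.prod_mul_distrib]
    · apply Finset.prod_congr rfl
      intro c _
      rw [theta_rho]; rfl
    · by_cases hσ : σ = 1
      · subst hσ; exact le_rfl
      · exact (weight_lt x.val hσ).le
  · rw [Polynomial.eval_finsetSum, Finset.sum_eq_single 1]
    · have : (∑ c : Fin k, (((1 : Equiv.Perm (Fin k)) c : Fin k) : ℕ) * (n + 1 - ent x c)) - uN n (ent x) = 0 := by
        simp [uN]
      rw [this, dl_monomial]
      simp only [Equiv.Perm.sign_one, one_smul, pow_zero, one_mul, Polynomial.eval_C]
      apply Finset.prod_congr rfl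
      intro c _
      exact rho_X_mem ⟨x.2.1 c, x.2.2 c⟩
    · intro σ _ hσ
      have h : uN n (ent x) < _ := weight_lt x.val hσ
      have h2 : (∑ c : Fin k, (σ c : ℕ) * (n + 1 - ent x c)) - uN n (ent x) ≠ 0 := by
        unfold ent at *; omega
      rw [Units.smul_def, Polynomial.eval_smul, Polynomial.eval_mul, Polynomial.eval_pow,
        Polynomial.eval_X, zero_pow h2, zero_mul, smul_zero]
    · simp

/-- natural weight of an exponent -/
noncomputable def wtN (m : TWV v w →₀ ℕ) : ℕ := m.sum fun x e => uN n (ent x) * e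

lemma expWt_eq (m : TWV v w →₀ ℕ) :
    expWt (fun x : TWV v w => wVec n 0 (x : PlVar n k).val) m = (wtN m : ℤ) := by
  unfold expWt wtN Finsupp.sum
  push_cast
  apply Finset.sum_congr rfl
  intro x _
  rw [wVec_eq]; rfl

lemma initial_mem {g : MvPolynomial (TWV v w) K} (hg : g ∈ richIdeal K n k v w) :
    phiT K v w (initialForm (fun x : TWV v w => wVec n 0 (x : PlVar n k).val) g) = 0 := by
  classical
  by_cases h0 : g = 0
  · subst h0; simp [initialForm]
  obtain ⟨m0, hm0, hmin⟩ := Finset.exists_min_image g.support wtN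
    (MvPolynomial.support_nonempty.2 h0)
  choose D hD1 hD2 using exists_D (K := K) (v := v) (w := w)
  have hmono : ∀ m c, theta K n (rho K v w (pluMap K n k
      (rename (fun x : TWV v w => (x : PlVar n k)) (monomial m c)))) =
      Polynomial.X ^ (wtN m) * aeval D (monomial m c) := by
    intro m c
    have : (((theta K n).comp (rho K v w)).comp (pluMap K n k)).comp
        (rename fun x : TWV v w => (x : PlVar n k)) =
        aeval fun x => Polynomial.X ^ (uN n (ent x)) * D x := by
      ext x : 1
      rw [aeval_X, ← hD1]
      simp [AlgHom.comp_apply]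
    have h2 := DFunLike.congr_fun this (monomial m c)
    simp only [AlgHom.comp_apply] at h2
    rw [h2, aeval_monomial, aeval_monomial, Finsupp.prod, Finsupp.prod, wtN, Finsupp.sum]
    simp only [mul_pow, Finset.prod_mul_distrib, ← pow_mul, Finset.prod_pow_eq_pow_sum]
    ring
  have hz := rich_ker hg
  have hz2 := congrArg (theta K n) hz
  rw [map_zero, g.as_sum] at hz2
  simp only [map_sum, hmono] at hz2
  have hfac : ∑ m ∈ g.support, Polynomial.X ^ (wtN m) * aeval D (monomial m (coeff m g)) =
      Polynomial.X ^ (wtN m0) * ∑ m ∈ g.support, Polynomial.X ^ (wtN m - wtN m0) *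
        aeval D (monomial m (coeff m g)) := by
    rw [Finset.mul_sum]
    apply Finset.sum_congr rfl
    intro m hm
    rw [← mul_assoc, ← pow_add, Nat.add_sub_cancel' (hmin m hm)]
  rw [hfac] at hz2
  have hz3 := (mul_eq_zero.1 hz2).resolve_left (pow_ne_zero _ Polynomial.X_ne_zero)
  have hz4 := congrArg (Polynomial.eval 0) hz3
  rw [Polynomial.eval_finsetSum, Polynomial.eval_zero] at hz4
  have hev : ∀ m c, Polynomial.eval 0 (aeval D (monomial m c)) = phiT K v w (monomial m c) := by
    intro m c
    have : ((Polynomial.aeval (R := MvPolynomial (ℕ × ℕ) K) (0 : MvPolynomial (ℕ × ℕ) K)).restrictScalars K).comp (aeval D)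
        = phiT K v w := by
      ext x : 1
      rw [AlgHom.comp_apply, aeval_X, phiT_X, ← hD2]
      simp [Polynomial.aeval_def, Polynomial.eval₂_eq_eval_map]
    rw [← this]
    simp
  unfold initialForm
  rw [map_sum, ← hz4, Finset.sum_filter]
  apply Finset.sum_congr rfl
  intro m hm
  rw [Polynomial.eval_mul, hev]
  simp only [expWt_eq, Nat.cast_le]
  split_ifs with h
  · rw [Nat.sub_eq_zero_of_le (h m0 hm0)]
    simp
  · have : wtN m - wtN m0 ≠ 0 := by
      intro h2
      apply h
      intro m' hm'
      have := hmin m' hm'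
      omega
    rw [Polynomial.eval_pow, Polynomial.eval_X, zero_pow this, zero_mul]


section Garnir

variable {R : Type*} [CommRing R]

/-- determinant with some rows fixed -/
noncomputable def altHalf (P : Fin k → Prop) [DecidablePred P] (z : Fin k → Fin k → R) :
    (Fin k → R) [⋀^{t : Fin k // P t}]→ₗ[R] R :=
  { (Matrix.detRowAlternating (R := R) (n := Fin k)).toMultilinearMap.domDomRestrict P
      (fun t => z t.1) with
    map_eq_zero_of_eq' := by
      intro x i j hij hne
      refine AlternatingMap.map_eq_zero_of_eq (Matrix.detRowAlternating (R := R) (n := Fin k)) _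
        (i := i.1) (j := j.1) ?_ (fun h => hne (Subtype.ext h))
      simp only [dif_pos i.2, dif_pos j.2]
      exact hij }

lemma altHalf_apply (P : Fin k → Prop) [DecidablePred P] (z : Fin k → Fin k → R)
    (x : {t : Fin k // P t} → Fin k → R) :
    altHalf P z x = Matrix.det (Matrix.of fun t => if h : P t then x ⟨t, h⟩ else z t) := rfl

/-- bracket -/
noncomputable def br (vec : ℕ → Fin k → R) (c : Fin k → ℕ) : R :=
  Matrix.det (Matrix.of fun t => vec (c t))

lemma sum_swap_lt {α β : Type*} [Fintype α] [Fintype β] (σ : Equiv.Perm (α ⊕ β))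
    (E : α ⊕ β → ℕ) (q : ℕ) (h1 : ∀ a, q < E (Sum.inl a)) (h2 : ∀ b, E (Sum.inr b) ≤ q)
    (a0 : α) (b0 : β) (hσ : σ (Sum.inl a0) = Sum.inr b0) :
    ∑ a, E (σ (Sum.inl a)) < ∑ a, E (Sum.inl a) := by
  classical
  set L : Finset (α ⊕ β) := Finset.univ.map Function.Embedding.inl with hL
  set S : Finset (α ⊕ β) := L.map σ.toEmbedding with hS
  have e1 : ∑ a, E (σ (Sum.inl a)) = ∑ x ∈ S, E x := by simp [hS, hL]
  have e2 : ∑ a, E (Sum.inl a) = ∑ x ∈ L, E x := by simp [hL]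
  have hcard : (S \ L).card = (L \ S).card := by
    rw [Finset.card_sdiff_comm]
    simp [hS]
  have hne : 0 < (S \ L).card := by
    rw [Finset.card_pos]
    refine ⟨Sum.inr b0, ?_⟩
    rw [Finset.mem_sdiff]
    constructor
    · rw [← hσ]; simp [hS, hL]
    · simp [hL]
  have b1 : ∑ x ∈ S \ L, E x ≤ (S \ L).card * q := by
    rw [← smul_eq_mul]
    apply Finset.sum_le_card_nsmul
    intro x hx
    rcases x with a | b
    · simp [hL] at hx
    · exact h2 b
  have b2 : (L \ S).card * (q + 1) ≤ ∑ x ∈ L \ S, E x := by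
    rw [← smul_eq_mul]
    apply Finset.card_nsmul_le_sum
    intro x hx
    rcases x with a | b
    · exact h1 a
    · simp [hL] at hx
  have s1 := Finset.sum_inter_add_sum_sdiff S L E
  have s2 := Finset.sum_inter_add_sum_sdiff L S E
  rw [Finset.inter_comm] at s2
  rw [← hcard, mul_add] at b2
  rw [e1, e2]
  omega

lemma garnir [IsDomain R] (vec : ℕ → Fin k → R) (c d : Fin k → ℕ) (hc : StrictMono c)
    (hd : StrictMono d) (s : Fin k) (hs : d s < c s) (Q : ℕ → Prop) (hQc : ∀ t, Q (c t))
    (hQd : ∀ t, Q (d t)) :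
    br vec c * br vec d ∈ AddSubgroup.closure {p | ∃ c' d' : Fin k → ℕ,
      (∀ t, Q (c' t)) ∧ (∀ t, Q (d' t)) ∧ ∑ t, c' t < ∑ t, c t ∧
      p = br vec c' * br vec d'} := by
  classical
  set H := AddSubgroup.closure {p | ∃ c' d' : Fin k → ℕ,
      (∀ t, Q (c' t)) ∧ (∀ t, Q (d' t)) ∧ ∑ t, c' t < ∑ t, c t ∧
      p = br vec c' * br vec d'} with hH
  let a := altHalf (fun t : Fin k => s ≤ t) (fun t => vec (c t))
  let b := altHalf (fun t : Fin k => t ≤ s) (fun t => vec (d t))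
  let E : {t : Fin k // s ≤ t} ⊕ {t : Fin k // t ≤ s} → ℕ := Sum.elim (fun t => c t) (fun t => d t)
  let Φ := (LinearMap.mul' R R).compAlternatingMap (a.domCoprod b)
  have hE : ∀ x, Q (E x) := by
    rintro (x | x)
    · exact hQc _
    · exact hQd _
  have hz : Φ (fun x => vec (E x)) = 0 := by
    apply AlternatingMap.map_linearDependent
    intro hli
    have := hli.fintype_card_le_finrank
    rw [Fintype.card_sum, Fintype.card_subtype, Fintype.card_subtype] at this
    simp only [Module.finrank_fintype_fun_eq_card, Fintype.card_fin] at this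
    have e1 : (Finset.univ.filter fun t : Fin k => s ≤ t) = Finset.Ici s := by ext; simp
    have e2 : (Finset.univ.filter fun t : Fin k => t ≤ s) = Finset.Iic s := by ext; simp
    rw [e1, e2, Fin.card_Ici, Fin.card_Iic] at this
    have := s.2
    omega
  have hterm : ∀ σ : Equiv.Perm ({t : Fin k // s ≤ t} ⊕ {t : Fin k // t ≤ s}),
      LinearMap.mul' R R (AlternatingMap.domCoprod.summand a b (Quotient.mk'' σ)
        (fun x => vec (E x))) = Equiv.Perm.sign σ •
        (br vec (fun t => if h : s ≤ t then E (σ (Sum.inl ⟨t, h⟩)) else c t) *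
        br vec (fun t => if h : t ≤ s then E (σ (Sum.inr ⟨t, h⟩)) else d t)) := by
    intro σ
    rw [AlternatingMap.domCoprod.summand_mk'']
    rw [Units.smul_def, Units.smul_def, _root_.smul_apply, map_zsmul]
    congr 1
    rw [MultilinearMap.domDomCongr_apply, MultilinearMap.domCoprod_apply, LinearMap.mul'_apply]
    simp only [AlternatingMap.coe_multilinearMap]
    congr 1
    · unfold a br
      rw [altHalf_apply]
      congr 2
      funext t
      dsimp only
      split_ifs <;> rfl
    · unfold b br
      rw [altHalf_apply]
      congr 2
      funext t
      dsimp only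
      split_ifs <;> rfl
  have hz2 : ∑ σ : Equiv.Perm.ModSumCongr {t : Fin k // s ≤ t} {t : Fin k // t ≤ s},
      LinearMap.mul' R R (AlternatingMap.domCoprod.summand a b σ (fun x => vec (E x))) = 0 := by
    rw [← hz, ← map_sum]
    unfold Φ
    rw [LinearMap.compAlternatingMap_apply, AlternatingMap.domCoprod_apply, _root_.sum_apply]
  rw [← Finset.add_sum_erase _ _ (@Finset.mem_univ (Equiv.Perm.ModSumCongr {t : Fin k // s ≤ t} {t : Fin k // t ≤ s}) _
    (Quotient.mk'' 1 : Equiv.Perm.ModSumCongr {t : Fin k // s ≤ t} {t : Fin k // t ≤ s}))] at hz2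
  rw [hterm 1] at hz2
  have hid : Equiv.Perm.sign (1 : Equiv.Perm ({t : Fin k // s ≤ t} ⊕ {t : Fin k // t ≤ s})) •
        (br vec (fun t => if h : s ≤ t then E ((1 : Equiv.Perm ({t : Fin k // s ≤ t} ⊕ {t : Fin k // t ≤ s})) (Sum.inl ⟨t, h⟩)) else c t) *
        br vec (fun t => if h : t ≤ s then E ((1 : Equiv.Perm ({t : Fin k // s ≤ t} ⊕ {t : Fin k // t ≤ s})) (Sum.inr ⟨t, h⟩)) else d t)) = br vec c * br vec d := by
    simp [E]
  rw [hid] at hz2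
  rw [eq_neg_of_add_eq_zero_left hz2]
  apply H.neg_mem
  apply H.sum_mem
  intro σq hσq
  induction σq using Quotient.inductionOn' with | _ σ
  rw [hterm]
  have hne : ∃ a0 b0, σ (Sum.inl a0) = Sum.inr b0 := by
    by_contra hcon
    push Not at hcon
    apply (Finset.mem_erase.1 hσq).1
    have hm : σ ∈ (Equiv.Perm.sumCongrHom {t : Fin k // s ≤ t} {t : Fin k // t ≤ s}).range := by
      apply Equiv.Perm.mem_sumCongrHom_range_of_perm_mapsTo_inl
      rintro _ ⟨a0, rfl⟩
      rcases hx : σ (Sum.inl a0) with x | x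
      · exact ⟨x, rfl⟩
      · exact absurd hx (hcon a0 x)
    symm
    apply Quotient.sound'
    rw [QuotientGroup.leftRel_apply]
    simpa using hm
  obtain ⟨a0, b0, hab⟩ := hne
  rw [Units.smul_def]
  apply H.zsmul_mem
  apply AddSubgroup.subset_closure
  refine ⟨_, _, ?_, ?_, ?_, rfl⟩
  · intro t; split_ifs
    · exact hE _
    · exact hQc _
  · intro t; split_ifs
    · exact hE _
    · exact hQd _
  · have hlt := sum_swap_lt σ E (d s) (fun x => lt_of_lt_of_le hs (hc.monotone x.2))
      (fun x => hd.monotone x.2) a0 b0 hab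
    rw [← Fintype.sum_subtype_add_sum_subtype (fun t : Fin k => s ≤ t),
      ← Fintype.sum_subtype_add_sum_subtype (fun t : Fin k => s ≤ t) c]
    apply add_lt_add_of_lt_of_le
    · refine lt_of_eq_of_lt (Finset.sum_congr rfl ?_) hlt
      intro x _
      rw [dif_pos x.2]
    · apply Finset.sum_le_sum
      intro x _
      rw [dif_neg x.2]

lemma br_perm (vec : ℕ → Fin k → R) (c : Fin k → ℕ) (τ : Equiv.Perm (Fin k)) :
    br vec (c ∘ τ) = (Equiv.Perm.sign τ : ℤ) • br vec c := by
  unfold br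
  have := Matrix.det_permute τ (Matrix.of fun t => vec (c t))
  rw [zsmul_eq_mul, ← this]
  rfl

lemma br_eq_zero (vec : ℕ → Fin k → R) {c : Fin k → ℕ} (h : ¬ Function.Injective c) :
    br vec c = 0 := by
  unfold Function.Injective at h
  push Not at h
  obtain ⟨i, j, hij, hne⟩ := h
  unfold br
  apply Matrix.det_zero_of_row_eq hne
  change vec (c i) = vec (c j)
  rw [hij]

lemma straighten_s19 [IsDomain R] (vec : ℕ → Fin k → R) (Q : ℕ → Prop) (W : AddSubgroup R)
    (hW : ∀ c d : Fin k → ℕ, StrictMono c → StrictMono d → (∀ t, Q (c t)) → (∀ t, Q (d t)) →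
      c ≤ d → br vec c * br vec d ∈ W) (N : ℕ) :
    ∀ c d : Fin k → ℕ, (∀ t, Q (c t)) → (∀ t, Q (d t)) → ∑ t, c t = N →
      br vec c * br vec d ∈ W := by
  induction N using Nat.strong_induction_on with
  | _ N ih =>
    intro c d hc hd hN
    by_cases ic : Function.Injective c
    swap
    · rw [br_eq_zero vec ic, zero_mul]; exact W.zero_mem
    by_cases id : Function.Injective d
    swap
    · rw [br_eq_zero vec id, mul_zero]; exact W.zero_mem
    have key : br vec (c ∘ Tuple.sort c) * br vec (d ∘ Tuple.sort d) ∈ W := by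
      have mc : StrictMono (c ∘ Tuple.sort c) :=
        (Tuple.monotone_sort c).strictMono_of_injective (ic.comp (Tuple.sort c).injective)
      have md : StrictMono (d ∘ Tuple.sort d) :=
        (Tuple.monotone_sort d).strictMono_of_injective (id.comp (Tuple.sort d).injective)
      have hc' : ∀ t, Q ((c ∘ Tuple.sort c) t) := fun t => hc _
      have hd' : ∀ t, Q ((d ∘ Tuple.sort d) t) := fun t => hd _
      have hN' : ∑ t, (c ∘ Tuple.sort c) t = N := by
        rw [← hN]; exact Equiv.sum_comp (Tuple.sort c) c
      by_cases hle : c ∘ Tuple.sort c ≤ d ∘ Tuple.sort d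
      · exact hW _ _ mc md hc' hd' hle
      · simp only [Pi.le_def, not_forall, not_le] at hle
        obtain ⟨s, hs⟩ := hle
        refine (AddSubgroup.closure_le W).2 ?_ (garnir vec _ _ mc md s hs Q hc' hd')
        rintro _ ⟨c', d', h1, h2, h3, rfl⟩
        exact ih _ (by omega) c' d' h1 h2 rfl
    rw [br_perm, br_perm, smul_mul_smul_comm] at key
    have h2 := W.zsmul_mem key
      ((Equiv.Perm.sign (Tuple.sort c) : ℤ) * (Equiv.Perm.sign (Tuple.sort d) : ℤ))
    rw [smul_smul] at h2
    have : ((Equiv.Perm.sign (Tuple.sort c) : ℤ) * (Equiv.Perm.sign (Tuple.sort d) : ℤ)) *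
      ((Equiv.Perm.sign (Tuple.sort c) : ℤ) * (Equiv.Perm.sign (Tuple.sort d) : ℤ)) = 1 := by
      rw [mul_mul_mul_comm, ← Units.val_mul, ← Units.val_mul, Int.units_mul_self,
        Int.units_mul_self]
      rfl
    rwa [this, one_smul] at h2

end Garnir

lemma plu_br (J : PlVar n k) : pluMap K n k (X J) =
    br (fun j (r : Fin k) => (X ((r : ℕ) + 1, j) : MvPolynomial (ℕ × ℕ) K)) J.val := by
  unfold pluMap br
  rw [aeval_X, ← Matrix.det_transpose]
  rfl

lemma plu_straighten (I J : PlVar n k) :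
    ∃ q ∈ AddSubgroup.closure {p : MvPolynomial (PlVar n k) K | ∃ A B : PlVar n k,
      A.val ≤ B.val ∧ p = X A * X B}, pluMap K n k (X I * X J - q) = 0 := by
  set H := AddSubgroup.closure {p : MvPolynomial (PlVar n k) K | ∃ A B : PlVar n k,
      A.val ≤ B.val ∧ p = X A * X B} with hH
  have := straighten_s19 (fun j (r : Fin k) => (X ((r : ℕ) + 1, j) : MvPolynomial (ℕ × ℕ) K))
    (fun j => 1 ≤ j ∧ j ≤ n) (H.map (pluMap K n k : _ →+ _)) (by
      intro c d h1 h2 h3 h4 h5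
      let A : PlVar n k := ⟨c, h1, h3⟩
      let B : PlVar n k := ⟨d, h2, h4⟩
      refine ⟨X A * X B, AddSubgroup.subset_closure ⟨A, B, h5, rfl⟩, ?_⟩
      have e : pluMap K n k (X A * X B) = _ := map_mul _ _ _
      rw [plu_br, plu_br] at e
      exact e) _ I.val J.val I.2.2 J.2.2 rfl
  obtain ⟨q, hq, he⟩ := this
  refine ⟨q, hq, ?_⟩
  rw [map_sub, map_mul, plu_br, plu_br, sub_eq_zero]
  exact he.symm


/-- kill the variables outside the interval -/
noncomputable def psi (K : Type*) [Field K] {n k : ℕ} (v w : PlVar n k) :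
    MvPolynomial (PlVar n k) K →ₐ[K] MvPolynomial (TWV v w) K :=
  letI := Classical.propDecidable
  aeval fun J => if h : J ∈ TWV v w then X ⟨J, h⟩ else 0

lemma psi_mem {J : PlVar n k} (h : J ∈ TWV v w) : psi K v w (X J) = X ⟨J, h⟩ := by
  unfold psi
  rw [aeval_X, dif_pos h]

lemma psi_not {J : PlVar n k} (h : J ∉ TWV v w) : psi K v w (X J) = 0 := by
  unfold psi
  rw [aeval_X, dif_neg h]

lemma psi_sub (f : MvPolynomial (PlVar n k) K) :
    rename (fun x : TWV v w => (x : PlVar n k)) (psi K v w f) - f ∈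
      Ideal.span (X '' {J | J ∉ TWV v w} : Set (MvPolynomial (PlVar n k) K)) := by
  rw [← Ideal.Quotient.eq]
  have : ((Ideal.Quotient.mkₐ K (Ideal.span (X '' {J | J ∉ TWV v w} :
      Set (MvPolynomial (PlVar n k) K)))).comp
      (rename (fun x : TWV v w => (x : PlVar n k)))).comp (psi K v w) =
      Ideal.Quotient.mkₐ K _ := by
    ext J : 1
    rw [AlgHom.comp_apply]
    by_cases h : J ∈ TWV v w
    · rw [psi_mem h, AlgHom.comp_apply, rename_X]
    · rw [psi_not h, map_zero]
      symm
      rw [Ideal.Quotient.mkₐ_eq_mk, Ideal.Quotient.eq_zero_iff_mem]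
      exact Ideal.subset_span ⟨J, h, rfl⟩
  exact DFunLike.congr_fun this f

lemma psi_rich {f : MvPolynomial (PlVar n k) K} (hf : pluMap K n k f = 0) :
    psi K v w f ∈ richIdeal K n k v w := by
  unfold richIdeal restrictIdeal
  rw [Ideal.mem_comap]
  have : rename (fun x : TWV v w => (x : PlVar n k)) (psi K v w f) =
    f + (rename (fun x : TWV v w => (x : PlVar n k)) (psi K v w f) - f) := by ring
  rw [this]
  exact Ideal.add_mem _ (Ideal.mem_sup_left hf) (Ideal.mem_sup_right (psi_sub f))

lemma X_mul_X {σ : Type*} (x y : σ) : (X x * X y : MvPolynomial σ K) = monomial (pr x y) 1 := by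
  unfold pr X
  rw [monomial_mul, one_mul]

lemma exists_rich (x y : TWV v w) : ∃ q ∈ StdPoly K v w,
    monomial (pr x y) 1 - q ∈ richIdeal K n k v w := by
  obtain ⟨q, hq, h⟩ := plu_straighten (K := K) x.val y.val
  refine ⟨psi K v w q, ?_, ?_⟩
  · have : AddSubgroup.closure {p : MvPolynomial (PlVar n k) K | ∃ A B : PlVar n k,
      A.val ≤ B.val ∧ p = X A * X B} ≤
      (StdPoly K v w).toAddSubgroup.comap (psi K v w : _ →+ _) := by
      rw [AddSubgroup.closure_le]
      rintro _ ⟨A, B, hAB, rfl⟩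
      change psi K v w (X A * X B) ∈ StdPoly K v w
      rw [map_mul]
      by_cases hA : A ∈ TWV v w
      · by_cases hB : B ∈ TWV v w
        · rw [psi_mem hA, psi_mem hB, X_mul_X]
          exact monomial_mem_StdPoly (Stdm_pr hAB) 1
        · rw [psi_not hB, mul_zero]; exact Submodule.zero_mem _
      · rw [psi_not hA, zero_mul]; exact Submodule.zero_mem _
    exact this hq
  · have h2 := psi_rich (v := v) (w := w) h
    rw [map_sub, map_mul, psi_mem x.2, psi_mem y.2, X_mul_X] at h2
    exact h2

lemma support_initialForm {σ : Type*} (u : σ → ℤ) (f : MvPolynomial σ K) :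
    (initialForm u f).support ⊆ f.support := by
  classical
  unfold initialForm
  intro m hm
  have := MvPolynomial.support_sum hm
  rw [Finset.mem_biUnion] at this
  obtain ⟨a, ha, hma⟩ := this
  rw [Finset.mem_singleton.1 (support_monomial_subset hma)]
  exact (Finset.mem_filter.1 ha).1

lemma initialForm_ne_zero {σ : Type*} (u : σ → ℤ) {f : MvPolynomial σ K} (hf : f ≠ 0) :
    initialForm u f ≠ 0 := by
  classical
  obtain ⟨m0, hm0, hmin⟩ := Finset.exists_min_image f.support (expWt u)
    (MvPolynomial.support_nonempty.2 hf)
  intro h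
  have h2 := congrArg (coeff m0) h
  unfold initialForm at h2
  rw [coeff_sum, coeff_zero, Finset.sum_eq_single m0] at h2
  · rw [coeff_monomial, if_pos rfl] at h2
    exact (MvPolynomial.mem_support_iff.1 hm0) h2
  · intro b _ hb
    rw [coeff_monomial, if_neg hb]
  · intro hn
    exact absurd (Finset.mem_filter.2 ⟨hm0, hmin⟩) hn

lemma hibi_mem (hk : 0 < k) (x y : TWV v w) : hibi K x y ∈
    initialIdeal (fun x : TWV v w => wVec n 0 (x : PlVar n k).val) (richIdeal K n k v w) := by
  classical
  have hstd2 : Stdm (pr (infT x y) (supT x y)) :=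
    Stdm_pr fun s => by rw [ent_infT, ent_supT]; exact min_le_max
  by_cases hs : Stdm (pr x y)
  · have : pr x y = pr (infT x y) (supT x y) := Stdm_inj hk _ _ _ rfl hs hstd2 (Ph_pr x y)
    unfold hibi
    rw [← this, sub_self]
    exact Ideal.zero_mem _
  obtain ⟨q, hq, hg⟩ := exists_rich (K := K) x y
  set g : MvPolynomial (TWV v w) K := monomial (pr x y) 1 - q with hgdef
  set u := (fun x : TWV v w => wVec n 0 (x : PlVar n k).val) with hu
  have hg0 : g ≠ 0 := by
    intro h0
    apply hs
    apply hq
    rw [hgdef, sub_eq_zero] at h0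
    rw [← h0, MvPolynomial.mem_support_iff, coeff_monomial, if_pos rfl]
    exact one_ne_zero
  have hker := initial_mem hg
  set ε := coeff (pr x y) (initialForm u g) with hε
  have hz : initialForm u g - C ε * hibi K x y = 0 := by
    apply StdPoly_ker hk
    · intro m hm
      by_cases hmp : m = pr x y
      · exfalso
        subst hmp
        rw [MvPolynomial.mem_support_iff, coeff_sub, coeff_C_mul, ← hε] at hm
        apply hm
        unfold hibi
        rw [coeff_sub, coeff_monomial, coeff_monomial, if_pos rfl, if_neg]
        · ring
        · intro h; apply hs; rw [← h]; exact hstd2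
      · by_cases hmp2 : m = pr (infT x y) (supT x y)
        · rw [hmp2]; exact hstd2
        · have h1 : coeff m (hibi K x y) = 0 := by
            unfold hibi
            rw [coeff_sub, coeff_monomial, coeff_monomial, if_neg (Ne.symm hmp),
              if_neg (Ne.symm hmp2), sub_zero]
          rw [MvPolynomial.mem_support_iff, coeff_sub, coeff_C_mul, h1, mul_zero, sub_zero,
            ← MvPolynomial.mem_support_iff] at hm
          have h2 := support_initialForm u g hm
          rw [MvPolynomial.mem_support_iff, hgdef, coeff_sub, coeff_monomial,
            if_neg (Ne.symm hmp), zero_sub, neg_ne_zero] at h2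
          exact hq m (MvPolynomial.mem_support_iff.2 h2)
    · rw [map_sub, map_mul, phiT_hibi, mul_zero, sub_zero]
      exact hker
  rw [sub_eq_zero] at hz
  have hε0 : ε ≠ 0 := by
    intro h0
    rw [h0, C_0, zero_mul] at hz
    exact initialForm_ne_zero u hg0 hz
  have : hibi K x y = C ε⁻¹ * initialForm u g := by
    rw [hz, ← mul_assoc, ← C_mul, inv_mul_cancel₀ hε0, C_1, one_mul]
  rw [this]
  exact Ideal.mul_mem_left _ _ (Ideal.subset_span ⟨g, hg, rfl⟩)

end Sub19

/-- For `ℓ = 0` (the diagonal matching field), the three ideals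
`G_{k,n,0}|_w^v`, `in_{w_0}(I(X_w^v))` and `ker(φ_0|_w^v)` are all equal; in particular
they are quadratically generated toric ideals: generated by binomials of degree two and
equal to the kernel of a monomial map. -/
theorem statement_19 (K : Type*) [Field K] (n k : ℕ) (hk : 0 < k) (hkn : k < n)
    (v w : PlVar n k) (hvw : TupLe v.val w.val) :
    restrictIdeal (RingHom.ker (phiMF K n k 0)) (TWV v w) =
        initialIdeal (fun x : TWV v w => wVec n 0 (x : PlVar n k).val)
          (richIdeal K n k v w) ∧
      restrictIdeal (RingHom.ker (phiMF K n k 0)) (TWV v w) =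
        kerPhiRes K n k 0 (TWV v w) ∧
      ∃ S : Set (MvPolynomial (TWV v w) K),
        (∀ g ∈ S, g.IsHomogeneous 2 ∧
          ∃ m₁ m₂ : (TWV v w) →₀ ℕ, g = monomial m₁ (1 : K) - monomial m₂ (1 : K)) ∧
        Ideal.span S = restrictIdeal (RingHom.ker (phiMF K n k 0)) (TWV v w) := by
  have h1 := restrict_phi (K := K) (v := v) (w := w)
  have h2 := ker_phiT (K := K) (v := v) (w := w) hk
  refine ⟨?_, h1, hibiSet K v w, ?_, ?_⟩
  · rw [h1]
    apply le_antisymm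
    · rw [h2, Ideal.span_le]
      rintro _ ⟨x, y, rfl⟩
      exact hibi_mem hk x y
    · unfold initialIdeal
      rw [Ideal.span_le]
      rintro _ ⟨f, hf, rfl⟩
      exact initial_mem hf
  · rintro _ ⟨x, y, rfl⟩
    exact ⟨hibi_homog x y, _, _, rfl⟩
  · rw [h1, h2]
end
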